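/- Let Ω ⊂ ℝ² be a bounded Lipschitz x₁-connected domain and let u ∈ (A ∩ SBV_∞(Ω;ℝ²)) ∪ A∥. Then there exists a sequence (u_ε)_ε ⊂ W^{1,1}(Ω;ℝ²) with u_ε ∈ A_ε for every ε such that u_ε converges weakly* to u in BV(Ω;ℝ²). -/

import Mathlib

open MeasureTheory Set Filter Topology
open scoped ENNReal

noncomputable section

/-- We identify `ℝ²` with maps `Fin 2 → ℝ`; `x 0` is the `x₁` coordinate and
`x 1` the `x₂` coordinate. -/
abbrev V2 := Fin 2 → ℝ

/-- `2 × 2` real matrices. -/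
abbrev Mat2 := Matrix (Fin 2) (Fin 2) ℝ

/-- Proper rotations: `SO(2) = {R : R Rᵀ = 1, det R = 1}`. -/
def SO2 : Set Mat2 := {R | R * R.transpose = 1 ∧ R.det = 1}

def e1 : V2 := ![1, 0]
def e2 : V2 := ![0, 1]

/-- Euclidean norm on `ℝ²`. -/
def vnorm (v : V2) : ℝ := Real.sqrt (v 0 ^ 2 + v 1 ^ 2)

/-- Frobenius norm on `2 × 2` matrices. -/
def mnorm (M : Mat2) : ℝ := Real.sqrt (∑ i, ∑ j, M i j ^ 2)

/-- Euclidean inner product on `ℝ²`. -/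
def dot (v w : V2) : ℝ := ∑ i, v i * w i

/-- Tensor (outer) product `a ⊗ b = a bᵀ` of two vectors. -/
def outer (a b : V2) : Mat2 := Matrix.of fun i j => a i * b j

/-- Identification of `ℝ²` with the Euclidean space `EuclideanSpace ℝ (Fin 2)`. -/
def vToE (v : V2) : EuclideanSpace ℝ (Fin 2) := (EuclideanSpace.equiv (Fin 2) ℝ).symm v

/-- Identification of `2×2` matrices with `EuclideanSpace ℝ (Fin 2 × Fin 2)`
(so that the induced norm is the Frobenius norm). -/
def mToE (M : Mat2) : EuclideanSpace ℝ (Fin 2 × Fin 2) :=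
  (EuclideanSpace.equiv (Fin 2 × Fin 2) ℝ).symm fun p => M p.1 p.2

/-- A vector-valued function of one real variable has bounded variation on `s`
(with respect to the Euclidean norm). -/
def BVv (ψ : ℝ → V2) (s : Set ℝ) : Prop := BoundedVariationOn (fun t => vToE (ψ t)) s

/-- A matrix-valued function of one real variable has bounded variation on `s`
(with respect to the Frobenius norm). -/
def BVm (R : ℝ → Mat2) (s : Set ℝ) : Prop := BoundedVariationOn (fun t => mToE (R t)) s

/-- Componentwise (a.e. pointwise) derivative of a vector-valued function of one variable.
For a one-dimensional `BV` function, the classical derivative exists a.e. and coincides with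
the density of the absolutely continuous part of its distributional derivative
(the approximate derivative). -/
def vecDeriv (ψ : ℝ → V2) (t : ℝ) : V2 := fun i => deriv (fun s => ψ s i) t

/-- Componentwise derivative of a matrix-valued function of one variable. -/
def mDeriv (R : ℝ → Mat2) (t : ℝ) : Mat2 := Matrix.of fun i j => deriv (fun s => R s i j) t

/-- The rigid layers `ε Y_rig = {x : Int.fract (x₂/ε) ∈ [λ, 1)}` (1-periodic extension of
`[0,1) × [λ,1)`, scaled by `ε`). -/
def rigid2 (lam ε : ℝ) : Set V2 := {x | lam ≤ Int.fract (x 1 / ε)}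

/-- The one-dimensional rigid layers `ε I_rig`, where `I_rig` is the 1-periodic extension
of `[λ, 1)`. -/
def rigid1 (lam ε : ℝ) : Set ℝ := {t | lam ≤ Int.fract (t / ε)}

/-- `a_Ω = inf_{x ∈ Ω} x₂`. -/
def aOm (Ω : Set V2) : ℝ := sInf ((fun x : V2 => x 1) '' Ω)

/-- `b_Ω = sup_{x ∈ Ω} x₂`. -/
def bOm (Ω : Set V2) : ℝ := sSup ((fun x : V2 => x 1) '' Ω)

/-- `Ω` is `x₁`-connected: every horizontal slice is a (possibly empty) interval. -/
def X1Connected (Ω : Set V2) : Prop := ∀ t : ℝ, OrdConnected {s : ℝ | ![s, t] ∈ Ω}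

/-- A (nonempty) bounded Lipschitz domain: near every boundary point, after a rotation,
`Ω` is the region above the graph of a Lipschitz function. -/
def IsLipschitzDomain (Ω : Set V2) : Prop :=
  IsOpen Ω ∧ Ω.Nonempty ∧ Bornology.IsBounded Ω ∧
    ∀ x ∈ frontier Ω, ∃ Q ∈ SO2, ∃ L : NNReal, ∃ f : ℝ → ℝ, ∃ r : ℝ, 0 < r ∧
      LipschitzWith L f ∧ ∀ y ∈ Metric.ball x r, (y ∈ Ω ↔ f (Q.mulVec y 0) < Q.mulVec y 1)

/-- Partial derivative `∂_j φ` of a scalar test function. -/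
def pd (j : Fin 2) (φ : V2 → ℝ) (x : V2) : ℝ := fderiv ℝ φ x (Pi.single j 1)

/-- Componentwise integrability of a matrix-valued map. -/
def IntegrableOnM (g : V2 → Mat2) (Ω : Set V2) : Prop :=
  ∀ i j, IntegrableOn (fun x => g x i j) Ω volume

/-- `u ∈ W^{1,1}(Ω;ℝ²)` with weak gradient `gu`, expressed through integration by parts
against smooth compactly supported test functions. -/
structure IsSobolev11On (Ω : Set V2) (u : V2 → V2) (gu : V2 → Mat2) : Prop where
  int_u : IntegrableOn u Ω volume
  int_gu : IntegrableOnM gu Ω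
  ibp : ∀ φ : V2 → ℝ, ContDiff ℝ (⊤ : ℕ∞) φ → HasCompactSupport φ → tsupport φ ⊆ Ω →
    ∀ i j, ∫ x in Ω, u x i * pd j φ x = - ∫ x in Ω, φ x * gu x i j

/-- `u ∈ BV(Ω;ℝ²)`, with distributional derivative `Du = gu · L² + gs · σ`.
Here `gu` is the approximate differential (density of the absolutely continuous part),
`σ = |D^s u|` is the total variation measure of the singular part (a finite measure,
concentrated on `Ω` and singular with respect to Lebesgue measure), and `gs` is the
polar density of the singular part, of unit Frobenius norm `σ`-a.e. -/
structure HasBVDerivOn (Ω : Set V2) (u : V2 → V2) (gu : V2 → Mat2)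
    (σ : Measure V2) (gs : V2 → Mat2) : Prop where
  int_u : IntegrableOn u Ω volume
  int_gu : IntegrableOnM gu Ω
  fin : σ Set.univ ≠ ⊤
  conc : σ Ωᶜ = 0
  perp : σ ⟂ₘ (volume : Measure V2)
  meas_gs : ∀ i j, AEMeasurable (fun x => gs x i j) σ
  unit : ∀ᵐ x ∂σ, mnorm (gs x) = 1
  ibp : ∀ φ : V2 → ℝ, ContDiff ℝ (⊤ : ℕ∞) φ → HasCompactSupport φ → tsupport φ ⊆ Ω →
    ∀ i j, ∫ x in Ω, u x i * pd j φ x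
        = (- ∫ x in Ω, φ x * gu x i j) - ∫ x, φ x * gs x i j ∂σ

/-- `L¹(Ω;ℝ²)` convergence of a sequence. -/
def L1ConvOn (Ω : Set V2) (un : ℕ → V2 → V2) (u : V2 → V2) : Prop :=
  Tendsto (fun n => ∫ x in Ω, vnorm (un n x - u x)) atTop (𝓝 0)

/-- Weak* convergence of the measures `gn n · L²∟Ω` to `gu · L²∟Ω + gs · σ`
in `M(Ω; ℝ^{2×2})`, tested against continuous functions compactly supported in `Ω`. -/
def MeasConv (Ω : Set V2) (gn : ℕ → V2 → Mat2) (gu : V2 → Mat2)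
    (σ : Measure V2) (gs : V2 → Mat2) : Prop :=
  ∀ φ : V2 → ℝ, Continuous φ → HasCompactSupport φ → tsupport φ ⊆ Ω → ∀ i j,
    Tendsto (fun n => ∫ x in Ω, φ x * gn n x i j) atTop
      (𝓝 ((∫ x in Ω, φ x * gu x i j) + ∫ x, φ x * gs x i j ∂σ))

/-- Weak* convergence in `BV(Ω;ℝ²)` of a sequence of `W^{1,1}` maps to a `BV` limit:
`L¹` convergence together with weak* convergence of the derivative measures. -/
def WeakStarToBV (Ω : Set V2) (un : ℕ → V2 → V2) (u : V2 → V2) : Prop :=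
  ∃ gu σ gs, HasBVDerivOn Ω u gu σ gs ∧ L1ConvOn Ω un u ∧
    ∀ gn : ℕ → V2 → Mat2, (∀ n, IsSobolev11On Ω (un n) (gn n)) → MeasConv Ω gn gu σ gs

/-- `u ∈ A_ε`, witnessed by the data `R ∈ L^∞(Ω;SO(2))` and `γ ∈ L¹(Ω)`:
`u ∈ W^{1,1}(Ω;ℝ²)` with `∇u = R (I + γ e₁⊗e₂)` a.e. and `γ = 0` a.e. on `εY_rig ∩ Ω`. -/
structure MemAeps (Ω : Set V2) (lam ε : ℝ) (u : V2 → V2)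
    (R : V2 → Mat2) (γ : V2 → ℝ) : Prop where
  so2 : ∀ᵐ x ∂(volume.restrict Ω), R x ∈ SO2
  int_γ : IntegrableOn γ Ω volume
  sob : IsSobolev11On Ω u fun x => R x * (1 + γ x • outer e1 e2)
  rig : ∀ᵐ x ∂(volume.restrict (Ω ∩ rigid2 lam ε)), γ x = 0

/-- The elastoplastic energy `E_ε(u) = ∫_Ω |γ| dx` for `u ∈ A_ε`, `∞` otherwise,
as an `ℝ≥0∞`-valued functional (the decomposition data is essentially unique). -/
def Eeps (Ω : Set V2) (lam ε : ℝ) (u : V2 → V2) : ℝ≥0∞ :=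
  sInf {c | ∃ R γ, MemAeps Ω lam ε u R γ ∧ c = ∫⁻ x in Ω, ENNReal.ofReal |γ x|}

/-- `u ∈ A` relative to the vertical interval `(a, b)`:
`u ∈ BV(Ω;ℝ²)` with `u(x) = R(x₂)x + ψ(x₂)` a.e., `R ∈ BV(a,b;SO(2))`,
`ψ ∈ BV(a,b;ℝ²)` and `det ∇u = 1` a.e. in `Ω`. -/
def memAOn (Ω : Set V2) (a b : ℝ) (u : V2 → V2) : Prop :=
  ∃ gu σ gs, HasBVDerivOn Ω u gu σ gs ∧
    (∃ R : ℝ → Mat2, ∃ ψ : ℝ → V2, (∀ t ∈ Ioo a b, R t ∈ SO2) ∧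
      BVm R (Ioo a b) ∧ BVv ψ (Ioo a b) ∧
      ∀ᵐ x ∂(volume.restrict Ω), u x = (R (x 1)).mulVec x + ψ (x 1)) ∧
    ∀ᵐ x ∂(volume.restrict Ω), (gu x).det = 1

/-- `u ∈ A`. -/
def memA (Ω : Set V2) (u : V2 → V2) : Prop := memAOn Ω (aOm Ω) (bOm Ω) u

/-- `u ∈ A∥` relative to the vertical interval `(a,b)`:
`u(x) = Rx + ϑ(x₂) R e₁ + c` a.e. with a constant rotation `R ∈ SO(2)`,
`ϑ ∈ BV(a,b)` and `c ∈ ℝ²`. -/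
def memAparOn (Ω : Set V2) (a b : ℝ) (u : V2 → V2) : Prop :=
  ∃ R ∈ SO2, ∃ ϑ : ℝ → ℝ, ∃ c : V2, BoundedVariationOn ϑ (Ioo a b) ∧
    ∀ᵐ x ∂(volume.restrict Ω), u x = R.mulVec x + ϑ (x 1) • R.mulVec e1 + c

/-- `u ∈ A∥`. -/
def memApar (Ω : Set V2) (u : V2 → V2) : Prop := memAparOn Ω (aOm Ω) (bOm Ω) u

/-- The limit energy `E(u) = ∫_Ω |ψ'·Re₁| dx + |D^s u|(Ω)` for `u ∈ A`, `∞` otherwise. -/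
def Efun (Ω : Set V2) (u : V2 → V2) : ℝ≥0∞ :=
  sInf {c | ∃ gu σ gs, HasBVDerivOn Ω u gu σ gs ∧
    ∃ R : ℝ → Mat2, ∃ ψ : ℝ → V2,
      (∀ t ∈ Ioo (aOm Ω) (bOm Ω), R t ∈ SO2) ∧ BVm R (Ioo (aOm Ω) (bOm Ω)) ∧
      BVv ψ (Ioo (aOm Ω) (bOm Ω)) ∧
      (∀ᵐ x ∂(volume.restrict Ω), u x = (R (x 1)).mulVec x + ψ (x 1)) ∧
      (∀ᵐ x ∂(volume.restrict Ω), (gu x).det = 1) ∧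
      c = (∫⁻ x in Ω, ENNReal.ofReal |dot (vecDeriv ψ (x 1)) ((R (x 1)).mulVec e1)|)
          + σ Set.univ}

/-- The limit energy on `A∥`: `E(u) = ∫_Ω |ϑ'(x₂)| dx + |D^s u|(Ω)` for `u ∈ A∥`,
`∞` otherwise. -/
def EparFun (Ω : Set V2) (u : V2 → V2) : ℝ≥0∞ :=
  sInf {c | ∃ gu σ gs, HasBVDerivOn Ω u gu σ gs ∧
    ∃ R ∈ SO2, ∃ ϑ : ℝ → ℝ, ∃ c0 : V2, BoundedVariationOn ϑ (Ioo (aOm Ω) (bOm Ω)) ∧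
      (∀ᵐ x ∂(volume.restrict Ω), u x = R.mulVec x + ϑ (x 1) • R.mulVec e1 + c0) ∧
      c = (∫⁻ x in Ω, ENNReal.ofReal |deriv ϑ (x 1)|) + σ Set.univ}

/-- The regularized limit energy `E^δ(u) = ∫_Ω |ϑ'| dx + |D^s u|(Ω) + δ|Ω|` on `A∥`,
`∞` otherwise. -/
def EDelta (Ω : Set V2) (δ : ℝ) (u : V2 → V2) : ℝ≥0∞ :=
  EparFun Ω u + ENNReal.ofReal δ * volume Ω

/-- `‖v‖_{W^{1,p}(Ω;ℝ²)}^p = ∫_Ω |v|^p + ∫_Ω |Dv|^p` for a map `v` with weak Jacobian `G`. -/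
def Wp1 (p : ℝ) (Ω : Set V2) (v : V2 → V2) (G : V2 → Mat2) : ℝ≥0∞ :=
  (∫⁻ x in Ω, ENNReal.ofReal (vnorm (v x) ^ p)) + ∫⁻ x in Ω, ENNReal.ofReal (mnorm (G x) ^ p)

/-- The regularized energy
`E^δ_ε(u) = ∫_Ω |γ| dx + δ ‖∂₁ u‖_{W^{1,p}(Ω;ℝ²)}^p` for `u ∈ A_ε` with
`∂₁u = R e₁ ∈ W^{1,p}(Ω;ℝ²)`, and `∞` otherwise. -/
def EepsDelta (Ω : Set V2) (lam ε δ p : ℝ) (u : V2 → V2) : ℝ≥0∞ :=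
  sInf {c | ∃ R γ, MemAeps Ω lam ε u R γ ∧
    ∃ G : V2 → Mat2, IsSobolev11On Ω (fun x => (R x).mulVec e1) G ∧
      c = (∫⁻ x in Ω, ENNReal.ofReal |γ x|) +
          ENNReal.ofReal δ * Wp1 p Ω (fun x => (R x).mulVec e1) G}

/-- `x` is an approximate jump point of `u`, with one-sided approximate limits `a ≠ b`
relative to a unit normal `ν`. -/
def JumpPt (u : V2 → V2) (x : V2) : Prop :=
  ∃ a b ν : V2, a ≠ b ∧ vnorm ν = 1 ∧
    Tendsto (fun r : ℝ =>
        (∫⁻ z in {z | z ∈ Metric.ball x r ∧ 0 < dot (z - x) ν},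
            ENNReal.ofReal (vnorm (u z - a))) / volume (Metric.ball x r))
      (𝓝[>] 0) (𝓝 0) ∧
    Tendsto (fun r : ℝ =>
        (∫⁻ z in {z | z ∈ Metric.ball x r ∧ dot (z - x) ν < 0},
            ENNReal.ofReal (vnorm (u z - b))) / volume (Metric.ball x r))
      (𝓝[>] 0) (𝓝 0)

/-- The jump set `J_u` of `u` in `Ω`. -/
def jumpSet (Ω : Set V2) (u : V2 → V2) : Set V2 := {x ∈ Ω | JumpPt u x}

/-- `u ∈ SBV_∞(Ω;ℝ²)`: `u ∈ BV` with singular part concentrated on the jump set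
(no Cantor part), `∇u ∈ L^∞(Ω;ℝ^{2×2})` and `H¹(J_u) < ∞`. -/
def memSBVinf (Ω : Set V2) (u : V2 → V2) : Prop :=
  ∃ gu σ gs, HasBVDerivOn Ω u gu σ gs ∧
    σ {x | ¬ JumpPt u x} = 0 ∧
    (∃ M : ℝ, ∀ᵐ x ∂(volume.restrict Ω), mnorm (gu x) ≤ M) ∧
    Measure.hausdorffMeasure (1 : ℝ) (jumpSet Ω u) ≠ ⊤

/-- Piecewise constant functions on `(a,b)` with finitely many jumps
(the class `PC(a,b)`). -/
def PCOn {α : Type*} (a b : ℝ) (f : ℝ → α) : Prop :=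
  ∃ S : Finset ℝ, ∀ s₁ ∈ Ioo a b, ∀ s₂ ∈ Ioo a b, s₁ ≤ s₂ →
    (∀ r ∈ S, r ∉ Icc s₁ s₂) → f s₁ = f s₂

/-- Piecewise Lipschitz functions on `(a,b)` with finitely many jump points:
the class `SBV_∞(a,b;ℝ²)` of one-dimensional special functions of bounded variation
with bounded derivative and finitely many jumps. -/
def PLipOn (a b : ℝ) (f : ℝ → V2) : Prop :=
  ∃ S : Finset ℝ, ∃ L : ℝ, 0 ≤ L ∧ ∀ s₁ ∈ Ioo a b, ∀ s₂ ∈ Ioo a b, s₁ ≤ s₂ →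
    (∀ r ∈ S, r ∉ Icc s₁ s₂) → vnorm (f s₂ - f s₁) ≤ L * (s₂ - s₁)

/-- The rectangle `Ω = (0,1) × (−1,1)`. -/
def Rect : Set V2 := {x | x 0 ∈ Ioo (0:ℝ) 1 ∧ x 1 ∈ Ioo (-1:ℝ) 1}

/-- `f ∈ W^{1,1}(a,b)`: `f` has an integrable weak derivative on `(a,b)`
(absolutely continuous representative). -/
def IsW11On (f : ℝ → ℝ) (a b : ℝ) : Prop :=
  ∃ g : ℝ → ℝ, IntegrableOn g (Ioo a b) volume ∧
    ∀ s ∈ Ioo a b, ∀ t ∈ Ioo a b, f t - f s = ∫ r in s..t, g r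


/-- Unit vector with angle `θ`. -/
def ev (θ : ℝ) : V2 := ![Real.cos θ, Real.sin θ]
/-- The rotated unit vector. -/
def nv (θ : ℝ) : V2 := ![-Real.sin θ, Real.cos θ]
/-- Rigid motion with angle `θ` and translation `p`. -/
def rig (θ : ℝ) (p : V2) (x : V2) : V2 := p + x 0 • ev θ + x 1 • nv θ

/-- The linear map `Rot(φ) (I + γ e₁ ⊗ e₂)`. -/
def shearD (φ γ : ℝ) : V2 →L[ℝ] V2 :=
  (ContinuousLinearMap.proj (R := ℝ) (φ := fun _ : Fin 2 => ℝ) 0 +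
    γ • ContinuousLinearMap.proj (R := ℝ) (φ := fun _ : Fin 2 => ℝ) 1).smulRight (ev φ)
  + (ContinuousLinearMap.proj (R := ℝ) (φ := fun _ : Fin 2 => ℝ) 1).smulRight (nv φ)

lemma shearD_apply (φ γ : ℝ) (y : V2) :
    shearD φ γ y = (y 0 + γ * y 1) • ev φ + y 1 • nv φ := by
  simp [shearD]

def GoodAt (V : V2 → V2) (x : V2) : Prop := ∃ φ γ, HasFDerivAt V (shearD φ γ) x

structure Piece (L t0 t1 K θ0 : ℝ) (p0 : V2) (θ1 : ℝ) (p1 : V2) (V : V2 → V2) : Prop where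
  hx : ∀ t ∈ Icc t0 t1, ∀ x ∈ Icc (-L) L, ∀ y ∈ Icc (-L) L,
    ‖V ![x, t] - V ![y, t]‖ ≤ |x - y|
  ht : ∀ x ∈ Icc (-L) L, ∀ s ∈ Icc t0 t1, ∀ t ∈ Icc t0 t1,
    ‖V ![x, s] - V ![x, t]‖ ≤ K * |s - t|
  bot : ∀ x ∈ Icc (-L) L, V ![x, t0] = rig θ0 p0 ![x, t0]
  top : ∀ x ∈ Icc (-L) L, V ![x, t1] = rig θ1 p1 ![x, t1]
  good : ∃ N : Set ℝ, N.Countable ∧ ∀ x : V2, x 0 ∈ Ioo (-L) L → x 1 ∈ Ioo t0 t1 → x 1 ∉ N →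
    GoodAt V x

lemma norm_ev (θ : ℝ) : ‖ev θ‖ ≤ 1 := by
  rw [pi_norm_le_iff_of_nonneg zero_le_one]
  intro i
  fin_cases i
  · simpa [ev] using Real.abs_cos_le_one θ
  · simpa [ev] using Real.abs_sin_le_one θ

lemma norm_nv (θ : ℝ) : ‖nv θ‖ ≤ 1 := by
  rw [pi_norm_le_iff_of_nonneg zero_le_one]
  intro i
  fin_cases i
  · simpa [nv] using Real.abs_sin_le_one θ
  · simpa [nv] using Real.abs_cos_le_one θ

lemma Piece.mono {L t0 t1 K K' θ0 θ1 : ℝ} {p0 p1 : V2} {V : V2 → V2}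
    (h : Piece L t0 t1 K θ0 p0 θ1 p1 V) (hK : K ≤ K') : Piece L t0 t1 K' θ0 p0 θ1 p1 V :=
  { h with
    ht := fun x hx s hs t ht => (h.ht x hx s hs t ht).trans
      (mul_le_mul_of_nonneg_right hK (abs_nonneg _)) }

/-- 1D gluing of Lipschitz bounds. -/
lemma glue_lip {f : ℝ → V2} {a b c K : ℝ} (hK : 0 ≤ K)
    (h1 : ∀ s ∈ Icc a b, ∀ t ∈ Icc a b, ‖f s - f t‖ ≤ K * |s - t|)
    (h2 : ∀ s ∈ Icc b c, ∀ t ∈ Icc b c, ‖f s - f t‖ ≤ K * |s - t|) :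
    ∀ s ∈ Icc a c, ∀ t ∈ Icc a c, ‖f s - f t‖ ≤ K * |s - t| := by
  have key : ∀ s ∈ Icc a c, ∀ t ∈ Icc a c, s ≤ t → ‖f s - f t‖ ≤ K * |s - t| := by
    intro s hs t ht hst
    rcases le_total t b with h | h
    · exact h1 s ⟨hs.1, hst.trans h⟩ t ⟨ht.1, h⟩
    rcases le_total b s with h' | h'
    · exact h2 s ⟨h', hs.2⟩ t ⟨h, ht.2⟩
    have e1 := h1 s ⟨hs.1, h'⟩ b ⟨hs.1.trans h', le_rfl⟩
    have e2 := h2 b ⟨le_rfl, h.trans ht.2⟩ t ⟨h, ht.2⟩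
    have : f s - f t = (f s - f b) + (f b - f t) := by abel
    rw [this]
    refine (norm_add_le _ _).trans ((add_le_add e1 e2).trans_eq ?_)
    rw [abs_of_nonpos (by linarith), abs_of_nonpos (by linarith), abs_of_nonpos (by linarith)]
    ring
  intro s hs t ht
  rcases le_total s t with h | h
  · exact key s hs t ht h
  · rw [norm_sub_rev, abs_sub_comm]; exact key t ht s hs h

lemma Piece.trans {L t0 t1 t2 K θ0 θ1 θ2 : ℝ} {p0 p1 p2 : V2} {V W : V2 → V2}
    (hK : 0 ≤ K) (h01 : t0 ≤ t1) (h12 : t1 ≤ t2)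
    (h : Piece L t0 t1 K θ0 p0 θ1 p1 V) (h' : Piece L t1 t2 K θ1 p1 θ2 p2 W) :
    Piece L t0 t2 K θ0 p0 θ2 p2 (fun x => if x 1 ≤ t1 then V x else W x) := by
  have e1 : ∀ x ∈ Icc (-L) L, ∀ t, t ≤ t1 →
      (if (![x, t] : V2) 1 ≤ t1 then V ![x, t] else W ![x, t]) = V ![x, t] := by
    intro x hx t ht; simp [ht]
  have e2 : ∀ x ∈ Icc (-L) L, ∀ t, t1 ≤ t →
      (if (![x, t] : V2) 1 ≤ t1 then V ![x, t] else W ![x, t]) = W ![x, t] := by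
    intro x hx t ht
    rcases ht.eq_or_lt with rfl | ht
    · simp [h.top x hx, h'.bot x hx]
    · simp [not_le.2 ht]
  refine ⟨?_, ?_, ?_, ?_, ?_⟩
  · intro t ht x hx y hy
    rcases le_total t t1 with H | H
    · rw [e1 x hx t H, e1 y hy t H]; exact h.hx t ⟨ht.1, H⟩ x hx y hy
    · rw [e2 x hx t H, e2 y hy t H]; exact h'.hx t ⟨H, ht.2⟩ x hx y hy
  · intro x hx
    refine glue_lip (b := t1) hK ?_ ?_ (f := fun t =>
      (if (![x, t] : V2) 1 ≤ t1 then V ![x, t] else W ![x, t]))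
    · intro s hs t ht
      rw [e1 x hx s hs.2, e1 x hx t ht.2]; exact h.ht x hx s hs t ht
    · intro s hs t ht
      rw [e2 x hx s hs.1, e2 x hx t ht.1]; exact h'.ht x hx s hs t ht
  · intro x hx; rw [e1 x hx t0 h01, h.bot x hx]
  · intro x hx; rw [e2 x hx t2 h12, h'.top x hx]
  · obtain ⟨N, hN, hg⟩ := h.good
    obtain ⟨N', hN', hg'⟩ := h'.good
    refine ⟨insert t1 (N ∪ N'), (hN.union hN').insert t1, ?_⟩
    intro x hx0 hx1 hxN
    simp only [mem_insert_iff, mem_union, not_or] at hxN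
    obtain ⟨hne, hxN, hxN'⟩ := hxN
    rcases lt_or_gt_of_ne hne with H | H
    · obtain ⟨φ, γ, hd⟩ := hg x hx0 ⟨hx1.1, H⟩ hxN
      refine ⟨φ, γ, hd.congr_of_eventuallyEq ?_⟩
      have : ∀ᶠ y : V2 in 𝓝 x, y 1 < t1 :=
        (continuous_apply 1).continuousAt.eventually_lt continuousAt_const H
      filter_upwards [this] with y hy
      simp [hy.le]
    · obtain ⟨φ, γ, hd⟩ := hg' x hx0 ⟨H, hx1.2⟩ hxN'
      refine ⟨φ, γ, hd.congr_of_eventuallyEq ?_⟩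
      have : ∀ᶠ y : V2 in 𝓝 x, t1 < y 1 :=
        continuousAt_const.eventually_lt (continuous_apply 1).continuousAt H
      filter_upwards [this] with y hy
      simp [not_le.2 hy]

/-- bounds from differentiability on the strip. -/
lemma hasDerivAt_x {V : V2 → V2} {φ γ x t : ℝ} (h : HasFDerivAt V (shearD φ γ) ![x, t]) :
    HasDerivAt (fun s => V ![s, t]) (ev φ) x := by
  have h1 : HasDerivAt (fun s : ℝ => (![s, t] : V2)) ![1, 0] x := by
    rw [hasDerivAt_pi]
    intro i
    fin_cases i
    · exact hasDerivAt_id' x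
    · exact hasDerivAt_const x t
  have := h.comp_hasDerivAt x h1
  simpa [shearD_apply, Function.comp_def] using this

lemma hasDerivAt_t {V : V2 → V2} {φ γ x t : ℝ} (h : HasFDerivAt V (shearD φ γ) ![x, t]) :
    HasDerivAt (fun s => V ![x, s]) (γ • ev φ + nv φ) t := by
  have h1 : HasDerivAt (fun s : ℝ => (![x, s] : V2)) ![0, 1] t := by
    rw [hasDerivAt_pi]
    intro i
    fin_cases i
    · exact hasDerivAt_const t x
    · exact hasDerivAt_id' t
  have := h.comp_hasDerivAt t h1
  simpa [shearD_apply, Function.comp_def] using this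

lemma piece_of_deriv {L t0 t1 K θ0 θ1 : ℝ} {p0 p1 : V2} {V : V2 → V2} (φ γ : V2 → ℝ)
    (hV : ∀ x : V2, x 1 ∈ Icc t0 t1 → HasFDerivAt V (shearD (φ x) (γ x)) x)
    (hγ : ∀ x : V2, x 1 ∈ Icc t0 t1 → |γ x| + 1 ≤ K)
    (bot : ∀ x ∈ Icc (-L) L, V ![x, t0] = rig θ0 p0 ![x, t0])
    (top : ∀ x ∈ Icc (-L) L, V ![x, t1] = rig θ1 p1 ![x, t1]) :
    Piece L t0 t1 K θ0 p0 θ1 p1 V := by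
  refine ⟨?_, ?_, bot, top, ⟨∅, countable_empty, ?_⟩⟩
  · intro t ht x hx y hy
    have := convex_univ.norm_image_sub_le_of_norm_hasDerivWithin_le (𝕜 := ℝ) (C := 1)
      (f := fun s => V ![s, t]) (f' := fun s => ev (φ ![s, t])) (x := y) (y := x)
      (fun s _ => (hasDerivAt_x (hV ![s, t] (by simpa using ht))).hasDerivWithinAt)
      (fun s _ => norm_ev _) (mem_univ _) (mem_univ _)
    simpa using this
  · intro x hx s hs t ht
    have := (convex_Icc t0 t1).norm_image_sub_le_of_norm_hasDerivWithin_le (𝕜 := ℝ) (C := K)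
      (f := fun s => V ![x, s]) (f' := fun s => γ ![x, s] • ev (φ ![x, s]) + nv (φ ![x, s]))
      (x := t) (y := s)
      (fun s hs => (hasDerivAt_t (hV ![x, s] (by simpa using hs))).hasDerivWithinAt)
      (fun s hs => ?_) ht hs
    · simpa using this
    · refine (norm_add_le _ _).trans (le_trans ?_ (hγ ![x, s] (by simpa using hs)))
      rw [norm_smul]
      have := norm_ev (φ ![x, s])
      have := norm_nv (φ ![x, s])
      have := mul_le_of_le_one_right (norm_nonneg (γ ![x, s])) (norm_ev (φ ![x, s]))
      rw [Real.norm_eq_abs] at *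
      linarith
  · intro x hx0 hx1 _
    exact ⟨_, _, hV x (Ioo_subset_Icc_self hx1)⟩

lemma hasDerivAt_ev (θ : ℝ) : HasDerivAt ev (nv θ) θ := by
  rw [hasDerivAt_pi]
  intro i
  fin_cases i
  · simpa [ev, nv] using Real.hasDerivAt_cos θ
  · simpa [ev, nv] using Real.hasDerivAt_sin θ

lemma hasDerivAt_nv (θ : ℝ) : HasDerivAt nv (-ev θ) θ := by
  rw [hasDerivAt_pi]
  intro i
  fin_cases i
  · exact (Real.hasDerivAt_sin θ).fun_neg
  · simpa [ev, nv] using Real.hasDerivAt_cos θ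

/-- shear piece -/
lemma shear_piece (L t0 t1 θ s : ℝ) (p : V2) (h : t0 < t1) :
    Piece L t0 t1 (|s| / (t1 - t0) + 1) θ p θ (p + s • ev θ)
      (fun x => p + (x 0 + s / (t1 - t0) * (x 1 - t0)) • ev θ + x 1 • nv θ) := by
  have hh : (t1 - t0) ≠ 0 := (sub_pos.2 h).ne'
  refine piece_of_deriv (fun _ => θ) (fun _ => s / (t1 - t0)) ?_ ?_ ?_ ?_
  · intro x _
    have h0 : HasFDerivAt (fun x : V2 => x 0) (ContinuousLinearMap.proj (R := ℝ) (φ := fun _ : Fin 2 => ℝ) 0) x :=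
      (ContinuousLinearMap.proj (R := ℝ) (φ := fun _ : Fin 2 => ℝ) 0).hasFDerivAt
    have h1 : HasFDerivAt (fun x : V2 => x 1) (ContinuousLinearMap.proj (R := ℝ) (φ := fun _ : Fin 2 => ℝ) 1) x :=
      (ContinuousLinearMap.proj (R := ℝ) (φ := fun _ : Fin 2 => ℝ) 1).hasFDerivAt
    have := (((h0.add ((h1.sub_const t0).const_mul (s / (t1 - t0)))).smul_const (ev θ)).const_add p).add
      (h1.smul_const (nv θ))
    refine this.congr_fderiv ?_
    ext y : 1
    simp [shearD_apply]
  · intro x _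
    rw [abs_div, abs_of_pos (sub_pos.2 h)]
  · intro x _; simp [rig]
  · intro x _
    simp only [rig]
    simp [div_mul_cancel₀ _ hh, add_smul]
    abel

/-- The turning map. -/
def turnβ (D c m k : ℝ) (x : V2) : ℝ := max 0 (min D ((x 0 + m * x 1 + k) / (x 1 + c)))

def turnV (Z : V2) (θ D c m k : ℝ) (x : V2) : V2 :=
  Z + (x 1 + c) • nv (θ - turnβ D c m k x) +
    (x 0 + m * x 1 + k - (x 1 + c) * turnβ D c m k x) • ev (θ - turnβ D c m k x)

def turnF (Z : V2) (θ c m k : ℝ) (q : V2 × ℝ) : V2 :=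
  Z + (q.1 1 + c) • nv (θ - q.2) +
    (q.1 0 + m * q.1 1 + k - (q.1 1 + c) * q.2) • ev (θ - q.2)

lemma turnF_deriv (Z : V2) (θ c m k : ℝ) (q : V2 × ℝ) :
    HasFDerivAt (turnF Z θ c m k)
      ((shearD (θ - q.2) (m - q.2)).comp (ContinuousLinearMap.fst ℝ V2 ℝ) -
       (q.1 0 + m * q.1 1 + k - (q.1 1 + c) * q.2) •
        (ContinuousLinearMap.snd ℝ V2 ℝ).smulRight (nv (θ - q.2))) q := by
  have h0 : HasFDerivAt (fun q : V2 × ℝ => q.1 0)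
      ((ContinuousLinearMap.proj (R := ℝ) (φ := fun _ : Fin 2 => ℝ) 0).comp (ContinuousLinearMap.fst ℝ V2 ℝ)) q :=
    ((ContinuousLinearMap.proj (R := ℝ) (φ := fun _ : Fin 2 => ℝ) 0).comp (ContinuousLinearMap.fst ℝ V2 ℝ)).hasFDerivAt
  have h1 : HasFDerivAt (fun q : V2 × ℝ => q.1 1)
      ((ContinuousLinearMap.proj (R := ℝ) (φ := fun _ : Fin 2 => ℝ) 1).comp (ContinuousLinearMap.fst ℝ V2 ℝ)) q :=
    ((ContinuousLinearMap.proj (R := ℝ) (φ := fun _ : Fin 2 => ℝ) 1).comp (ContinuousLinearMap.fst ℝ V2 ℝ)).hasFDerivAt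
  have h2 : HasFDerivAt (fun q : V2 × ℝ => q.2) (ContinuousLinearMap.snd ℝ V2 ℝ) q :=
    (ContinuousLinearMap.snd ℝ V2 ℝ).hasFDerivAt
  have he : HasFDerivAt (fun q : V2 × ℝ => ev (θ - q.2)) _ q :=
    HasFDerivAt.comp q (f := fun q : V2 × ℝ => θ - q.2) (hasDerivAt_ev (θ - q.2)).hasFDerivAt (h2.const_sub θ)
  have hn : HasFDerivAt (fun q : V2 × ℝ => nv (θ - q.2)) _ q :=
    HasFDerivAt.comp q (f := fun q : V2 × ℝ => θ - q.2) (hasDerivAt_nv (θ - q.2)).hasFDerivAt (h2.const_sub θ)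
  have := ((((h1.add_const c).smul hn).const_add Z).add
    ((((h0.add (h1.const_mul m)).add_const k).sub ((h1.add_const c).mul h2)).smul he))
  refine this.congr_fderiv ?_
  refine ContinuousLinearMap.ext fun y => ?_
  simp [shearD_apply]
  module

lemma turnβ_mem (D c m k : ℝ) (x : V2) (hD : 0 ≤ D) : turnβ D c m k x ∈ Icc 0 D :=
  ⟨le_max_left _ _, max_le hD (min_le_left _ _)⟩

lemma turnV_deriv (Z : V2) (θ D c m k : ℝ) (x : V2) (hτ : 0 < x 1 + c) (hD : 0 ≤ D) :
    HasFDerivAt (turnV Z θ D c m k)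
      (shearD (θ - turnβ D c m k x) (m - turnβ D c m k x)) x := by
  set β := turnβ D c m k with hβ
  set r : V2 → ℝ := fun y => (y 0 + m * y 1 + k) / (y 1 + c) with hr
  have hrd : DifferentiableAt ℝ r x := by
    have h1 : DifferentiableAt ℝ (fun y : V2 => y 0 + m * y 1 + k) x := by fun_prop
    have h2 : DifferentiableAt ℝ (fun y : V2 => y 1 + c) x := by fun_prop
    have h3 : (fun y : V2 => y 1 + c) x ≠ 0 := hτ.ne'
    simp only [hr, div_eq_mul_inv]
    exact h1.fun_mul (h2.fun_inv h3)
  have hO : (fun y => r y - r x) =O[𝓝 x] (fun y => y - x) := hrd.hasFDerivAt.isBigO_sub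
  have hβr : ∀ y, |β y - β x| ≤ |r y - r x| := by
    intro y
    have h1 := abs_max_sub_max_le_abs (min D (r y)) (min D (r x)) 0
    have h2 := abs_min_sub_min_le_max D (r y) D (r x)
    simp only [sub_self, abs_zero] at h2
    rw [max_eq_right (abs_nonneg _)] at h2
    have : β y - β x = max (min D (r y)) 0 - max (min D (r x)) 0 := by
      simp only [hβ, turnβ, hr, max_comm]
    rw [this]
    exact h1.trans h2
  have hβO : (fun y => β y - β x) =O[𝓝 x] (fun y => y - x) :=
    (Asymptotics.isBigO_of_le _ (fun y => by simpa [Real.norm_eq_abs] using hβr y)).trans hO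
  have hβc : Tendsto (fun y => (y, β y)) (𝓝 x) (𝓝 (x, β x)) := by
    refine tendsto_id.prodMk_nhds ?_
    rw [tendsto_iff_norm_sub_tendsto_zero]
    refine squeeze_zero (fun _ => norm_nonneg _) (fun y => hβr y) ?_
    have := hrd.continuousAt.tendsto
    rw [tendsto_iff_norm_sub_tendsto_zero] at this
    exact this
  have hF := (turnF_deriv Z θ c m k (x, β x)).isLittleO.comp_tendsto hβc
  have hstat : ∀ᶠ y in 𝓝 x, (x 0 + m * x 1 + k - (x 1 + c) * β x) * (β y - β x) = 0 := by
    have hg : x 0 + m * x 1 + k = (x 1 + c) * r x := by simp only [hr]; field_simp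
    rcases lt_or_ge (r x) 0 with h | h
    · have : ∀ᶠ y in 𝓝 x, r y < 0 := hrd.continuousAt.eventually_lt continuousAt_const h
      filter_upwards [this] with y hy
      have e1 : β y = 0 := max_eq_left ((min_le_right _ _).trans hy.le)
      have e2 : β x = 0 := max_eq_left ((min_le_right _ _).trans h.le)
      rw [e1, e2]; ring
    rcases le_or_gt (r x) D with h' | h'
    · have e2 : β x = r x := by
        have : min D (r x) = r x := min_eq_right h'
        change max 0 (min D (r x)) = r x
        rw [this, max_eq_right h]
      filter_upwards with y
      rw [hg, e2]; ring
    · have : ∀ᶠ y in 𝓝 x, D < r y := continuousAt_const.eventually_lt hrd.continuousAt h'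
      filter_upwards [this] with y hy
      have e : ∀ y, D < r y → β y = D := by
        intro y hy
        change max 0 (min D (r y)) = D
        rw [min_eq_left hy.le, max_eq_right hD]
      rw [e y hy, e x h']; ring
  rw [hasFDerivAt_iff_isLittleO]
  refine Asymptotics.IsLittleO.congr' (hF.trans_isBigO ?_) ?_ EventuallyEq.rfl
    (f₁ := _) (f₂ := fun y => turnV Z θ D c m k y - turnV Z θ D c m k x -
      (shearD (θ - β x) (m - β x)) (y - x))
  · exact (Asymptotics.isBigO_refl (fun y => y - x) (𝓝 x)).prod_left hβO
  · filter_upwards [hstat] with y hy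
    simp only [Function.comp, sub_apply,
      ContinuousLinearMap.comp_apply, smul_apply,
      ContinuousLinearMap.smulRight_apply, ContinuousLinearMap.coe_fst',
      ContinuousLinearMap.coe_snd', Prod.fst_sub, Prod.snd_sub, smul_smul]
    rw [hy, zero_smul, sub_zero]
    rfl



lemma turn_piece (L t0 t1 θ D c : ℝ) (p : V2) (h : t0 < t1) (hc : 1 ≤ t0 + c) (hD : 0 ≤ D)
    (hL : 0 ≤ L) :
    ∃ V, Piece L t0 t1 (((t1 + c) * D + 2 * L) / (t1 - t0) + D + 1) θ p (θ - D)
      (p - c • nv θ + L • ev θ + c • nv (θ - D) + L • ev (θ - D)) V := by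
  have hh : 0 < t1 - t0 := sub_pos.2 h
  set m := ((t1 + c) * D + 2 * L) / (t1 - t0) with hm
  have hm0 : 0 ≤ m := by
    apply div_nonneg _ hh.le
    have : 0 ≤ (t1 + c) * D := mul_nonneg (by linarith) hD
    linarith
  have hmh : m * (t1 - t0) = (t1 + c) * D + 2 * L := div_mul_cancel₀ _ hh.ne'
  set Z := p - c • nv θ + L • ev θ with hZ
  refine ⟨turnV Z θ D c m (-L - m * t0), ?_⟩
  refine piece_of_deriv (fun x => θ - turnβ D c m (-L - m * t0) x)
    (fun x => m - turnβ D c m (-L - m * t0) x) ?_ ?_ ?_ ?_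
  · intro x hx
    exact turnV_deriv Z θ D c m _ x (by linarith [hx.1]) hD
  · intro x hx
    have := turnβ_mem D c m (-L - m * t0) x hD
    have : |m - turnβ D c m (-L - m * t0) x| ≤ m + D := by
      rw [abs_le]; constructor <;> linarith [this.1, this.2]
    linarith
  · intro x hx
    have hb : turnβ D c m (-L - m * t0) ![x, t0] = 0 := by
      apply max_eq_left
      refine (min_le_right _ _).trans ?_
      apply div_nonpos_of_nonpos_of_nonneg
      · simp; linarith [hx.2]
      · simp; linarith
    simp only [turnV, hb, rig]
    simp only [Matrix.cons_val_zero, Matrix.cons_val_one, sub_zero, mul_zero, hZ]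
    have : x + m * t0 + (-L - m * t0) = x - L := by ring
    rw [this]
    module
  · intro x hx
    have hb : turnβ D c m (-L - m * t0) ![x, t1] = D := by
      unfold turnβ
      rw [min_eq_left, max_eq_right hD]
      rw [le_div_iff₀]
      · simp; nlinarith [hx.1]
      · simp; linarith
    simp only [turnV, hb, rig]
    simp only [Matrix.cons_val_zero, Matrix.cons_val_one]
    have : x + m * t1 + (-L - m * t0) - (t1 + c) * D = x + L := by linarith
    rw [this]
    module

lemma Piece.congr {L t0 t1 K θ0 θ1 θ1' : ℝ} {p0 p1 p1' : V2} {V : V2 → V2}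
    (h : Piece L t0 t1 K θ0 p0 θ1 p1 V) (he : ev θ1 = ev θ1') (hn : nv θ1 = nv θ1')
    (hp : p1 = p1') : Piece L t0 t1 K θ0 p0 θ1' p1' V :=
  { h with
    top := fun x hx => by rw [h.top x hx]; simp only [rig, he, hn, hp] }

lemma nv_sub_pi_div_two (θ : ℝ) : ev (θ - Real.pi / 2) = - nv θ := by
  ext i; fin_cases i <;> simp [ev, nv, Real.cos_sub_pi_div_two, Real.sin_sub_pi_div_two]

lemma ev_decomp (θ : ℝ) (W : V2) :
    W = (W 0 * Real.cos θ + W 1 * Real.sin θ) • ev θ +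
      (- (- W 0 * Real.sin θ + W 1 * Real.cos θ)) • (- nv θ) := by
  have := Real.sin_sq_add_cos_sq θ
  ext i; fin_cases i
  · simp [ev, nv]; linear_combination (- W 0) * this
  · simp [ev, nv]; linear_combination (- W 1) * this

lemma connection (L B H : ℝ) (hL : 0 ≤ L) (hB : 0 ≤ B) (hH : 0 ≤ H) :
    ∃ C : ℝ, 0 ≤ C ∧ ∀ t0 t1 θ0 θ1 : ℝ, ∀ p0 p1 : V2, t0 < t1 → t1 - t0 ≤ H → |t0| ≤ B → ‖p0‖ ≤ B →
      ‖p1‖ ≤ B → ∃ V, Piece L t0 t1 (C / (t1 - t0)) θ0 p0 θ1 p1 V := by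
  set Wb := 2 * B + 2 * (1 + B) + L with hWb
  set S := 2 * Wb + 2 * L with hS
  have hpi := Real.pi_pos
  set C := 4 * (((1 + H) * (2 * Real.pi) + 2 * L) + (1 + 2 * Real.pi) * H + S) with hC
  refine ⟨C, by positivity, ?_⟩
  intro t0 t1 θ0 θ1 p0 p1 ht hH' ht0 hp0 hp1
  have hh : 0 < t1 - t0 := sub_pos.2 ht
  set q := (t1 - t0) / 4 with hq
  have hq0 : 0 < q := by positivity
  set c := 1 - t0 with hc
  set m := θ0 - Real.pi / 2 with hm
  set D' := toIcoMod Real.two_pi_pos 0 (m - θ1) with hD'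
  have hD'mem : D' ∈ Ico 0 (0 + 2 * Real.pi) := toIcoMod_mem_Ico _ _ _
  have hD'eq : m - D' = θ1 + (toIcoDiv Real.two_pi_pos 0 (m - θ1)) * (2 * Real.pi) := by
    have := toIcoMod_add_toIcoDiv_zsmul Real.two_pi_pos 0 (m - θ1)
    rw [← hD', zsmul_eq_mul] at this
    linarith
  have hev : ev (m - D') = ev θ1 := by
    rw [hD'eq]; simp only [ev, Real.cos_add_int_mul_two_pi, Real.sin_add_int_mul_two_pi]
  have hnv : nv (m - D') = nv θ1 := by
    rw [hD'eq]; simp only [nv, Real.cos_add_int_mul_two_pi, Real.sin_add_int_mul_two_pi]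
  set W := p1 - c • nv θ1 - p0 + c • nv θ0 - L • ev θ1 with hW
  have hWn : ‖W‖ ≤ Wb := by
    have hc' : ‖c‖ ≤ 1 + B := by
      rw [Real.norm_eq_abs, hc]; rw [abs_le] at *; constructor <;> linarith [ht0.1, ht0.2]
    have e1 : ‖c • nv θ1‖ ≤ 1 + B := by
      rw [norm_smul]; nlinarith [norm_nv θ1, norm_nonneg (nv θ1), norm_nonneg c]
    have e2 : ‖c • nv θ0‖ ≤ 1 + B := by
      rw [norm_smul]; nlinarith [norm_nv θ0, norm_nonneg (nv θ0), norm_nonneg c]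
    have e3 : ‖L • ev θ1‖ ≤ L := by
      rw [norm_smul, Real.norm_of_nonneg hL]; nlinarith [norm_ev θ1, norm_nonneg (ev θ1)]
    have f1 := norm_sub_le (p1 - c • nv θ1 - p0 + c • nv θ0) (L • ev θ1)
    have f2 := norm_add_le (p1 - c • nv θ1 - p0) (c • nv θ0)
    have f3 := norm_sub_le (p1 - c • nv θ1) p0
    have f4 := norm_sub_le p1 (c • nv θ1)
    rw [hW, hWb]; linarith
  have hW0 : |W 0| ≤ Wb := (norm_le_pi_norm W 0).trans hWn
  have hW1 : |W 1| ≤ Wb := (norm_le_pi_norm W 1).trans hWn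
  have prod_bd : ∀ a b : ℝ, |a| ≤ Wb → |b| ≤ 1 → |a * b| ≤ Wb := by
    intro a b ha hb; rw [abs_mul]; nlinarith [abs_nonneg a, abs_nonneg b]
  set s0 := (W 0 * Real.cos θ0 + W 1 * Real.sin θ0) - L with hs0
  set s1 := (- (- W 0 * Real.sin θ0 + W 1 * Real.cos θ0)) - 2 * L with hs1
  have hs0b : |s0| ≤ S := by
    have a1 := abs_le.1 (prod_bd _ _ hW0 (Real.abs_cos_le_one θ0))
    have a2 := abs_le.1 (prod_bd _ _ hW1 (Real.abs_sin_le_one θ0))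
    rw [abs_le]; constructor <;> linarith [a1.1, a1.2, a2.1, a2.2]
  have hs1b : |s1| ≤ S := by
    have a1 := abs_le.1 (prod_bd _ _ hW1 (Real.abs_cos_le_one θ0))
    have a2 := abs_le.1 (prod_bd _ _ hW0 (Real.abs_sin_le_one θ0))
    rw [abs_le]; constructor <;> linarith [a1.1, a1.2, a2.1, a2.2]
  have hdec : W = (s0 + L) • ev θ0 + (s1 + 2 * L) • ev m := by
    have := ev_decomp θ0 W
    rw [hm, nv_sub_pi_div_two]
    rw [hs0, hs1, sub_add_cancel, sub_add_cancel]
    exact this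
  have hCq : C / (t1 - t0) = (C / 4) / q := by rw [hq]; field_simp
  have hqH : q ≤ H := by rw [hq]; linarith
  have shK : ∀ s a : ℝ, |s| ≤ S → |s| / (a + q - a) + 1 ≤ C / (t1 - t0) := by
    intro s a hs
    rw [hCq, add_sub_cancel_left, div_add_one hq0.ne']
    apply div_le_div_of_nonneg_right _ hq0.le
    rw [hC]
    have : 0 ≤ (1 + H) * (2 * Real.pi) := by positivity
    have : 0 ≤ Real.pi * H := by positivity
    nlinarith
  have tuK : ∀ D a : ℝ, 0 ≤ D → D ≤ 2 * Real.pi → a + q ≤ t1 → t0 ≤ a →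
      ((a + q + c) * D + 2 * L) / (a + q - a) + D + 1 ≤ C / (t1 - t0) := by
    intro D a hD hD2 ha ha0
    rw [hCq, add_sub_cancel_left, div_add' _ _ _ hq0.ne', div_add_one hq0.ne']
    apply div_le_div_of_nonneg_right _ hq0.le
    rw [hC]
    have h1 : (a + q + c) * D ≤ (1 + H) * (2 * Real.pi) := by
      apply mul_le_mul _ hD2 hD (by linarith)
      rw [hc]; linarith
    have h2 : D * q ≤ (2 * Real.pi) * H := mul_le_mul hD2 hqH hq0.le (by positivity)
    have : 0 ≤ S := (abs_nonneg _).trans hs0b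
    nlinarith
  have hK : 0 ≤ C / (t1 - t0) := by positivity
  have P1 := (shear_piece L t0 (t0 + q) θ0 s0 p0 (by linarith)).mono (shK s0 t0 hs0b)
  obtain ⟨V2', P2⟩ := turn_piece L (t0 + q) (t0 + q + q) θ0 (Real.pi / 2) c (p0 + s0 • ev θ0)
    (by linarith) (by rw [hc]; linarith) (by positivity) hL
  have P2 := P2.mono (tuK _ _ (by positivity) (by linarith) (by rw [hq]; linarith) (by linarith))
  rw [← hm] at P2
  have P3 := (shear_piece L (t0 + q + q) (t0 + q + q + q) m s1
    (p0 + s0 • ev θ0 - c • nv θ0 + L • ev θ0 + c • nv m + L • ev m) (by linarith)).mono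
    (shK s1 _ hs1b)
  obtain ⟨V4, P4⟩ := turn_piece L (t0 + q + q + q) (t0 + q + q + q + q) m D' c
    (p0 + s0 • ev θ0 - c • nv θ0 + L • ev θ0 + c • nv m + L • ev m + s1 • ev m)
    (by linarith) (by rw [hc]; linarith) hD'mem.1 hL
  have P4 := P4.mono (tuK _ _ hD'mem.1 (by linarith [hD'mem.2]) (by rw [hq]; linarith) (by linarith))
  have P := (P1.trans hK (by linarith) (by linarith) P2).trans hK (by linarith) (by linarith) P3
  have P := P.trans hK (by linarith) (by linarith) P4
  have e : t0 + q + q + q + q = t1 := by rw [hq]; ring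
  rw [e] at P
  refine ⟨_, P.congr hev hnv ?_⟩
  rw [hev, hnv]
  have : p1 = W + c • nv θ1 + p0 - c • nv θ0 + L • ev θ1 := by rw [hW]; module
  rw [this, hdec]
  module


structure GlobData (L lam ε : ℝ) (θ : ℤ → ℝ) (p : ℤ → V2) (V : ℤ → V2 → V2) (K : ℤ → ℝ) : Prop where
  hlam0 : 0 < lam
  hlam1 : lam < 1
  hε : 0 < ε
  piece : ∀ k : ℤ, Piece L (ε * k) (ε * k + lam * ε) (K k) (θ (k-1)) (p (k-1)) (θ k) (p k) (V k)
  K1 : ∀ k, 1 ≤ K k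

def glob (lam ε : ℝ) (θ : ℤ → ℝ) (p : ℤ → V2) (V : ℤ → V2 → V2) (x : V2) : V2 :=
  if Int.fract (x 1 / ε) < lam then V ⌊x 1 / ε⌋ x else rig (θ ⌊x 1 / ε⌋) (p ⌊x 1 / ε⌋) x

lemma floor_strip {ε t : ℝ} (hε : 0 < ε) {k : ℤ} (h0 : ε * k ≤ t) (h1 : t < ε * (k + 1)) :
    ⌊t / ε⌋ = k := by
  rw [Int.floor_eq_iff]
  constructor
  · rw [le_div_iff₀ hε]; linarith
  · rw [div_lt_iff₀ hε]; linarith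

lemma fract_strip {ε t lam : ℝ} (hε : 0 < ε) {k : ℤ} (h0 : ε * k ≤ t) (h1 : t < ε * (k + 1)) :
    Int.fract (t / ε) < lam ↔ t < ε * k + lam * ε := by
  have := Int.self_sub_floor (t / ε)
  rw [← this, floor_strip hε h0 h1, sub_lt_iff_lt_add, div_lt_iff₀ hε]
  constructor <;> intro h <;> linarith

lemma mem_strip {ε : ℝ} (hε : 0 < ε) (t : ℝ) :
    ε * ⌊t / ε⌋ ≤ t ∧ t < ε * (⌊t / ε⌋ + 1) := by
  constructor
  · have := Int.floor_le (t / ε); rw [le_div_iff₀ hε] at this; linarith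
  · have := Int.lt_floor_add_one (t / ε); rw [div_lt_iff₀ hε] at this; linarith

lemma rig_x (θ : ℝ) (p : V2) (x y t : ℝ) :
    ‖rig θ p ![x, t] - rig θ p ![y, t]‖ ≤ |x - y| := by
  have : rig θ p ![x, t] - rig θ p ![y, t] = (x - y) • ev θ := by
    simp only [rig, Matrix.cons_val_zero, Matrix.cons_val_one]; module
  rw [this, norm_smul, Real.norm_eq_abs]
  exact mul_le_of_le_one_right (abs_nonneg _) (norm_ev θ)

lemma rig_t (θ : ℝ) (p : V2) (x s t : ℝ) :
    ‖rig θ p ![x, s] - rig θ p ![x, t]‖ ≤ |s - t| := by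
  have : rig θ p ![x, s] - rig θ p ![x, t] = (s - t) • nv θ := by
    simp only [rig, Matrix.cons_val_zero, Matrix.cons_val_one]; module
  rw [this, norm_smul, Real.norm_eq_abs]
  exact mul_le_of_le_one_right (abs_nonneg _) (norm_nv θ)

lemma rig_deriv (θ : ℝ) (p x : V2) : HasFDerivAt (rig θ p) (shearD θ 0) x := by
  have h0 : HasFDerivAt (fun x : V2 => x 0) (ContinuousLinearMap.proj (R := ℝ) (φ := fun _ : Fin 2 => ℝ) 0) x :=
    (ContinuousLinearMap.proj (R := ℝ) (φ := fun _ : Fin 2 => ℝ) 0).hasFDerivAt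
  have h1 : HasFDerivAt (fun x : V2 => x 1) (ContinuousLinearMap.proj (R := ℝ) (φ := fun _ : Fin 2 => ℝ) 1) x :=
    (ContinuousLinearMap.proj (R := ℝ) (φ := fun _ : Fin 2 => ℝ) 1).hasFDerivAt
  have := ((h0.smul_const (ev θ)).const_add p).add (h1.smul_const (nv θ))
  refine this.congr_fderiv ?_
  refine ContinuousLinearMap.ext fun y => ?_
  simp [shearD_apply]

namespace GlobData
variable {L lam ε : ℝ} {θ : ℤ → ℝ} {p : ℤ → V2} {V : ℤ → V2 → V2} {K : ℤ → ℝ}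

lemma soft (h : GlobData L lam ε θ p V K) (k : ℤ) {x t : ℝ} (hx : x ∈ Icc (-L) L)
    (h0 : ε * k ≤ t) (h1 : t ≤ ε * k + lam * ε) : glob lam ε θ p V ![x, t] = V k ![x, t] := by
  have hε := h.hε
  have hl : lam * ε < ε := by nlinarith [h.hlam1]
  have h1' : t < ε * (k + 1) := by linarith
  have e1 : (![x, t] : V2) 1 = t := by simp
  unfold glob
  rw [e1, floor_strip hε h0 h1']
  rcases h1.eq_or_lt with rfl | h2
  · rw [if_neg]
    · exact ((h.piece k).top x hx).symm
    · rw [fract_strip hε h0 h1']; simp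
  · rw [if_pos]
    rwa [fract_strip hε h0 h1']

lemma rigid (h : GlobData L lam ε θ p V K) (k : ℤ) {x t : ℝ} (hx : x ∈ Icc (-L) L)
    (h0 : ε * k + lam * ε ≤ t) (h1 : t ≤ ε * (k + 1)) :
    glob lam ε θ p V ![x, t] = rig (θ k) (p k) ![x, t] := by
  have hε := h.hε
  have hl : 0 < lam * ε := mul_pos h.hlam0 hε
  have e1 : (![x, t] : V2) 1 = t := by simp
  rcases h1.eq_or_lt with h2 | h2
  · have hc : ε * ((k + 1 : ℤ) : ℝ) = t := by push_cast; linarith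
    rw [h.soft (k + 1) hx hc.le (by linarith)]
    have := (h.piece (k + 1)).bot x hx
    rw [hc] at this
    simpa using this
  · unfold glob
    rw [e1, floor_strip hε (by linarith) h2, if_neg]
    rw [fract_strip hε (by linarith) h2]; linarith

lemma hx (h : GlobData L lam ε θ p V K) (t x y : ℝ) (hx : x ∈ Icc (-L) L) (hy : y ∈ Icc (-L) L) :
    ‖glob lam ε θ p V ![x, t] - glob lam ε θ p V ![y, t]‖ ≤ |x - y| := by
  obtain ⟨h0, h1⟩ := mem_strip h.hε t
  set k := ⌊t / ε⌋
  rcases le_total t (ε * k + lam * ε) with H | H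
  · rw [h.soft k hx h0 H, h.soft k hy h0 H]
    exact (h.piece k).hx t ⟨h0, H⟩ x hx y hy
  · rw [h.rigid k hx H h1.le, h.rigid k hy H h1.le]
    exact rig_x _ _ _ _ _

lemma ht_strip (h : GlobData L lam ε θ p V K) (k : ℤ) (x : ℝ) (hx : x ∈ Icc (-L) L) :
    ∀ s ∈ Icc (ε * k) (ε * (k + 1)), ∀ t ∈ Icc (ε * k) (ε * (k + 1)),
    ‖glob lam ε θ p V ![x, s] - glob lam ε θ p V ![x, t]‖ ≤ K k * |s - t| := by
  have hK := h.K1 k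
  refine glue_lip (b := ε * k + lam * ε) (by linarith) ?_ ?_
    (f := fun t => glob lam ε θ p V ![x, t])
  · intro s hs t ht
    rw [h.soft k hx hs.1 hs.2, h.soft k hx ht.1 ht.2]
    exact (h.piece k).ht x hx s hs t ht
  · intro s hs t ht
    rw [h.rigid k hx hs.1 hs.2, h.rigid k hx ht.1 ht.2]
    exact (rig_t _ _ _ _ _).trans (le_mul_of_one_le_left (abs_nonneg _) hK)

lemma ht (h : GlobData L lam ε θ p V K) {Kb : ℝ} (hKb : ∀ k, K k ≤ Kb) (x : ℝ)
    (hx : x ∈ Icc (-L) L) (s t : ℝ) :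
    ‖glob lam ε θ p V ![x, s] - glob lam ε θ p V ![x, t]‖ ≤ Kb * |s - t| := by
  have hε := h.hε
  have hKb0 : 0 ≤ Kb := by linarith [h.K1 0, hKb 0]
  have key : ∀ (k : ℤ) (n : ℕ), ∀ s ∈ Icc (ε * k) (ε * (k + n)), ∀ t ∈ Icc (ε * k) (ε * (k + n)),
    ‖glob lam ε θ p V ![x, s] - glob lam ε θ p V ![x, t]‖ ≤ Kb * |s - t| := by
    intro k n
    induction n with
    | zero =>
      intro s hs t ht
      simp only [Nat.cast_zero, add_zero, Icc_self, mem_singleton_iff] at hs ht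
      rw [hs, ht]; simp
    | succ n ih =>
      refine glue_lip (b := ε * (k + n)) hKb0 ih ?_ (f := fun t => glob lam ε θ p V ![x, t])
      intro s hs t ht
      have := h.ht_strip (k + n) x hx s (by push_cast at *; rwa [add_assoc]) t
        (by push_cast at *; rwa [add_assoc])
      exact this.trans (mul_le_mul_of_nonneg_right (hKb _) (abs_nonneg _))
  have hh := mem_strip hε (min s t)
  obtain ⟨n, hn⟩ := exists_nat_gt (max s t / ε - ⌊(min s t) / ε⌋)
  have hn' : max s t ≤ ε * (⌊(min s t) / ε⌋ + n) := by
    have : max s t / ε < ⌊(min s t) / ε⌋ + n := by linarith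
    rw [div_lt_iff₀ hε] at this; linarith
  exact key ⌊(min s t) / ε⌋ n s ⟨hh.1.trans (min_le_left _ _), (le_max_left _ _).trans hn'⟩
    t ⟨hh.1.trans (min_le_right _ _), (le_max_right _ _).trans hn'⟩

lemma eta2 (x : V2) : x = ![x 0, x 1] := by
  ext i; fin_cases i <;> rfl

lemma close (h : GlobData L lam ε θ p V K) (x : V2) (hx : x 0 ∈ Icc (-L) L) :
    ‖glob lam ε θ p V x - rig (θ ⌊x 1 / ε⌋) (p ⌊x 1 / ε⌋) x‖ ≤ 2 * (K ⌊x 1 / ε⌋ * ε) := by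
  have hε := h.hε
  obtain ⟨h0, h1⟩ := mem_strip hε (x 1)
  set k := ⌊x 1 / ε⌋
  have hl : 0 < lam * ε := mul_pos h.hlam0 hε
  have hl' : lam * ε < ε := by nlinarith [h.hlam1]
  have a1 := h.ht_strip k (x 0) hx (x 1) ⟨h0, h1.le⟩ (ε * (k + 1)) ⟨by linarith, le_rfl⟩
  rw [← eta2 x, h.rigid k hx (by linarith) le_rfl] at a1
  have a2 := rig_t (θ k) (p k) (x 0) (ε * (k + 1)) (x 1)
  rw [← eta2 x] at a2
  have a3 : |x 1 - ε * (k + 1)| ≤ ε := by rw [abs_le]; constructor <;> linarith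
  have a4 : |ε * (k + 1) - x 1| ≤ ε := by rw [abs_sub_comm]; exact a3
  have hK := h.K1 k
  have a5 := norm_sub_le_norm_sub_add_norm_sub (glob lam ε θ p V x)
    (rig (θ k) (p k) ![x 0, ε * (k + 1)]) (rig (θ k) (p k) x)
  have a6 : K k * |x 1 - ε * (k + 1)| ≤ K k * ε := mul_le_mul_of_nonneg_left a3 (by linarith)
  have a7 : ε ≤ K k * ε := le_mul_of_one_le_left hε.le hK
  linarith

lemma good_rig (h : GlobData L lam ε θ p V K) (x : V2) (hx : x 0 ∈ Ioo (-L) L) (k : ℤ)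
    (h0 : ε * k + lam * ε < x 1) (h1 : x 1 < ε * (k + 1)) :
    HasFDerivAt (glob lam ε θ p V) (shearD (θ k) 0) x := by
  refine (rig_deriv (θ k) (p k) x).congr_of_eventuallyEq ?_
  have c0 : ContinuousAt (fun y : V2 => y 0) x := (continuous_apply 0).continuousAt
  have c1 : ContinuousAt (fun y : V2 => y 1) x := (continuous_apply 1).continuousAt
  filter_upwards [c0.eventually_const_lt hx.1, c0.eventually_lt_const hx.2,
    c1.eventually_const_lt h0, c1.eventually_lt_const h1] with y y1 y2 y3 y4
  rw [eta2 y]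
  exact h.rigid k ⟨y1.le, y2.le⟩ y3.le y4.le

/-- a.e. `GoodAt`. -/
lemma good (h : GlobData L lam ε θ p V K) : ∃ N : Set ℝ, N.Countable ∧
    ∀ x : V2, x 0 ∈ Ioo (-L) L → x 1 ∉ N →
      (GoodAt (glob lam ε θ p V) x ∧ (lam ≤ Int.fract (x 1 / ε) →
        ∃ φ, HasFDerivAt (glob lam ε θ p V) (shearD φ 0) x)) := by
  have hε := h.hε
  choose N hN hg using fun k => (h.piece k).good
  refine ⟨(⋃ k, N k) ∪ ((range fun k : ℤ => ε * k) ∪ range fun k : ℤ => ε * k + lam * ε),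
    (countable_iUnion hN).union ((countable_range _).union (countable_range _)), ?_⟩
  intro x hx hxN
  simp only [mem_union, mem_iUnion, mem_range, not_or, not_exists] at hxN
  obtain ⟨n1, n2, n3⟩ := hxN
  obtain ⟨h0, h1⟩ := mem_strip hε (x 1)
  set k := ⌊x 1 / ε⌋ with hk
  have h0' := h0.lt_of_ne (n2 k)
  have hfr := fract_strip (lam := lam) hε h0 h1
  rcases lt_or_gt_of_ne (n3 k) with H | H
  · have := h.good_rig x hx k H h1
    exact ⟨⟨_, _, this⟩, fun _ => ⟨_, this⟩⟩
  · refine ⟨?_, fun hc => absurd (hfr.2 H) (not_lt.2 hc)⟩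
    obtain ⟨φ, γ, hd⟩ := hg k x hx ⟨h0', H⟩ (n1 k)
    refine ⟨φ, γ, hd.congr_of_eventuallyEq ?_⟩
    have c0 : ContinuousAt (fun y : V2 => y 0) x := (continuous_apply 0).continuousAt
    have c1 : ContinuousAt (fun y : V2 => y 1) x := (continuous_apply 1).continuousAt
    filter_upwards [c0.eventually_const_lt hx.1, c0.eventually_lt_const hx.2,
      c1.eventually_const_lt h0', c1.eventually_lt_const H] with y y1 y2 y3 y4
    rw [eta2 y]
    exact h.soft k ⟨y1.le, y2.le⟩ y3.le y4.le

end GlobData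

def clampL (L : ℝ) (x : V2) : V2 := ![max (-L) (min L (x 0)), x 1]

lemma clampL_mem {L : ℝ} (hL : 0 ≤ L) (x : V2) : max (-L) (min L (x 0)) ∈ Icc (-L) L :=
  ⟨le_max_left _ _, max_le (by linarith) (min_le_left _ _)⟩

lemma clampL_eq {L : ℝ} (x : V2) (hx : x 0 ∈ Icc (-L) L) : clampL L x = x := by
  rw [GlobData.eta2 x]
  simp [clampL, min_eq_right hx.2, max_eq_right hx.1]

/-- final Lipschitz function -/
def gmap (L lam ε : ℝ) (θ : ℤ → ℝ) (p : ℤ → V2) (V : ℤ → V2 → V2) (x : V2) : V2 :=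
  glob lam ε θ p V (clampL L x)

lemma GlobData.lip {L lam ε : ℝ} {θ : ℤ → ℝ} {p : ℤ → V2} {V : ℤ → V2 → V2} {K : ℤ → ℝ}
    (h : GlobData L lam ε θ p V K) (hL : 0 ≤ L) {Kb : ℝ} (hKb : ∀ k, K k ≤ Kb) :
    LipschitzWith (1 + Kb).toNNReal (gmap L lam ε θ p V) := by
  have hKb0 : 0 ≤ Kb := by linarith [h.K1 0, hKb 0]
  refine LipschitzWith.of_dist_le_mul fun x y => ?_
  rw [dist_eq_norm, dist_eq_norm, Real.coe_toNNReal _ (by linarith)]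
  unfold gmap clampL
  set a := max (-L) (min L (x 0))
  set b := max (-L) (min L (y 0))
  have hab : |a - b| ≤ ‖x - y‖ := by
    have h1 := abs_max_sub_max_le_abs (min L (x 0)) (min L (y 0)) (-L)
    have h2 := abs_min_sub_min_le_max L (x 0) L (y 0)
    simp only [sub_self, abs_zero] at h2
    rw [max_eq_right (abs_nonneg _)] at h2
    have h3 := norm_le_pi_norm (x - y) 0
    rw [Real.norm_eq_abs] at h3
    have : a - b = max (min L (x 0)) (-L) - max (min L (y 0)) (-L) := by
      simp only [a, b, max_comm]
    rw [this]; exact h1.trans (h2.trans h3)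
  have h1 : |x 1 - y 1| ≤ ‖x - y‖ := by
    have h3 := norm_le_pi_norm (x - y) 1
    rw [Real.norm_eq_abs] at h3; exact h3
  have a1 := h.hx (x 1) a b (clampL_mem hL x) (clampL_mem hL y)
  have a2 := h.ht hKb b (clampL_mem hL y) (x 1) (y 1)
  have a3 := norm_sub_le_norm_sub_add_norm_sub (glob lam ε θ p V ![a, x 1])
    (glob lam ε θ p V ![b, x 1]) (glob lam ε θ p V ![b, y 1])
  have a4 := mul_le_mul_of_nonneg_left h1 hKb0
  linarith


/-- classical Jacobian -/
def gJ (u : V2 → V2) (x : V2) : Mat2 := Matrix.of fun i j => fderiv ℝ u x (Pi.single j 1) i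

lemma norm_single (j : Fin 2) : ‖(Pi.single j 1 : V2)‖ ≤ 1 := by
  rw [pi_norm_le_iff_of_nonneg zero_le_one]
  intro i
  by_cases h : i = j
  · subst h; simp
  · simp [h]

lemma gJ_bound {u : V2 → V2} {C : NNReal} (hu : LipschitzWith C u) (x : V2) (i j : Fin 2) :
    |gJ u x i j| ≤ C := by
  have h1 : ‖fderiv ℝ u x‖ ≤ C := norm_fderiv_le_of_lipschitz ℝ hu
  have h2 := (fderiv ℝ u x).le_opNorm (Pi.single j 1)
  have h3 := norm_le_pi_norm (fderiv ℝ u x (Pi.single j 1)) i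
  have h4 := norm_single j
  have : ‖fderiv ℝ u x‖ * ‖(Pi.single j 1 : V2)‖ ≤ C * 1 :=
    mul_le_mul h1 h4 (norm_nonneg _) C.2
  rw [Real.norm_eq_abs] at h3
  simp only [gJ, Matrix.of_apply]
  linarith

lemma gJ_meas (u : V2 → V2) (i j : Fin 2) : Measurable fun x => gJ u x i j := by
  simp only [gJ, Matrix.of_apply]
  exact (measurable_pi_apply i).comp (measurable_fderiv_apply_const ℝ u _)

lemma gJ_int {u : V2 → V2} {C : NNReal} (hu : LipschitzWith C u) {Ω : Set V2}
    (hb : Bornology.IsBounded Ω) (i j : Fin 2) : IntegrableOn (fun x => gJ u x i j) Ω volume := by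
  refine Measure.integrableOn_of_bounded (M := C) hb.measure_lt_top.ne
    (gJ_meas u i j).aestronglyMeasurable ?_
  exact Eventually.of_forall fun x => gJ_bound hu x i j

lemma setInt_of_tsupport {f g : V2 → ℝ} {Ω : Set V2} (h : tsupport f ⊆ Ω)
    {μ : Measure V2} (hg : ∀ x, f x = 0 → g x = 0) : ∫ x in Ω, g x ∂μ = ∫ x, g x ∂μ := by
  apply setIntegral_eq_integral_of_forall_compl_eq_zero
  intro x hx
  apply hg
  by_contra h0
  exact hx (h (subset_tsupport _ h0))

lemma pd_eq_zero {φ : V2 → ℝ} {x : V2} (j : Fin 2) (h : x ∉ tsupport φ) : pd j φ x = 0 := by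
  have : fderiv ℝ φ x = 0 := by
    by_contra h0
    exact h (support_fderiv_subset ℝ h0)
  simp [pd, this]

lemma setInt_pd {f φ : V2 → ℝ} {Ω : Set V2} (h : tsupport φ ⊆ Ω) (j : Fin 2) :
    ∫ x in Ω, f x * pd j φ x = ∫ x, f x * pd j φ x := by
  apply setIntegral_eq_integral_of_forall_compl_eq_zero
  intro x hx
  rw [pd_eq_zero j (fun h0 => hx (h h0)), mul_zero]

lemma sob_of_lip {u : V2 → V2} {C : NNReal} (hu : LipschitzWith C u) {Ω : Set V2}
    (hb : Bornology.IsBounded Ω) : IsSobolev11On Ω u (gJ u) := by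
  refine ⟨?_, fun i j => gJ_int hu hb i j, ?_⟩
  · exact (hu.continuous.locallyIntegrable.integrableOn_isCompact
      hb.isCompact_closure).mono_set subset_closure
  · intro φ hφ hφc hφΩ i j
    rw [setInt_pd hφΩ]
    rw [setInt_of_tsupport hφΩ (fun x hx => by simp [hx])]
    have hui : LipschitzWith C (fun x => u x i) := by
      have := (LipschitzWith.eval (α := fun _ : Fin 2 => ℝ) i).comp hu
      rw [one_mul] at this
      exact this
    obtain ⟨D, hD⟩ := (hφ.of_le (by exact_mod_cast le_top : (1 : WithTop ℕ∞) ≤ _)).lipschitzWith_of_hasCompactSupport hφc one_ne_zero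
    have key := LipschitzWith.integral_lineDeriv_mul_eq (μ := volume) hui hD hφc (Pi.single j 1)
    have e1 : ∫ x, lineDeriv ℝ (fun x => u x i) x (Pi.single j 1) * φ x = ∫ x, φ x * gJ u x i j := by
      apply integral_congr_ae
      filter_upwards [hu.ae_differentiableAt (μ := volume)] with x hx
      have hd : HasFDerivAt (fun x => u x i) _ x := (hasFDerivAt_pi'.1 hx.hasFDerivAt) i
      rw [hd.hasLineDerivAt (Pi.single j 1) |>.lineDeriv, mul_comm]
      simp [gJ]
    have e2 : ∫ x, lineDeriv ℝ φ x (-Pi.single j 1) * u x i = - ∫ x, u x i * pd j φ x := by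
      rw [← integral_neg]
      congr 1; ext x
      have hd := (hφ.differentiable (by simp) x).hasFDerivAt
      rw [(hd.hasLineDerivAt _).lineDeriv]
      simp [pd, mul_comm]
    rw [e1, e2] at key
    linarith

lemma IsSobolev11On.congr {Ω : Set V2} {u : V2 → V2} {g g' : V2 → Mat2}
    (h : IsSobolev11On Ω u g) (hg : ∀ᵐ x ∂(volume.restrict Ω), g x = g' x) :
    IsSobolev11On Ω u g' := by
  refine ⟨h.int_u, fun i j => (h.int_gu i j).congr ?_, ?_⟩
  · filter_upwards [hg] with x hx; rw [hx]
  · intro φ h1 h2 h3 i j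
    rw [h.ibp φ h1 h2 h3 i j]
    congr 1
    apply integral_congr_ae
    filter_upwards [hg] with x hx; rw [hx]

lemma sob_unique {Ω : Set V2} (hΩ : IsOpen Ω) {u : V2 → V2} {g g' : V2 → Mat2}
    (h : IsSobolev11On Ω u g) (h' : IsSobolev11On Ω u g') (i j : Fin 2) :
    ∀ᵐ x ∂(volume.restrict Ω), g x i j = g' x i j := by
  have := hΩ.ae_eq_zero_of_integral_contDiff_smul_eq_zero (μ := volume)
    (f := fun x => g x i j - g' x i j)
    ((h.int_gu i j).sub (h'.int_gu i j)).locallyIntegrableOn ?_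
  · rw [ae_restrict_iff' hΩ.measurableSet]
    filter_upwards [this] with x hx hx'
    linarith [hx hx']
  · intro φ h1 h2 h3
    have e := h.ibp φ h1 h2 h3 i j
    rw [h'.ibp φ h1 h2 h3 i j, neg_inj] at e
    rw [← setInt_of_tsupport h3 (fun x hx => by simp [hx])]
    simp only [smul_eq_mul, mul_sub]
    have hb : ∃ M, ∀ x, ‖φ x‖ ≤ M := h1.continuous.bounded_above_of_compact_support h2
    obtain ⟨M, hM⟩ := hb
    rw [integral_sub, e, sub_self]
    · exact (h.int_gu i j).bdd_mul h1.continuous.aestronglyMeasurable (Eventually.of_forall hM)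
    · exact (h'.int_gu i j).bdd_mul h1.continuous.aestronglyMeasurable (Eventually.of_forall hM)

lemma ae_snd_notMem {N : Set ℝ} (hN : volume N = 0) : ∀ᵐ x : V2, x 1 ∉ N := by
  have := (Measure.quasiMeasurePreserving_eval (fun _ : Fin 2 => (volume : Measure ℝ)) 1).ae
    (p := fun t => t ∉ N) (measure_eq_zero_iff_ae_notMem.1 hN)
  exact this

lemma shearD_e1 (φ γ : ℝ) : shearD φ γ (Pi.single 0 1) = ev φ := by simp [shearD_apply]
lemma shearD_e2 (φ γ : ℝ) : shearD φ γ (Pi.single 1 1) = γ • ev φ + nv φ := by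
  simp [shearD_apply]

lemma memAeps_of_good {Ω : Set V2} (hΩ : IsOpen Ω) (hb : Bornology.IsBounded Ω) {u : V2 → V2}
    {C : NNReal} (hu : LipschitzWith C u) {lam ε : ℝ} {N : Set ℝ} (hN : N.Countable)
    (hg : ∀ x ∈ Ω, x 1 ∉ N → GoodAt u x ∧ (lam ≤ Int.fract (x 1 / ε) →
      ∃ φ, HasFDerivAt u (shearD φ 0) x)) : ∃ R γ, MemAeps Ω lam ε u R γ := by
  set R : V2 → Mat2 := fun x => !![gJ u x 0 0, - gJ u x 1 0; gJ u x 1 0, gJ u x 0 0] with hR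
  set γ : V2 → ℝ := fun x => gJ u x 0 0 * gJ u x 0 1 + gJ u x 1 0 * gJ u x 1 1 with hγ
  have hae : ∀ᵐ x : V2, x 1 ∉ N := ae_snd_notMem (hN.measure_zero _)
  have comp : ∀ x φ g, HasFDerivAt u (shearD φ g) x →
      gJ u x 0 0 = Real.cos φ ∧ gJ u x 1 0 = Real.sin φ ∧
      gJ u x 0 1 = g * Real.cos φ - Real.sin φ ∧ gJ u x 1 1 = g * Real.sin φ + Real.cos φ := by
    intro x φ g h
    refine ⟨?_, ?_, ?_, ?_⟩ <;> simp only [gJ, Matrix.of_apply, h.fderiv, shearD_e1, shearD_e2] <;>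
      simp [ev, nv] <;> ring
  have compγ : ∀ x φ g, HasFDerivAt u (shearD φ g) x → γ x = g := by
    intro x φ g h
    obtain ⟨a, b, c, d⟩ := comp x φ g h
    simp only [hγ, a, b, c, d]
    linear_combination g * Real.sin_sq_add_cos_sq φ
  refine ⟨R, γ, ?_, ?_, ?_, ?_⟩
  · rw [ae_restrict_iff' hΩ.measurableSet]
    filter_upwards [hae] with x hx hxΩ
    obtain ⟨φ, g, h⟩ := (hg x hxΩ hx).1
    obtain ⟨a, b, c, d⟩ := comp x φ g h
    have := Real.sin_sq_add_cos_sq φ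
    constructor
    · ext i j
      fin_cases i <;> fin_cases j <;> simp [hR, a, b, Matrix.mul_apply, Fin.sum_univ_two] <;> nlinarith
    · simp [hR, a, b, Matrix.det_fin_two]; nlinarith
  · have h1 : ∀ i j k l, Integrable (fun x => gJ u x i j * gJ u x k l) (volume.restrict Ω) :=
      fun i j k l => (gJ_int hu hb k l).bdd_mul (gJ_meas u i j).aestronglyMeasurable
        (c := C) (Eventually.of_forall fun x => gJ_bound hu x i j)
    exact (h1 0 0 0 1).add (h1 1 0 1 1)
  · refine (sob_of_lip hu hb).congr ?_
    rw [ae_restrict_iff' hΩ.measurableSet]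
    filter_upwards [hae] with x hx hxΩ
    obtain ⟨φ, g, h⟩ := (hg x hxΩ hx).1
    obtain ⟨a, b, c, d⟩ := comp x φ g h
    have e := compγ x φ g h
    rw [e]
    ext i j
    fin_cases i <;> fin_cases j <;>
      simp [hR, a, b, c, d, Matrix.mul_apply, Fin.sum_univ_two, outer, e1, e2] <;> ring
  · have hm : MeasurableSet (Ω ∩ rigid2 lam ε) := by
      refine hΩ.measurableSet.inter ?_
      have hm1 : Measurable fun x : V2 => x 1 / ε := by fun_prop
      exact measurableSet_le measurable_const (measurable_fract.comp hm1)
    rw [ae_restrict_iff' hm]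
    filter_upwards [hae] with x hx hxΩ
    obtain ⟨φ, h⟩ := (hg x hxΩ.1 hx).2 hxΩ.2
    exact compγ x φ 0 h


lemma abs_le_vnorm (v : V2) (i : Fin 2) : |v i| ≤ vnorm v := by
  unfold vnorm
  apply Real.abs_le_sqrt
  fin_cases i
  · simp; positivity
  · simp; positivity

lemma vnorm_le (v : V2) : vnorm v ≤ |v 0| + |v 1| := by
  unfold vnorm
  rw [Real.sqrt_le_left (by positivity)]
  nlinarith [abs_nonneg (v 0), abs_nonneg (v 1), sq_abs (v 0), sq_abs (v 1)]

lemma vnorm_nonneg (v : V2) : 0 ≤ vnorm v := Real.sqrt_nonneg _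

lemma abs_le_mnorm (M : Mat2) (i j : Fin 2) : |M i j| ≤ mnorm M := by
  unfold mnorm
  apply Real.abs_le_sqrt
  have h1 : M i j ^ 2 ≤ ∑ j, M i j ^ 2 :=
    Finset.single_le_sum (f := fun j => M i j ^ 2) (fun _ _ => sq_nonneg _) (Finset.mem_univ j)
  have h2 : (∑ j, M i j ^ 2) ≤ ∑ i, ∑ j, M i j ^ 2 :=
    Finset.single_le_sum (f := fun i => ∑ j, M i j ^ 2)
      (fun _ _ => Finset.sum_nonneg fun _ _ => sq_nonneg _) (Finset.mem_univ i)
  exact h1.trans h2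

lemma HasBVDerivOn.gs_int {Ω : Set V2} {u : V2 → V2} {gu : V2 → Mat2} {σ : Measure V2}
    {gs : V2 → Mat2} (h : HasBVDerivOn Ω u gu σ gs) (i j : Fin 2) :
    Integrable (fun x => gs x i j) σ := by
  have : IsFiniteMeasure σ := ⟨h.fin.lt_top⟩
  refine Integrable.of_bound (C := 1) (h.meas_gs i j).aestronglyMeasurable ?_
  filter_upwards [h.unit] with x hx
  rw [← hx]; exact abs_le_mnorm _ _ _

lemma comp_int {Ω : Set V2} {u : V2 → V2} (h : IntegrableOn u Ω volume) (i : Fin 2) :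
    IntegrableOn (fun x => u x i) Ω volume := by
  have := (ContinuousLinearMap.proj (R := ℝ) (φ := fun _ : Fin 2 => ℝ) i).integrable_comp h
  exact this

lemma l1conv_of {Ω : Set V2} {un : ℕ → V2 → V2} {u : V2 → V2}
    (hu : IntegrableOn u Ω volume) (hun : ∀ n, IntegrableOn (un n) Ω volume)
    (h : ∀ i, Tendsto (fun n => ∫ x in Ω, |un n x i - u x i|) atTop (𝓝 0)) :
    L1ConvOn Ω un u := by
  have hs := (h 0).add (h 1)
  rw [add_zero] at hs
  refine squeeze_zero (fun n => integral_nonneg fun x => vnorm_nonneg _) (fun n => ?_) hs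
  have hi : ∀ i, Integrable (fun x => |un n x i - u x i|) (volume.restrict Ω) := fun i =>
    ((comp_int (hun n) i).sub (comp_int hu i)).abs
  rw [← integral_add (hi 0) (hi 1)]
  exact integral_mono_of_nonneg (Eventually.of_forall fun x => vnorm_nonneg _)
    ((hi 0).add (hi 1)) (Eventually.of_forall fun x => vnorm_le _)

lemma pd_cont {φ : V2 → ℝ} (h : ContDiff ℝ (⊤ : ℕ∞) φ) (j : Fin 2) : Continuous (pd j φ) := by
  have := h.continuous_fderiv (by simp)
  exact this.clm_apply continuous_const

lemma pd_bdd {φ : V2 → ℝ} (h : ContDiff ℝ (⊤ : ℕ∞) φ) (hc : HasCompactSupport φ) (j : Fin 2) :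
    ∃ M, ∀ x, |pd j φ x| ≤ M := by
  refine (pd_cont h j).bounded_above_of_compact_support ?_
  exact hc.mono' fun x hx => by
    by_contra h0; exact hx (pd_eq_zero j h0)

lemma measConv_of {Ω : Set V2} (hΩ : IsOpen Ω) {u : V2 → V2} {gu : V2 → Mat2} {σ : Measure V2}
    {gs : V2 → Mat2} (h : HasBVDerivOn Ω u gu σ gs) {un : ℕ → V2 → V2} {J : ℕ → V2 → Mat2}
    (hJ : ∀ n, IsSobolev11On Ω (un n) (J n))
    (hL : ∀ i, Tendsto (fun n => ∫ x in Ω, |un n x i - u x i|) atTop (𝓝 0))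
    (hC : ∀ S, IsCompact S → S ⊆ Ω → ∀ i j, ∃ C, ∀ᶠ n in atTop, ∫ x in S, |J n x i j| ≤ C)
    (gn : ℕ → V2 → Mat2) (hgn : ∀ n, IsSobolev11On Ω (un n) (gn n)) : MeasConv Ω gn gu σ gs := by
  intro φ hφ hφc hφΩ i j
  obtain ⟨C, hC⟩ := hC _ hφc hφΩ i j
  have hC0 : 0 ≤ C := by
    obtain ⟨n, hn⟩ := hC.exists
    exact (integral_nonneg fun x => abs_nonneg _).trans hn
  set M1 := ∫ x in Ω, |gu x i j| with hM1
  set M2 := ∫ x, |gs x i j| ∂σ with hM2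
  have hM10 : 0 ≤ M1 := integral_nonneg fun x => abs_nonneg _
  have hM20 : 0 ≤ M2 := integral_nonneg fun x => abs_nonneg _
  have bddmul : ∀ {f : V2 → ℝ} {μ : Measure V2} {g : V2 → ℝ}, Continuous f → HasCompactSupport f →
      Integrable g μ → Integrable (fun x => f x * g x) μ := by
    intro f μ g hf hfc hg
    obtain ⟨M, hM⟩ := hf.bounded_above_of_compact_support hfc
    exact hg.bdd_mul hf.aestronglyMeasurable (Eventually.of_forall hM)
  rw [Metric.tendsto_atTop']
  intro e he
  set δ := e / (2 * (C + M1 + M2 + 1)) with hδ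
  have hden : 0 < 2 * (C + M1 + M2 + 1) := by positivity
  have hδ0 : 0 < δ := by positivity
  have hδe : δ * (C + M1 + M2) < e / 2 := by
    have : δ * (2 * (C + M1 + M2 + 1)) = e := div_mul_cancel₀ _ hden.ne'
    nlinarith
  obtain ⟨ψ, hψ, hψd, hψs⟩ := hφ.exists_contDiff_approx (⊤ : ℕ∞) (ε := fun _ => δ)
    continuous_const (fun _ => hδ0)
  have hψt : tsupport ψ ⊆ tsupport φ := closure_mono hψs
  have hψc : HasCompactSupport ψ := hφc.of_isClosed_subset (isClosed_tsupport _) hψt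
  have hψΩ : tsupport ψ ⊆ Ω := hψt.trans hφΩ
  obtain ⟨Mp, hMp⟩ := pd_bdd hψ hψc j
  have hMp0 : 0 ≤ Mp := (abs_nonneg _).trans (hMp 0)
  -- convergence for ψ
  have hA : Tendsto (fun n => Mp * ∫ x in Ω, |un n x i - u x i|) atTop (𝓝 0) := by
    have := (hL i).const_mul Mp
    rwa [mul_zero] at this
  have hev := hA.eventually_lt_const (half_pos he)
  obtain ⟨n0, hn0⟩ := eventually_atTop.1 (hev.and hC)
  refine ⟨n0, fun n hn => ?_⟩
  obtain ⟨b1, b2⟩ := hn0 n hn.le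
  have b2' : ∫ x in tsupport φ, |gn n x i j| ≤ C := by
    refine le_trans (le_of_eq ?_) b2
    apply integral_congr_ae
    have := ae_restrict_of_ae_restrict_of_subset hφΩ (sob_unique hΩ (hgn n) (hJ n) i j)
    filter_upwards [this] with x hx; rw [hx]
  -- A_n
  have c1 : |(∫ x in Ω, φ x * gn n x i j) - ∫ x in Ω, ψ x * gn n x i j| ≤ δ * C := by
    rw [← integral_sub (bddmul hφ hφc ((hgn n).int_gu i j))
      (bddmul hψ.continuous hψc ((hgn n).int_gu i j))]
    have : ∫ x in Ω, (φ x * gn n x i j - ψ x * gn n x i j) =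
        ∫ x in tsupport φ, (φ x * gn n x i j - ψ x * gn n x i j) := by
      refine setIntegral_eq_of_subset_of_forall_sdiff_eq_zero hΩ.measurableSet hφΩ ?_
      intro x hx
      have h1 := image_eq_zero_of_notMem_tsupport hx.2
      have h2 := image_eq_zero_of_notMem_tsupport (fun hh => hx.2 (hψt hh))
      rw [h1, h2]; ring
    rw [this, ← Real.norm_eq_abs]
    refine le_trans (norm_integral_le_of_norm_le (g := fun x => δ * |gn n x i j|) ?_ ?_) ?_
    · exact (((hgn n).int_gu i j).mono_set hφΩ).abs.const_mul δ
    · refine Eventually.of_forall fun x => ?_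
      rw [← sub_mul, norm_mul, Real.norm_eq_abs (gn n x i j)]
      apply mul_le_mul_of_nonneg_right _ (abs_nonneg _)
      have := (hψd x).le
      rwa [dist_comm, dist_eq_norm] at this
    · rw [integral_const_mul]
      exact mul_le_mul_of_nonneg_left b2' hδ0.le
  have c2 : ∀ (μ : Measure V2) (g : V2 → ℝ), Integrable g μ →
      |(∫ x, φ x * g x ∂μ) - ∫ x, ψ x * g x ∂μ| ≤ δ * ∫ x, |g x| ∂μ := by
    intro μ g hg
    rw [← integral_sub (bddmul hφ hφc hg) (bddmul hψ.continuous hψc hg), ← integral_const_mul, ← Real.norm_eq_abs]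
    refine norm_integral_le_of_norm_le (hg.abs.const_mul δ) (Eventually.of_forall fun x => ?_)
    rw [← sub_mul, norm_mul, Real.norm_eq_abs (g x)]
    apply mul_le_mul_of_nonneg_right _ (abs_nonneg _)
    have := (hψd x).le
    rwa [dist_comm, dist_eq_norm] at this
  have c3 := c2 (volume.restrict Ω) _ (h.int_gu i j)
  have c4 := c2 σ _ (h.gs_int i j)
  have c5 : |(∫ x in Ω, ψ x * gn n x i j) - ((∫ x in Ω, ψ x * gu x i j) + ∫ x, ψ x * gs x i j ∂σ)|
      ≤ Mp * ∫ x in Ω, |un n x i - u x i| := by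
    have e1 := (hgn n).ibp ψ hψ hψc hψΩ i j
    have e2 := h.ibp ψ hψ hψc hψΩ i j
    have pdm : ∀ {f : V2 → ℝ}, IntegrableOn f Ω volume →
        Integrable (fun x => f x * pd j ψ x) (volume.restrict Ω) := by
      intro f hf
      have : (fun x => f x * pd j ψ x) = fun x => pd j ψ x * f x := by ext x; ring
      rw [this]
      exact hf.bdd_mul (pd_cont hψ j).aestronglyMeasurable (Eventually.of_forall hMp)
    have i1 := pdm (comp_int (hgn n).int_u i)
    have i2 := pdm (comp_int h.int_u i)
    have : (∫ x in Ω, ψ x * gn n x i j) - ((∫ x in Ω, ψ x * gu x i j) + ∫ x, ψ x * gs x i j ∂σ)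
        = ∫ x in Ω, (u x i * pd j ψ x - un n x i * pd j ψ x) := by
      rw [integral_sub i2 i1]; linarith
    rw [this, ← integral_const_mul, ← Real.norm_eq_abs]
    refine norm_integral_le_of_norm_le
      (((comp_int (hgn n).int_u i).sub (comp_int h.int_u i)).abs.const_mul Mp)
      (Eventually.of_forall fun x => ?_)
    rw [← sub_mul, norm_mul, mul_comm, Real.norm_eq_abs, Real.norm_eq_abs]
    rw [abs_sub_comm (u x i)]
    exact mul_le_mul_of_nonneg_right (hMp x) (abs_nonneg _)
  rw [Real.dist_eq]
  rw [← hM1] at c3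
  rw [← hM2] at c4
  rw [abs_le] at c1 c3 c4 c5
  have := hδe
  rw [abs_lt]
  constructor <;> nlinarith [c1.1, c1.2, c3.1, c3.2, c4.1, c4.2, c5.1, c5.2]


lemma half_le_norm_ev (θ : ℝ) : 1 / 2 ≤ ‖ev θ‖ := by
  have h0 := norm_le_pi_norm (ev θ) 0
  have h1 := norm_le_pi_norm (ev θ) 1
  simp only [ev, Matrix.cons_val_zero, Matrix.cons_val_one, Real.norm_eq_abs] at h0 h1
  by_contra h
  push Not at h
  change ‖(![Real.cos θ, Real.sin θ] : V2)‖ < 1 / 2 at h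
  have := Real.sin_sq_add_cos_sq θ
  rw [← sq_abs (Real.sin θ), ← sq_abs (Real.cos θ)] at this
  nlinarith [abs_nonneg (Real.sin θ), abs_nonneg (Real.cos θ)]

lemma nv_of_ev {a b : ℝ} (h : ev a = ev b) : nv a = nv b := by
  have h0 := congrFun h 0
  have h1 := congrFun h 1
  simp only [ev, Matrix.cons_val_zero, Matrix.cons_val_one] at h0 h1
  simp only [nv, h0, h1]

def Tang (θ : ℝ → ℝ) (ψ : ℝ → V2) (s t : ℝ) : Prop :=
  ev (θ s) = ev (θ t) ∧ ∃ r : ℝ, ψ t = ψ s + r • ev (θ s)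

open Classical in
def Dk (C : ℝ) (θ : ℝ → ℝ) (ψ : ℝ → V2) (s t : ℝ) : ℝ :=
  if Tang θ ψ s t then 2 * ‖ψ t - ψ s‖ else C

lemma Dk_nonneg {C : ℝ} (hC : 0 ≤ C) (θ : ℝ → ℝ) (ψ : ℝ → V2) (s t : ℝ) : 0 ≤ Dk C θ ψ s t := by
  unfold Dk; split_ifs
  · positivity
  · exact hC

lemma Dk_le {C : ℝ} (hC : 0 ≤ C) (θ : ℝ → ℝ) (ψ : ℝ → V2) (s t : ℝ) :
    Dk C θ ψ s t ≤ 2 * ‖ψ t - ψ s‖ + C := by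
  unfold Dk; split_ifs
  · linarith
  · linarith [norm_nonneg (ψ t - ψ s)]

lemma exists_glob {L lam E A B : ℝ} (hL : 0 ≤ L) (hlam : lam ∈ Ioo (0:ℝ) 1) (hE : 0 ≤ E)
    (hA : 0 ≤ A) {θ : ℝ → ℝ} {ψ : ℝ → V2} (hB : ∀ t, ‖ψ t‖ ≤ B)
    (hout : ∀ t, A ≤ |t| → θ t = 0 ∧ ψ t = 0) {T : Set ℝ} (hT : Dense T) :
    ∃ C : ℝ, 0 ≤ C ∧ ∀ ε, 0 < ε → ε ≤ E → ∃ τ : ℤ → ℝ, ∃ V : ℤ → V2 → V2,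
      (∀ k : ℤ, τ k ∈ T ∧ τ k ∈ Ioo (ε * k) (ε * (k + 1))) ∧
      GlobData L lam ε (fun k => θ (τ k)) (fun k => ψ (τ k)) V
        (fun k => 1 + Dk C θ ψ (τ (k - 1)) (τ k) / (lam * ε)) := by
  have hB0 : 0 ≤ B := (norm_nonneg _).trans (hB 0)
  obtain ⟨C, hC, hconn⟩ := connection L (B + A + E) E hL (by positivity) hE
  refine ⟨C, hC, fun ε hε hεE => ?_⟩
  have hlε : 0 < lam * ε := mul_pos hlam.1 hε
  have hlε' : lam * ε ≤ E := by nlinarith [hlam.2]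
  have hτ : ∀ k : ℤ, ∃ t ∈ T, t ∈ Ioo (ε * k) (ε * (k + 1)) := by
    intro k
    obtain ⟨t, ht, h⟩ := hT.exists_between (show ε * k < ε * (k + 1) by linarith)
    exact ⟨t, ht, h⟩
  choose τ hτT hτ using hτ
  have hV : ∀ k : ℤ, ∃ V, Piece L (ε * k) (ε * k + lam * ε)
      (1 + Dk C θ ψ (τ (k - 1)) (τ k) / (lam * ε)) (θ (τ (k-1))) (ψ (τ (k-1)))
      (θ (τ k)) (ψ (τ k)) V := by
    intro k
    by_cases hTg : Tang θ ψ (τ (k - 1)) (τ k)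
    · obtain ⟨h1, r, hr⟩ := id hTg
      have P := shear_piece L (ε * k) (ε * k + lam * ε) (θ (τ (k - 1))) r (ψ (τ (k - 1)))
        (by linarith)
      refine ⟨_, (P.congr h1 (nv_of_ev h1) hr.symm).mono ?_⟩
      rw [add_sub_cancel_left, Dk, if_pos hTg, add_comm]
      refine add_le_add le_rfl (div_le_div_of_nonneg_right ?_ hlε.le)
      rw [hr, add_sub_cancel_left, norm_smul, Real.norm_eq_abs]
      nlinarith [half_le_norm_ev (θ (τ (k - 1))), abs_nonneg r]
    · have hk := hτ k
      have hk1 := hτ (k - 1)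
      push_cast at hk1
      have hb : |ε * k| ≤ B + A + E := by
        by_contra hcon
        push Not at hcon
        have e1 : A ≤ |τ (k - 1)| := by
          rcases abs_cases (ε * (k:ℝ)) with ⟨h, h'⟩ | ⟨h, h'⟩ <;>
          rcases abs_cases (τ (k - 1)) with ⟨g, g'⟩ | ⟨g, g'⟩ <;> linarith [hk1.1, hk1.2]
        have e2 : A ≤ |τ k| := by
          rcases abs_cases (ε * (k:ℝ)) with ⟨h, h'⟩ | ⟨h, h'⟩ <;>
          rcases abs_cases (τ k) with ⟨g, g'⟩ | ⟨g, g'⟩ <;> linarith [hk.1, hk.2]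
        apply hTg
        refine ⟨by rw [(hout _ e1).1, (hout _ e2).1], 0, by rw [(hout _ e1).2, (hout _ e2).2]; simp⟩
      have hBB : ∀ t, ‖ψ t‖ ≤ B + A + E := fun t => (hB t).trans (by linarith)
      obtain ⟨V, P⟩ := hconn (ε * k) (ε * k + lam * ε) (θ (τ (k-1))) (θ (τ k)) _ _ (by linarith)
        (by linarith) hb (hBB (τ (k-1))) (hBB (τ k))
      refine ⟨V, P.mono ?_⟩
      rw [add_sub_cancel_left, Dk, if_neg hTg]
      linarith
  choose V hV using hV
  refine ⟨τ, V, fun k => ⟨hτT k, hτ k⟩, hlam.1, hlam.2, hε, hV, fun k => ?_⟩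
  have := div_nonneg (Dk_nonneg hC θ ψ (τ (k - 1)) (τ k)) hlε.le
  linarith

/-- gmap is locally glob -/
lemma gmap_eventuallyEq {L lam ε : ℝ} {θ : ℤ → ℝ} {p : ℤ → V2} {V : ℤ → V2 → V2} {x : V2}
    (hx : x 0 ∈ Ioo (-L) L) : gmap L lam ε θ p V =ᶠ[𝓝 x] glob lam ε θ p V := by
  have c0 : ContinuousAt (fun y : V2 => y 0) x := (continuous_apply 0).continuousAt
  filter_upwards [c0.eventually_const_lt hx.1, c0.eventually_lt_const hx.2] with y y1 y2
  rw [gmap, clampL_eq y ⟨y1.le, y2.le⟩]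

lemma gmap_eq {L lam ε : ℝ} {θ : ℤ → ℝ} {p : ℤ → V2} {V : ℤ → V2 → V2} {x : V2}
    (hx : x 0 ∈ Ioo (-L) L) : gmap L lam ε θ p V x = glob lam ε θ p V x := by
  rw [gmap, clampL_eq x ⟨hx.1.le, hx.2.le⟩]

lemma glob_memAeps {L lam ε : ℝ} {θ : ℤ → ℝ} {p : ℤ → V2} {V : ℤ → V2 → V2} {K : ℤ → ℝ}
    (h : GlobData L lam ε θ p V K) (hL : 0 ≤ L) {Kb : ℝ} (hKb : ∀ k, K k ≤ Kb)
    {Ω : Set V2} (hΩ : IsOpen Ω) (hb : Bornology.IsBounded Ω) (hΩL : ∀ x ∈ Ω, x 0 ∈ Ioo (-L) L) :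
    ∃ R γ, MemAeps Ω lam ε (gmap L lam ε θ p V) R γ := by
  obtain ⟨N, hN, hg⟩ := h.good
  refine memAeps_of_good hΩ hb (h.lip hL hKb) hN ?_
  intro x hx hxN
  obtain ⟨⟨φ, γ, h1⟩, h2⟩ := hg x (hΩL x hx) hxN
  have he := gmap_eventuallyEq (lam := lam) (ε := ε) (θ := θ) (p := p) (V := V) (hΩL x hx)
  refine ⟨⟨φ, γ, h1.congr_of_eventuallyEq he⟩, fun hr => ?_⟩
  obtain ⟨φ, h3⟩ := h2 hr
  exact ⟨φ, h3.congr_of_eventuallyEq he⟩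

/-- pointwise gradient bound in a strip -/
lemma glob_grad {L lam ε : ℝ} {θ : ℤ → ℝ} {p : ℤ → V2} {V : ℤ → V2 → V2} {K : ℤ → ℝ}
    (h : GlobData L lam ε θ p V K) {x : V2} (hx : x 0 ∈ Ioo (-L) L) (k : ℤ)
    (h0 : ε * k < x 1) (h1 : x 1 < ε * (k + 1)) (i j : Fin 2) :
    |gJ (gmap L lam ε θ p V) x i j| ≤ K k := by
  have hK := h.K1 k
  have he := gmap_eventuallyEq (lam := lam) (ε := ε) (θ := θ) (p := p) (V := V) hx
  by_cases hd : DifferentiableAt ℝ (gmap L lam ε θ p V) x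
  swap
  · simp [gJ, fderiv_zero_of_not_differentiableAt hd]; linarith
  have hd' : DifferentiableAt ℝ (glob lam ε θ p V) x := (he.differentiableAt_iff).1 hd
  have e : gJ (gmap L lam ε θ p V) x = gJ (glob lam ε θ p V) x := by
    simp only [gJ, he.fderiv_eq]
  rw [e]
  have hl := hd'.hasFDerivAt.hasLineDerivAt (Pi.single j 1)
  have key : ‖fderiv ℝ (glob lam ε θ p V) x (Pi.single j 1)‖ ≤ K k := by
    have hD : HasDerivAt (fun t : ℝ => glob lam ε θ p V (x + t • Pi.single j 1)) _ 0 := hl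
    rw [← hD.deriv]
    refine norm_deriv_le_of_lip' (by linarith) ?_
    have hc : Tendsto (fun t : ℝ => x + t • (Pi.single j 1 : V2)) (𝓝 0) (𝓝 x) := by
      have : Continuous (fun t : ℝ => x + t • (Pi.single j 1 : V2)) := by fun_prop
      simpa using this.tendsto 0
    have c0 : ContinuousAt (fun y : V2 => y 0) x := (continuous_apply 0).continuousAt
    have c1 : ContinuousAt (fun y : V2 => y 1) x := (continuous_apply 1).continuousAt
    filter_upwards [hc.eventually (c0.eventually_const_lt hx.1),
      hc.eventually (c0.eventually_lt_const hx.2), hc.eventually (c1.eventually_const_lt h0),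
      hc.eventually (c1.eventually_lt_const h1)] with t a1 a2 a3 a4
    have ex : x = ![x 0, x 1] := GlobData.eta2 x
    fin_cases j
    · have e1 : x + t • (Pi.single (0 : Fin 2) 1 : V2) = ![x 0 + t, x 1] := by
        ext i; fin_cases i <;> simp
      simp only [Fin.zero_eta] at *
      rw [e1] at a1 a2 ⊢
      have := h.hx (x 1) (x 0 + t) (x 0) ⟨a1.le, a2.le⟩ ⟨hx.1.le, hx.2.le⟩
      rw [← ex] at this
      simp only [zero_smul, add_zero, sub_zero, Real.norm_eq_abs] at *
      refine this.trans ?_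
      rw [add_sub_cancel_left]
      exact le_mul_of_one_le_left (abs_nonneg _) hK
    · have e1 : x + t • (Pi.single (1 : Fin 2) 1 : V2) = ![x 0, x 1 + t] := by
        ext i; fin_cases i <;> simp
      simp only [Fin.mk_one] at *
      rw [e1] at a3 a4 ⊢
      have := h.ht_strip k (x 0) ⟨hx.1.le, hx.2.le⟩ (x 1 + t) ⟨a3.le, a4.le⟩ (x 1) ⟨h0.le, h1.le⟩
      rw [← ex, add_sub_cancel_left] at this
      simpa using this
  exact (norm_le_pi_norm (fderiv ℝ (glob lam ε θ p V) x (Pi.single j 1)) i).trans key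


lemma ae_fst_notMem {N : Set ℝ} (hN : volume N = 0) : ∀ᵐ x : V2, x 0 ∉ N := by
  have := (Measure.quasiMeasurePreserving_eval (fun _ : Fin 2 => (volume : Measure ℝ)) 0).ae
    (p := fun t => t ∉ N) (measure_eq_zero_iff_ae_notMem.1 hN)
  exact this

lemma strip_lint {L lam ε : ℝ} {θ : ℤ → ℝ} {p : ℤ → V2} {V : ℤ → V2 → V2} {K : ℤ → ℝ}
    (h : GlobData L lam ε θ p V K) (hL : 0 ≤ L) (k : ℤ) (i j : Fin 2) :
    ∫⁻ x in Icc (![-L, ε * k] : V2) ![L, ε * (k + 1)], ‖gJ (gmap L lam ε θ p V) x i j‖ₑ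
      ≤ ENNReal.ofReal (K k * (2 * L * ε)) := by
  have hε := h.hε
  have hK := h.K1 k
  have h1 : ∀ᵐ x ∂(volume.restrict (Icc (![-L, ε * k] : V2) ![L, ε * (k + 1)])),
      ‖gJ (gmap L lam ε θ p V) x i j‖ₑ ≤ ENNReal.ofReal (K k) := by
    rw [ae_restrict_iff' measurableSet_Icc]
    have a0 : ∀ᵐ x : V2, x 0 ∉ ({-L, L} : Set ℝ) :=
      ae_fst_notMem ((Set.toFinite _).measure_zero _)
    have a1 : ∀ᵐ x : V2, x 1 ∉ ({ε * k, ε * (k + 1)} : Set ℝ) :=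
      ae_snd_notMem ((Set.toFinite _).measure_zero _)
    filter_upwards [a0, a1] with x b0 b1 hx
    simp only [mem_insert_iff, mem_singleton_iff, not_or] at b0 b1
    have c0 := hx.1 0
    have c1 := hx.1 1
    have c2 := hx.2 0
    have c3 := hx.2 1
    simp only [Matrix.cons_val_zero, Matrix.cons_val_one] at c0 c1 c2 c3
    rw [← ofReal_norm, Real.norm_eq_abs]
    exact ENNReal.ofReal_le_ofReal (glob_grad h ⟨c0.lt_of_ne (Ne.symm b0.1), c2.lt_of_ne b0.2⟩ k
      (c1.lt_of_ne (Ne.symm b1.1)) (c3.lt_of_ne b1.2) i j)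
  refine (lintegral_mono_ae h1).trans ?_
  rw [lintegral_const, Measure.restrict_apply_univ, Real.volume_Icc_pi, Fin.prod_univ_two]
  simp only [Matrix.cons_val_zero, Matrix.cons_val_one]
  rw [← ENNReal.ofReal_mul (by linarith), ← ENNReal.ofReal_mul (by linarith)]
  apply le_of_eq; congr 1; ring

lemma sum_ite_le {C : ℝ} (hC : 0 ≤ C) (N : ℕ) (k0 m : ℤ) :
    ∑ i ∈ Finset.range N, (if k0 + (i : ℤ) = m then C else 0) ≤ C := by
  rw [← Finset.sum_filter, Finset.sum_const, nsmul_eq_mul]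
  have : ((Finset.range N).filter fun i : ℕ => k0 + (i : ℤ) = m).card ≤ 1 := by
    rw [Finset.card_le_one]
    intro a ha b hb
    simp only [Finset.mem_filter] at ha hb
    have := ha.2.trans hb.2.symm
    omega
  have : (((Finset.range N).filter fun i : ℕ => k0 + (i : ℤ) = m).card : ℝ) ≤ 1 := by
    exact_mod_cast this
  nlinarith

lemma loc_bound {L lam ε C : ℝ} {θ : ℝ → ℝ} {ψ : ℝ → V2} {τ : ℤ → ℝ} {V : ℤ → V2 → V2}
    {T : Set ℝ} (hL : 0 ≤ L) (hC : 0 ≤ C)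
    (hτ : ∀ k : ℤ, τ k ∈ T ∧ τ k ∈ Ioo (ε * k) (ε * (k + 1)))
    (h : GlobData L lam ε (fun k => θ (τ k)) (fun k => ψ (τ k)) V
        (fun k => 1 + Dk C θ ψ (τ (k - 1)) (τ k) / (lam * ε)))
    {t0 δ : ℝ} {I : Set ℝ} (hI : Ioo (t0 - δ) (t0 + δ) ⊆ I) (hψ : BoundedVariationOn ψ I)
    (hTan : ∀ s ∈ T, ∀ t ∈ T, s ∈ Ioo (t0 - δ) (t0 + δ) → t ∈ Ioo (t0 - δ) (t0 + δ) → s < t →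
      t0 ∉ Icc s t → Tang θ ψ s t) (hεδ : ε < δ / 8) (i j : Fin 2) :
    ∫⁻ x in {x : V2 | x 0 ∈ Ioo (-L) L ∧ |x 1 - t0| < δ / 4},
      ‖gJ (gmap L lam ε (fun k => θ (τ k)) (fun k => ψ (τ k)) V) x i j‖ₑ
      ≤ ENNReal.ofReal (2 * L * (δ + (2 * (eVariationOn ψ I).toReal + 2 * C) / lam)) := by
  have hε := h.hε
  have hlam := h.hlam0
  set G := gmap L lam ε (fun k => θ (τ k)) (fun k => ψ (τ k)) V with hG
  set k0 := ⌊(t0 - δ / 4) / ε⌋ with hk0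
  set k1 := ⌊(t0 + δ / 4) / ε⌋ with hk1
  have hk0s := mem_strip hε (t0 - δ / 4)
  have hk1s := mem_strip hε (t0 + δ / 4)
  rw [← hk0] at hk0s
  rw [← hk1] at hk1s
  set N := (k1 - k0 + 1).toNat with hN
  have hk01 : k0 ≤ k1 := Int.floor_le_floor (div_le_div_of_nonneg_right (by linarith) hε.le)
  have hNr : (N : ℝ) = k1 - k0 + 1 := by
    have : (N : ℤ) = k1 - k0 + 1 := Int.toNat_of_nonneg (by omega)
    exact_mod_cast this
  have hNε : N * ε ≤ δ := by rw [hNr]; nlinarith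
  have hmono : ∀ k : ℤ, τ (k - 1) < τ k := by
    intro k
    have a := (hτ (k - 1)).2.2
    have b := (hτ k).2.1
    push_cast at a; linarith
  -- points inside
  have hin : ∀ i : ℕ, i ≤ N → τ (k0 - 1 + i) ∈ Ioo (t0 - δ) (t0 + δ) := by
    intro i hi
    have a := (hτ (k0 - 1 + i)).2
    push_cast at a
    have hi' : (i : ℝ) ≤ k1 - k0 + 1 := by rw [← hNr]; exact_mod_cast hi
    have hi0 : (0:ℝ) ≤ i := Nat.cast_nonneg i
    constructor
    · have : ε * (k0 - 1) ≤ ε * (k0 - 1 + i) := by nlinarith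
      linarith [a.1]
    · have : ε * (k0 - 1 + i + 1) ≤ ε * (k1 + 1) := by
        apply mul_le_mul_of_nonneg_left _ hε.le; linarith
      linarith [a.2]
  -- variation sum
  have hvar : ∑ i ∈ Finset.range N, ‖ψ (τ (k0 + i)) - ψ (τ (k0 + i - 1))‖ ≤ (eVariationOn ψ I).toReal := by
    have hm : MonotoneOn (fun i : ℕ => τ (k0 - 1 + i)) (Iic N) := by
      have : Monotone (fun i : ℕ => τ (k0 - 1 + i)) := by
        apply monotone_nat_of_le_succ
        intro i
        have := (hmono (k0 - 1 + (i + 1 : ℕ))).le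
        have e : k0 - 1 + ((i + 1 : ℕ) : ℤ) - 1 = k0 - 1 + i := by push_cast; ring
        rwa [e] at this
      exact this.monotoneOn _
    have := eVariationOn.sum_le_of_monotoneOn_Iic (f := ψ) (s := I) hm
      (fun i hi => hI (hin i hi))
    have e : ∑ i ∈ Finset.range N, ‖ψ (τ (k0 + i)) - ψ (τ (k0 + i - 1))‖ =
        (∑ i ∈ Finset.range N, edist (ψ (τ (k0 - 1 + (i + 1 : ℕ)))) (ψ (τ (k0 - 1 + i)))).toReal := by
      rw [ENNReal.toReal_sum (fun _ _ => edist_ne_top _ _)]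
      refine Finset.sum_congr rfl fun i _ => ?_
      rw [edist_dist, ENNReal.toReal_ofReal dist_nonneg, dist_eq_norm]
      have e1 : k0 - 1 + ((i + 1 : ℕ) : ℤ) = k0 + i := by push_cast; ring
      have e2 : k0 - 1 + (i : ℤ) = k0 + i - 1 := by ring
      rw [e1, e2]
    rw [e]
    exact ENNReal.toReal_mono hψ this
  set m := ⌊t0 / ε⌋ with hm
  have hms := mem_strip hε t0
  rw [← hm] at hms
  have hD : ∀ i ∈ Finset.range N, Dk C θ ψ (τ (k0 + i - 1)) (τ (k0 + i)) ≤
      2 * ‖ψ (τ (k0 + i)) - ψ (τ (k0 + i - 1))‖ +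
      ((if k0 + (i : ℤ) = m then C else 0) + (if k0 + (i : ℤ) = m + 1 then C else 0)) := by
    intro i hi
    have hi := Finset.mem_range.1 hi
    by_cases hmem : t0 ∈ Icc (τ (k0 + i - 1)) (τ (k0 + i))
    · have a := (hτ (k0 + i - 1)).2.1
      have b := (hτ (k0 + i)).2.2
      push_cast at a b
      have a' : ε * (k0 + i - 1) < ε * (m + 1) := by linarith [hmem.1]
      have b' : ε * m < ε * (k0 + i + 1) := by linarith [hmem.2]
      have a'' := lt_of_mul_lt_mul_left a' hε.le
      have b'' := lt_of_mul_lt_mul_left b' hε.le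
      have a3 : k0 + (i : ℤ) - 1 < m + 1 := by exact_mod_cast a''
      have b3 : m < k0 + (i : ℤ) + 1 := by exact_mod_cast b''
      have : C ≤ ((if k0 + (i : ℤ) = m then C else 0) + (if k0 + (i : ℤ) = m + 1 then C else 0)) := by
        have : k0 + (i : ℤ) = m ∨ k0 + (i : ℤ) = m + 1 := by omega
        rcases this with e | e
        · rw [if_pos e]; split_ifs <;> linarith
        · rw [if_pos e]; split_ifs <;> linarith
      linarith [Dk_le hC θ ψ (τ (k0 + i - 1)) (τ (k0 + i))]
    · have e2 : k0 - 1 + (i : ℤ) = k0 + i - 1 := by ring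
      have e1 : k0 - 1 + ((i + 1 : ℕ) : ℤ) = k0 + i := by push_cast; ring
      have hi1 := hin i hi.le
      have hi2 := hin (i + 1) hi
      rw [e2] at hi1
      rw [e1] at hi2
      have := hTan _ (hτ _).1 _ (hτ _).1 hi1 hi2 (hmono _) hmem
      rw [Dk, if_pos this]
      have : 0 ≤ ((if k0 + (i : ℤ) = m then C else 0) + (if k0 + (i : ℤ) = m + 1 then C else 0)) := by
        split_ifs <;> linarith
      linarith
  have hsum : ∑ i ∈ Finset.range N, Dk C θ ψ (τ (k0 + i - 1)) (τ (k0 + i)) ≤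
      2 * (eVariationOn ψ I).toReal + 2 * C := by
    refine (Finset.sum_le_sum hD).trans ?_
    rw [Finset.sum_add_distrib, ← Finset.mul_sum, Finset.sum_add_distrib]
    linarith [sum_ite_le hC N k0 m, sum_ite_le hC N k0 (m + 1)]
  set μ := (volume : Measure V2).withDensity (fun x => ‖gJ G x i j‖ₑ) with hμ
  have hcov : {x : V2 | x 0 ∈ Ioo (-L) L ∧ |x 1 - t0| < δ / 4} ⊆
      ⋃ i ∈ Finset.range N, Icc (![-L, ε * ((k0 + i : ℤ) : ℝ)] : V2) ![L, ε * (((k0 + i : ℤ) : ℝ) + 1)] := by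
    rintro x ⟨hx0, hx1⟩
    rw [abs_lt] at hx1
    have hs := mem_strip hε (x 1)
    have a1 : k0 ≤ ⌊x 1 / ε⌋ := Int.floor_le_floor (div_le_div_of_nonneg_right (by linarith) hε.le)
    have a2 : ⌊x 1 / ε⌋ ≤ k1 := Int.floor_le_floor (div_le_div_of_nonneg_right (by linarith) hε.le)
    simp only [mem_iUnion, Finset.mem_range]
    refine ⟨(⌊x 1 / ε⌋ - k0).toNat, by omega, ?_⟩
    have : k0 + (((⌊x 1 / ε⌋ - k0).toNat : ℕ) : ℤ) = ⌊x 1 / ε⌋ := by omega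
    rw [this]
    constructor
    · intro i; fin_cases i
      · simpa using hx0.1.le
      · simpa using hs.1
    · intro i; fin_cases i
      · simpa using hx0.2.le
      · simpa using hs.2.le
  rw [← withDensity_apply']
  refine (measure_mono hcov).trans ((measure_biUnion_finset_le _ _).trans ?_)
  refine (Finset.sum_le_sum (fun i _ => ?_) : _ ≤ ∑ n ∈ Finset.range N, ENNReal.ofReal
    ((1 + Dk C θ ψ (τ (k0 + n - 1)) (τ (k0 + n)) / (lam * ε)) * (2 * L * ε))).trans ?_
  · rw [withDensity_apply _ measurableSet_Icc]
    exact strip_lint h hL _ _ _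
  · rw [← ENNReal.ofReal_sum_of_nonneg]
    · apply ENNReal.ofReal_le_ofReal
      have e : ∀ n : ℕ, (1 + Dk C θ ψ (τ (k0 + n - 1)) (τ (k0 + n)) / (lam * ε)) * (2 * L * ε) =
          2 * L * (ε + Dk C θ ψ (τ (k0 + n - 1)) (τ (k0 + n)) / lam) := by
        intro n; field_simp
      simp only [e]
      rw [← Finset.mul_sum, Finset.sum_add_distrib, ← Finset.sum_div]
      apply mul_le_mul_of_nonneg_left _ (by linarith)
      refine add_le_add ?_ (div_le_div_of_nonneg_right hsum hlam.le)
      simpa using hNε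
    · intro n _
      have := div_nonneg (Dk_nonneg hC θ ψ (τ (k0 + n - 1)) (τ (k0 + n))) (mul_pos hlam hε).le
      have : 0 ≤ 2 * L * ε := by positivity
      apply mul_nonneg _ this; linarith


lemma nv_ev (θ : ℝ) : nv θ = ![-(ev θ 1), ev θ 0] := by
  simp [nv, ev]

lemma norm_nv' (θ : ℝ) : ‖nv θ‖ ≤ 1 := norm_nv θ

lemma ptw {L lam C : ℝ} {θ : ℝ → ℝ} {ψ : ℝ → V2} {ε : ℕ → ℝ} {τ : ℕ → ℤ → ℝ}
    {V : ℕ → ℤ → V2 → V2} {T : Set ℝ} (hε0 : Tendsto ε atTop (𝓝 0))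
    (hτ : ∀ n, ∀ k : ℤ, τ n k ∈ T ∧ τ n k ∈ Ioo (ε n * k) (ε n * (k + 1)))
    (h : ∀ n, GlobData L lam (ε n) (fun k => θ (τ n k)) (fun k => ψ (τ n k)) (V n)
        (fun k => 1 + Dk C θ ψ (τ n (k - 1)) (τ n k) / (lam * ε n)))
    {x : V2} (hx : x 0 ∈ Ioo (-L) L) (hc : ContinuousAt ψ (x 1))
    (hce : ContinuousAt (fun t => ev (θ t)) (x 1)) {η : ℝ} (hη : 0 < η)
    (hTan : ∀ s ∈ T, ∀ t ∈ T, s ∈ Ioo (x 1 - η) (x 1 + η) → t ∈ Ioo (x 1 - η) (x 1 + η) → s < t →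
      Tang θ ψ s t) :
    Tendsto (fun n => gmap L lam (ε n) (fun k => θ (τ n k)) (fun k => ψ (τ n k)) (V n) x) atTop
      (𝓝 (rig (θ (x 1)) (ψ (x 1)) x)) := by
  have hlam := (h 0).hlam0
  set k : ℕ → ℤ := fun n => ⌊x 1 / ε n⌋ with hk
  have hs := fun n => mem_strip (h n).hε (x 1)
  have ha : ∀ n, |τ n (k n) - x 1| ≤ 2 * ε n := by
    intro n
    obtain ⟨h1, h2⟩ := (hτ n (k n)).2
    obtain ⟨h3, h4⟩ := hs n
    have := (h n).hε
    simp only [hk] at *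
    rw [abs_le]; constructor <;> nlinarith
  have hbb : ∀ n, |τ n (k n - 1) - x 1| ≤ 2 * ε n := by
    intro n
    obtain ⟨h1, h2⟩ := (hτ n (k n - 1)).2
    obtain ⟨h3, h4⟩ := hs n
    have := (h n).hε
    push_cast at h1 h2
    simp only [hk] at *
    rw [abs_le]; constructor <;> nlinarith
  have h2ε : Tendsto (fun n => 2 * ε n) atTop (𝓝 0) := by simpa using hε0.const_mul 2
  have ta : Tendsto (fun n => τ n (k n)) atTop (𝓝 (x 1)) :=
    tendsto_iff_norm_sub_tendsto_zero.2 (squeeze_zero (fun _ => norm_nonneg _) ha h2ε)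
  have tb : Tendsto (fun n => τ n (k n - 1)) atTop (𝓝 (x 1)) :=
    tendsto_iff_norm_sub_tendsto_zero.2 (squeeze_zero (fun _ => norm_nonneg _) hbb h2ε)
  have tev := hce.tendsto.comp ta
  have tψ := hc.tendsto.comp ta
  have tψb := hc.tendsto.comp tb
  have t1 : Tendsto (fun n => rig (θ (τ n (k n))) (ψ (τ n (k n))) x) atTop
      (𝓝 (rig (θ (x 1)) (ψ (x 1)) x)) := by
    have tnv : Tendsto (fun n => nv (θ (τ n (k n)))) atTop (𝓝 (nv (θ (x 1)))) := by
      simp only [nv_ev]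
      have hcc : Continuous fun v : V2 => (![-(v 1), v 0] : V2) := by fun_prop
      exact (hcc.tendsto _).comp tev
    exact (tψ.add (tev.const_smul (x 0))).add (tnv.const_smul (x 1))
  have t2 : Tendsto (fun n => 2 * (ε n + 2 * ‖ψ (τ n (k n)) - ψ (τ n (k n - 1))‖ / lam)) atTop
      (𝓝 0) := by
    have := (tψ.sub tψb).norm
    simp only [Function.comp_def, sub_self, norm_zero] at this
    simpa using (hε0.add ((this.const_mul 2).div_const lam)).const_mul 2
  have t3 : Tendsto (fun n => gmap L lam (ε n) (fun k => θ (τ n k)) (fun k => ψ (τ n k)) (V n) x -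
      rig (θ (τ n (k n))) (ψ (τ n (k n))) x) atTop (𝓝 0) := by
    refine squeeze_zero_norm' ?_ t2
    filter_upwards [ta.eventually (Ioo_mem_nhds (by linarith : x 1 - η < x 1) (by linarith : x 1 < x 1 + η)),
      tb.eventually (Ioo_mem_nhds (by linarith : x 1 - η < x 1) (by linarith : x 1 < x 1 + η))] with n n1 n2
    rw [gmap_eq hx]
    refine ((h n).close x ⟨hx.1.le, hx.2.le⟩).trans ?_
    have hlt : τ n (k n - 1) < τ n (k n) := by
      have h1 := (hτ n (k n - 1)).2.2
      have h2 := (hτ n (k n)).2.1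
      push_cast at h1
      linarith
    have hTg := hTan _ (hτ n (k n - 1)).1 _ (hτ n (k n)).1 n2 n1 hlt
    have he := (h n).hε
    rw [show ⌊x 1 / ε n⌋ = k n from rfl, Dk, if_pos hTg]
    apply le_of_eq
    field_simp
  have := t3.add t1
  simpa using this

lemma bv_ae_cont {E : Type*} [NormedAddCommGroup E] [NormedSpace ℝ E] [FiniteDimensional ℝ E]
    {f : ℝ → E} {a b : ℝ} (h : BoundedVariationOn f (Ioo a b)) :
    ∀ᵐ t : ℝ, t ∈ Ioo a b → ContinuousAt f t := by
  filter_upwards [h.locallyBoundedVariationOn.ae_differentiableWithinAt_of_mem] with t ht htt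
  exact (ht htt).continuousWithinAt.continuousAt (Ioo_mem_nhds htt.1 htt.2)

/-- Good heights have full measure. -/
lemma good_null {T : Set ℝ} {θ : ℝ → ℝ} {ψ : ℝ → V2} {P : Set ℝ}
    (H : ∀ t0 ∈ P, ∃ δ > 0, ∀ s ∈ T, ∀ t ∈ T, s ∈ Ioo (t0 - δ) (t0 + δ) →
      t ∈ Ioo (t0 - δ) (t0 + δ) → s < t → t0 ∉ Icc s t → Tang θ ψ s t) :
    volume {t0 ∈ P | ¬ ∃ η > 0, ∀ s ∈ T, ∀ t ∈ T, s ∈ Ioo (t0 - η) (t0 + η) →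
      t ∈ Ioo (t0 - η) (t0 + η) → s < t → Tang θ ψ s t} = 0 := by
  refine measure_null_of_locally_null _ fun t0 ht0 => ?_
  obtain ⟨δ, hδ, hh⟩ := H t0 ht0.1
  refine ⟨_, inter_mem_nhdsWithin _ (Ioo_mem_nhds (by linarith : t0 - δ < t0) (by linarith : t0 < t0 + δ)), ?_⟩
  refine measure_mono_null (t := {t0}) ?_ (by simp)
  rintro t ⟨⟨htP, ht⟩, ht2⟩
  by_contra hne
  apply ht
  have hne : t ≠ t0 := hne
  have hpos : 0 < |t - t0| := abs_pos.2 (sub_ne_zero.2 hne)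
  obtain ⟨q1, q2⟩ := ht2
  refine ⟨min |t - t0| (min (t - (t0 - δ)) (t0 + δ - t)), by
    refine lt_min hpos (lt_min ?_ ?_) <;> linarith, ?_⟩
  intro s hs s' hs' hI hI' hss
  have m1 := min_le_left |t - t0| (min (t - (t0 - δ)) (t0 + δ - t))
  have m2 := (min_le_right |t - t0| (min (t - (t0 - δ)) (t0 + δ - t))).trans (min_le_left _ _)
  have m3 := (min_le_right |t - t0| (min (t - (t0 - δ)) (t0 + δ - t))).trans (min_le_right _ _)
  obtain ⟨i1, i2⟩ := hI
  obtain ⟨i3, i4⟩ := hI'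
  refine hh s hs s' hs' ⟨by linarith, by linarith⟩ ⟨by linarith, by linarith⟩ hss ?_
  rintro ⟨j1, j2⟩
  rcases lt_or_gt_of_ne hne with hl | hl
  · have := abs_of_neg (sub_neg.2 hl); linarith
  · have := abs_of_pos (sub_pos.2 hl); linarith

theorem approx_core {Ω : Set V2} (hΩ : IsOpen Ω) (hb : Bornology.IsBounded Ω) {a b : ℝ}
    (hab : ∀ x ∈ Ω, x 1 ∈ Ioo a b) {θ : ℝ → ℝ} {ψ : ℝ → V2} (hψ : BoundedVariationOn ψ (Ioo a b))
    (hθ : BoundedVariationOn (fun t => ev (θ t)) (Ioo a b)) {A B : ℝ} (hA : 0 ≤ A)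
    (hB : ∀ t, ‖ψ t‖ ≤ B) (hout : ∀ t, A ≤ |t| → θ t = 0 ∧ ψ t = 0) {T : Set ℝ} (hT : Dense T)
    {u : V2 → V2} (hu : ∀ᵐ x ∂(volume.restrict Ω), u x = rig (θ (x 1)) (ψ (x 1)) x)
    (H : ∀ x ∈ Ω, ∃ δ > 0, ∀ s ∈ T, ∀ t ∈ T, s ∈ Ioo (x 1 - δ) (x 1 + δ) →
      t ∈ Ioo (x 1 - δ) (x 1 + δ) → s < t → x 1 ∉ Icc s t → Tang θ ψ s t)
    {gu : V2 → Mat2} {σ : Measure V2} {gs : V2 → Mat2} (hBV : HasBVDerivOn Ω u gu σ gs)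
    {lam : ℝ} (hlam : lam ∈ Ioo (0:ℝ) 1)
    (ε : ℕ → ℝ) (hεpos : ∀ n, 0 < ε n) (hε0 : Tendsto ε atTop (𝓝 0)) :
    ∃ un : ℕ → V2 → V2, ∃ Rn : ℕ → V2 → Mat2, ∃ γn : ℕ → V2 → ℝ,
      (∀ n, MemAeps Ω lam (ε n) (un n) (Rn n) (γn n)) ∧
      WeakStarToBV Ω un u := by
  have hB0 : 0 ≤ B := (norm_nonneg _).trans (hB 0)
  obtain ⟨E0, hE0⟩ := hε0.bddAbove_range
  have hE0' : ∀ n, ε n ≤ E0 := fun n => hE0 ⟨n, rfl⟩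
  have hE00 : 0 ≤ E0 := (hεpos 0).le.trans (hE0' 0)
  obtain ⟨M, hM⟩ := hb.exists_norm_le
  set L : ℝ := max M 0 + 1 with hLdef
  have hLpos : 0 < L := by positivity
  have hcoord : ∀ x ∈ Ω, ∀ i, |x i| < L := by
    intro x hx i
    have := norm_le_pi_norm x i
    have h2 := hM x hx
    rw [Real.norm_eq_abs] at this
    have := le_max_left M 0
    linarith
  have hΩL : ∀ x ∈ Ω, x 0 ∈ Ioo (-L) L := fun x hx => abs_lt.1 (hcoord x hx 0)
  obtain ⟨C, hC, hgl⟩ := exists_glob hLpos.le hlam hE00 hA hB hout hT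
  choose τ V hτ hG using fun n => hgl (ε n) (hεpos n) (hE0' n)
  set un : ℕ → V2 → V2 := fun n =>
    gmap L lam (ε n) (fun k => θ (τ n k)) (fun k => ψ (τ n k)) (V n) with hun
  have hDk : ∀ n k, Dk C θ ψ (τ n (k - 1)) (τ n k) ≤ 4 * B + C := by
    intro n k
    refine (Dk_le hC θ ψ _ _).trans ?_
    have := norm_sub_le (ψ (τ n k)) (ψ (τ n (k - 1)))
    have := hB (τ n k)
    have := hB (τ n (k - 1))
    linarith
  have hKb : ∀ n k, 1 + Dk C θ ψ (τ n (k - 1)) (τ n k) / (lam * ε n) ≤ 1 + (4 * B + C) / (lam * ε n) := by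
    intro n k
    have := hDk n k
    have := mul_pos hlam.1 (hεpos n)
    gcongr
  have hlip := fun n => (hG n).lip hLpos.le (hKb n)
  choose Rn γn hmem using fun n => glob_memAeps (hG n) hLpos.le (hKb n) hΩ hb hΩL
  have hsob : ∀ n, IsSobolev11On Ω (un n) (gJ (un n)) := fun n => sob_of_lip (hlip n) hb
  -- pointwise convergence
  have hpt : ∀ᵐ x ∂(volume.restrict Ω), Tendsto (fun n => un n x) atTop (𝓝 (u x)) := by
    have n1 := ae_snd_notMem (N := {t | t ∈ Ioo a b ∧ ¬ ContinuousAt ψ t}) (measure_eq_zero_iff_ae_notMem.2 (by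
      filter_upwards [bv_ae_cont hψ] with t ht hh; exact hh.2 (ht hh.1)))
    have n2 := ae_snd_notMem (N := {t | t ∈ Ioo a b ∧ ¬ ContinuousAt (fun t => ev (θ t)) t})
      (measure_eq_zero_iff_ae_notMem.2 (by
      filter_upwards [bv_ae_cont hθ] with t ht hh; exact hh.2 (ht hh.1)))
    have n3 := ae_snd_notMem (good_null (P := (fun x : V2 => x 1) '' Ω) (T := T) (θ := θ) (ψ := ψ) (by
      rintro t0 ⟨x, hx, rfl⟩; exact H x hx))
    rw [ae_restrict_iff' hΩ.measurableSet] at hu ⊢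
    filter_upwards [hu, n1, n2, n3] with x hx h1 h2 h3 hxΩ
    rw [hx hxΩ]
    have c1 : ContinuousAt ψ (x 1) := by by_contra hh; exact h1 ⟨hab x hxΩ, hh⟩
    have c2 : ContinuousAt (fun t => ev (θ t)) (x 1) := by by_contra hh; exact h2 ⟨hab x hxΩ, hh⟩
    have c3 := not_and.1 h3 ⟨x, hxΩ, rfl⟩
    rw [not_not] at c3
    obtain ⟨η, hη, hT'⟩ := c3
    exact ptw hε0 hτ hG (hΩL x hxΩ) c1 c2 hη hT'
  have hunb : ∀ n, ∀ x ∈ Ω, ‖un n x‖ ≤ B + L + L + 2 * (E0 + (4 * B + C) / lam) := by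
    intro n x hx
    have h1 := (hG n).close x ⟨(hΩL x hx).1.le, (hΩL x hx).2.le⟩
    simp only [hun]
    rw [gmap_eq (hΩL x hx)]
    have h2 : ‖rig (θ (τ n ⌊x 1 / ε n⌋)) (ψ (τ n ⌊x 1 / ε n⌋)) x‖ ≤ B + L + L := by
      refine (norm_add_le _ _).trans (add_le_add ((norm_add_le _ _).trans (add_le_add (hB _) ?_)) ?_)
      · rw [norm_smul, Real.norm_eq_abs]
        have := norm_ev (θ (τ n ⌊x 1 / ε n⌋))
        nlinarith [hcoord x hx 0, abs_nonneg (x 0), norm_nonneg (ev (θ (τ n ⌊x 1 / ε n⌋)))]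
      · rw [norm_smul, Real.norm_eq_abs]
        have := norm_nv (θ (τ n ⌊x 1 / ε n⌋))
        nlinarith [hcoord x hx 1, abs_nonneg (x 1), norm_nonneg (nv (θ (τ n ⌊x 1 / ε n⌋)))]
    have h3 := norm_le_norm_add_norm_sub' (glob lam (ε n) (fun k => θ (τ n k)) (fun k => ψ (τ n k)) (V n) x)
      (rig (θ (τ n ⌊x 1 / ε n⌋)) (ψ (τ n ⌊x 1 / ε n⌋)) x)
    have h4 : (1 + Dk C θ ψ (τ n (⌊x 1 / ε n⌋ - 1)) (τ n ⌊x 1 / ε n⌋) / (lam * ε n)) * ε n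
        ≤ E0 + (4 * B + C) / lam := by
      have hl := hlam.1
      have he := hεpos n
      have e : (1 + Dk C θ ψ (τ n (⌊x 1 / ε n⌋ - 1)) (τ n ⌊x 1 / ε n⌋) / (lam * ε n)) * ε n
        = ε n + Dk C θ ψ (τ n (⌊x 1 / ε n⌋ - 1)) (τ n ⌊x 1 / ε n⌋) / lam := by field_simp
      rw [e]
      have := hDk n ⌊x 1 / ε n⌋
      have := hE0' n
      gcongr
    linarith
  have hL1 : ∀ i, Tendsto (fun n => ∫ x in Ω, |un n x i - u x i|) atTop (𝓝 0) := by
    intro i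
    have hui := comp_int hBV.int_u i
    have := tendsto_integral_of_dominated_convergence (μ := volume.restrict Ω)
      (F := fun n x => |un n x i - u x i|) (f := fun _ => 0)
      (fun x => (B + L + L + 2 * (E0 + (4 * B + C) / lam)) + |u x i|) ?_ ?_ ?_ ?_
    · simpa using this
    · intro n
      exact ((comp_int (hsob n).int_u i).sub hui).abs.aestronglyMeasurable
    · refine Integrable.add ?_ hui.abs
      exact integrableOn_const hb.measure_lt_top.ne
    · intro n
      rw [ae_restrict_iff' hΩ.measurableSet]
      refine Eventually.of_forall fun x hx => ?_
      rw [Real.norm_eq_abs, abs_abs]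
      have h1 := hunb n x hx
      have h2 := norm_le_pi_norm (un n x) i
      rw [Real.norm_eq_abs] at h2
      have := abs_sub (un n x i) (u x i)
      linarith
    · filter_upwards [hpt] with x hx
      have := (tendsto_pi_nhds.1 hx i).sub_const (u x i)
      simpa using this.abs
  -- gradient bounds
  have hgrad : ∀ S, IsCompact S → S ⊆ Ω → ∀ i j, ∃ C, ∀ᶠ n in atTop,
      ∫ x in S, |gJ (un n) x i j| ≤ C := by
    intro S hS hSΩ i j
    have key : ∃ D : ℝ, 0 ≤ D ∧ ∀ᶠ n in atTop, ∫⁻ x in S, ‖gJ (un n) x i j‖ₑ ≤ ENNReal.ofReal D := by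
      refine hS.induction_on (p := fun S => ∃ D : ℝ, 0 ≤ D ∧ ∀ᶠ n in atTop,
        ∫⁻ x in S, ‖gJ (un n) x i j‖ₑ ≤ ENNReal.ofReal D) ⟨0, le_rfl, by simp⟩ ?_ ?_ ?_
      · rintro s t hst ⟨D, hD, h⟩
        exact ⟨D, hD, h.mono fun n hn => (lintegral_mono_set hst).trans hn⟩
      · rintro s t ⟨D, hD, h⟩ ⟨D', hD', h'⟩
        refine ⟨D + D', by positivity, ?_⟩
        filter_upwards [h, h'] with n hn hn'
        refine (lintegral_union_le _ _ _).trans ?_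
        rw [ENNReal.ofReal_add hD hD']
        exact add_le_add hn hn'
      · intro x hx
        obtain ⟨δ, hδ, hTan⟩ := H x (hSΩ hx)
        obtain ⟨q1, q2⟩ := hab x (hSΩ hx)
        set δ' := min δ (min (x 1 - a) (b - x 1)) with hδ'
        have hδ'0 : 0 < δ' := lt_min hδ (lt_min (by linarith) (by linarith))
        have m1 : δ' ≤ δ := min_le_left _ _
        have m2 : δ' ≤ x 1 - a := (min_le_right _ _).trans (min_le_left _ _)
        have m3 : δ' ≤ b - x 1 := (min_le_right _ _).trans (min_le_right _ _)
        refine ⟨{y : V2 | y 0 ∈ Ioo (-L) L ∧ |y 1 - x 1| < δ' / 4}, ?_,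
          2 * L * (δ' + (2 * (eVariationOn ψ (Ioo a b)).toReal + 2 * C) / lam), ?_, ?_⟩
        · apply mem_nhdsWithin_of_mem_nhds
          have o : IsOpen {y : V2 | y 0 ∈ Ioo (-L) L ∧ |y 1 - x 1| < δ' / 4} := by
            apply IsOpen.inter
            · exact isOpen_Ioo.preimage (continuous_apply 0)
            · exact isOpen_lt (f := fun y : V2 => |y 1 - x 1|) (by fun_prop) continuous_const
          exact o.mem_nhds ⟨hΩL x (hSΩ hx), by simp [hδ'0]⟩
        · have := hlam.1
          positivity
        · filter_upwards [hε0.eventually (gt_mem_nhds (by positivity : 0 < δ' / 8))] with n hn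
          refine loc_bound hLpos.le hC (hτ n) (hG n) (fun t ht => ?_) hψ ?_ hn i j
          · exact ⟨by linarith [ht.1], by linarith [ht.2]⟩
          · intro s hs t ht hsI htI
            exact hTan s hs t ht ⟨by linarith [hsI.1], by linarith [hsI.2]⟩
              ⟨by linarith [htI.1], by linarith [htI.2]⟩
    obtain ⟨D, hD, h⟩ := key
    refine ⟨D, h.mono fun n hn => ?_⟩
    have e := integral_norm_eq_lintegral_enorm (μ := volume.restrict S)
      (f := fun x => gJ (un n) x i j) (gJ_meas _ i j).aestronglyMeasurable
    simp only [Real.norm_eq_abs] at e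
    rw [e]
    exact ENNReal.toReal_le_of_le_ofReal hD hn
  refine ⟨un, Rn, γn, hmem, gu, σ, gs, hBV, l1conv_of hBV.int_u (fun n => (hsob n).int_u) hL1, ?_⟩
  exact fun gn hgn => measConv_of hΩ hBV hsob hL1 hgrad gn hgn


lemma st_fin {f : ℝ → ℝ} (hf : Monotone f) (a b : ℝ) :
    IsFiniteMeasure (hf.stieltjesFunction.measure.restrict (Ioo a b)) := by
  constructor
  rw [Measure.restrict_apply_univ, StieltjesFunction.measure_Ioo]
  exact ENNReal.ofReal_lt_top

lemma st_ibp {f : ℝ → ℝ} (hf : Monotone f) {a b : ℝ} {φ : ℝ → ℝ} (hφ : ContDiff ℝ 1 φ)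
    (hc : HasCompactSupport φ) (hs : tsupport φ ⊆ Ioo a b) :
    ∫ t, f t * deriv φ t = - ∫ t, φ t ∂(hf.stieltjesFunction.measure.restrict (Ioo a b)) := by
  have := st_fin hf a b
  set F := hf.stieltjesFunction with hF
  set ν := F.measure.restrict (Ioo a b) with hν
  have hdc : Continuous (deriv φ) := hφ.continuous_deriv le_rfl
  have hdi : Integrable (deriv φ) := hdc.integrable_of_hasCompactSupport hc.deriv
  have e1 : ∀ t, φ t = ∫ s, (Iic t).indicator (deriv φ) s := by
    intro t
    rw [integral_indicator measurableSet_Iic, hc.integral_Iic_deriv_eq hφ]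
  have hm : MeasurableSet {p : ℝ × ℝ | p.2 ≤ p.1} := measurableSet_le measurable_snd measurable_fst
  have hintg : Integrable (Function.uncurry fun t s => (Iic t).indicator (deriv φ) s) (ν.prod volume) := by
    have h1 : Integrable (fun p : ℝ × ℝ => deriv φ p.2) (ν.prod volume) := hdi.comp_snd ν
    have h2 := h1.indicator hm
    refine h2.congr (Eventually.of_forall fun p => ?_)
    simp [Function.uncurry, indicator]
  have e2 : ∫ t, φ t ∂ν = ∫ s, deriv φ s * ν.real (Ici s) := by
    calc ∫ t, φ t ∂ν = ∫ t, (∫ s, (Iic t).indicator (deriv φ) s) ∂ν := by simp_rw [← e1]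
      _ = ∫ s, ∫ t, (Iic t).indicator (deriv φ) s ∂ν := integral_integral_swap hintg
      _ = _ := by
        congr 1; ext s
        have : (fun t => (Iic t).indicator (deriv φ) s) = (Ici s).indicator (fun _ => deriv φ s) := by
          ext t; simp [indicator]
        rw [this, integral_indicator measurableSet_Ici]
        simp [mul_comm, Measure.real]
  have hae : ∀ᵐ s : ℝ, Function.leftLim F s = f s := by
    have hcount := hf.countable_not_continuousAt
    filter_upwards [measure_eq_zero_iff_ae_notMem.1 (hcount.measure_zero volume)] with s hs
    have hcs : ContinuousAt f s := by simpa using hs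
    have t1 : Tendsto F (𝓝[<] s) (𝓝 (Function.leftLim F s)) := F.mono.tendsto_leftLim s
    have hl : Function.leftLim F s ≤ F s := F.mono.leftLim_le le_rfl
    have hr : F s = f s := by
      rw [hF, hf.stieltjesFunction_eq]
      exact (hcs.continuousWithinAt).rightLim_eq
    have hge : f s ≤ Function.leftLim F s := by
      refine le_of_tendsto_of_tendsto (hcs.tendsto.mono_left nhdsWithin_le_nhds) t1 ?_
      refine Eventually.of_forall fun t => ?_
      simp only [hF]
      rw [hf.stieltjesFunction_eq]
      exact hf.le_rightLim le_rfl
    linarith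
  have hz : ∫ s, deriv φ s = 0 := by
    have h1 := hc.integral_Iic_deriv_eq hφ b
    have h2 := hc.integral_Ioi_deriv_eq hφ b
    rw [← intervalIntegral.integral_Iic_add_Ioi hdi.integrableOn hdi.integrableOn, h1, h2]
    ring
  have hfi : Integrable (fun s => f s * deriv φ s) := by
    obtain ⟨M, hM⟩ := (hc.deriv.isCompact).isBounded.subset_closedBall 0
    have hsub : tsupport (deriv φ) ⊆ Icc (-M) M := by
      rw [← Real.closedBall_zero_eq_Icc]; exact hM
    have h1 : IntegrableOn (fun s => f s * deriv φ s) (Icc (-M) M) := by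
      have h2 : IntegrableOn (fun s => deriv φ s) (Icc (-M) M) := hdi.integrableOn
      refine Integrable.bdd_mul (c := max |f (-M)| |f M|) h2 hf.measurable.aestronglyMeasurable ?_
      rw [ae_restrict_iff' measurableSet_Icc]
      refine Eventually.of_forall fun t ht => ?_
      exact abs_le_max_abs_abs (hf ht.1) (hf ht.2)
    refine h1.integrable_of_forall_notMem_eq_zero fun t ht => ?_
    rw [image_eq_zero_of_notMem_tsupport (fun h => ht (hsub h)), mul_zero]
  rw [e2]
  have e3 : (fun s => deriv φ s * ν.real (Ici s)) =ᵐ[volume]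
      fun s => Function.leftLim F b * deriv φ s - f s * deriv φ s := by
    filter_upwards [hae] with s hs1
    by_cases h0 : s ∈ tsupport (deriv φ)
    · have hsI : s ∈ Ioo a b := hs (tsupport_deriv_subset h0)
      have : ν.real (Ici s) = Function.leftLim F b - f s := by
        have hset : Ici s ∩ Ioo a b = Ico s b := by
          ext t; simp only [mem_inter_iff, mem_Ici, mem_Ioo, mem_Ico]
          constructor
          · rintro ⟨p, q, r⟩; exact ⟨p, r⟩
          · rintro ⟨p, q⟩; exact ⟨p, hsI.1.trans_le p, q⟩
        rw [Measure.real, hν, Measure.restrict_apply measurableSet_Ici, hset,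
          StieltjesFunction.measure_Ico, hs1, ENNReal.toReal_ofReal]
        rw [← hs1, sub_nonneg]
        exact F.mono.leftLim hsI.2.le
      rw [this]; ring
    · rw [image_eq_zero_of_notMem_tsupport h0]; ring
  rw [integral_congr_ae e3, integral_sub (hdi.const_mul _) hfi, integral_const_mul, hz]
  ring

lemma bv_split {ϑ : ℝ → ℝ} {a b : ℝ} (h : BoundedVariationOn ϑ (Ioo a b)) :
    ∃ p q : ℝ → ℝ, Monotone p ∧ Monotone q ∧ ∀ t ∈ Ioo a b, ϑ t = p t - q t := by
  by_cases hab : a < b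
  swap
  · exact ⟨0, 0, monotone_const, monotone_const, fun t ht => absurd (ht.1.trans ht.2) hab⟩
  set m := (a + b) / 2
  have hm : m ∈ Ioo a b := ⟨by simp only [m]; linarith, by simp only [m]; linarith⟩
  have m1 := variationOnFromTo.monotoneOn h.locallyBoundedVariationOn hm
  have m2 := variationOnFromTo.sub_self_monotoneOn h.locallyBoundedVariationOn hm
  have hb1 : ∀ t ∈ Ioo a b, |variationOnFromTo ϑ (Ioo a b) m t| ≤ (eVariationOn ϑ (Ioo a b)).toReal := by
    intro t ht
    rcases le_total m t with hl | hl
    · rw [abs_of_nonneg (variationOnFromTo.nonneg_of_le _ _ hl), variationOnFromTo.eq_of_le _ _ hl]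
      exact ENNReal.toReal_mono h (eVariationOn.mono _ inter_subset_left)
    · rw [abs_of_nonpos (variationOnFromTo.nonpos_of_ge _ _ hl), variationOnFromTo.eq_of_ge _ _ hl, neg_neg]
      exact ENNReal.toReal_mono h (eVariationOn.mono _ inter_subset_left)
  have hb2 : ∀ t ∈ Ioo a b, |ϑ t| ≤ |ϑ m| + (eVariationOn ϑ (Ioo a b)).toReal := by
    intro t ht
    have := h.dist_le ht hm
    rw [Real.dist_eq] at this
    have := abs_sub_abs_le_abs_sub (ϑ t) (ϑ m)
    linarith
  have hbd : ∀ {f : ℝ → ℝ} {M : ℝ}, (∀ t ∈ Ioo a b, |f t| ≤ M) → BddBelow (f '' Ioo a b) ∧ BddAbove (f '' Ioo a b) := by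
    intro f M hM
    refine ⟨⟨-M, ?_⟩, ⟨M, ?_⟩⟩
    · rintro _ ⟨t, ht, rfl⟩; exact (abs_le.1 (hM t ht)).1
    · rintro _ ⟨t, ht, rfl⟩; exact (abs_le.1 (hM t ht)).2
  obtain ⟨p, hp, hpe⟩ := m1.exists_monotone_extension (hbd hb1).1 (hbd hb1).2
  have hb3 : ∀ t ∈ Ioo a b, |(variationOnFromTo ϑ (Ioo a b) m - ϑ) t| ≤
      (eVariationOn ϑ (Ioo a b)).toReal + (|ϑ m| + (eVariationOn ϑ (Ioo a b)).toReal) :=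
    fun t ht => (abs_sub _ _).trans (add_le_add (hb1 t ht) (hb2 t ht))
  obtain ⟨q, hq, hqe⟩ := m2.exists_monotone_extension (hbd hb3).1 (hbd hb3).2
  refine ⟨p, q, hp, hq, fun t ht => ?_⟩
  rw [← hpe ht, ← hqe ht]
  simp

/-- Distributional derivative of a one-dimensional BV function. -/
lemma bv1d {ϑ : ℝ → ℝ} {a b : ℝ} (h : BoundedVariationOn ϑ (Ioo a b)) :
    ∃ ν : Measure ℝ, ∃ g : ℝ → ℝ, IsFiniteMeasure ν ∧ Measurable g ∧ (∀ t, g t = 1 ∨ g t = -1) ∧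
      ∀ φ : ℝ → ℝ, ContDiff ℝ 1 φ → HasCompactSupport φ → tsupport φ ⊆ Ioo a b →
        ∫ t, ϑ t * deriv φ t = - ∫ t, φ t * g t ∂ν := by
  obtain ⟨p, q, hp, hq, hpq⟩ := bv_split h
  set μ1 := hp.stieltjesFunction.measure.restrict (Ioo a b) with hμ1
  set μ2 := hq.stieltjesFunction.measure.restrict (Ioo a b) with hμ2
  have := st_fin hp a b
  have := st_fin hq a b
  obtain ⟨s, hs, hs1, hs2⟩ := Measure.mutually_singular_measure_sub (μ := μ1) (ν := μ2)
  have hsum : μ1 + (μ2 - μ1) = μ2 + (μ1 - μ2) := by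
    have e := Measure.sub_toSignedMeasure_eq_toSignedMeasure_sub (μ := μ1) (ν := μ2)
    have e' : μ1.toSignedMeasure + (μ2 - μ1).toSignedMeasure = μ2.toSignedMeasure + (μ1 - μ2).toSignedMeasure := by
      rw [sub_eq_sub_iff_add_eq_add] at e
      rw [e]; abel
    rw [← Measure.toSignedMeasure_add, ← Measure.toSignedMeasure_add] at e'
    exact Measure.toSignedMeasure_eq_toSignedMeasure_iff.1 e'
  classical
  set g : ℝ → ℝ := fun t => if t ∈ s then -1 else 1 with hg
  refine ⟨(μ1 - μ2) + (μ2 - μ1), g, inferInstance, ?_, ?_, ?_⟩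
  · exact Measurable.ite hs measurable_const measurable_const
  · intro t; simp only [hg]; split_ifs <;> simp
  intro φ hφ hc hsup
  obtain ⟨M, hM⟩ := hc.exists_bound_of_continuous hφ.continuous
  have hφi : ∀ μ : Measure ℝ, IsFiniteMeasure μ → Integrable φ μ := by
    intro μ hμ
    exact Integrable.of_bound hφ.continuous.aestronglyMeasurable M (Eventually.of_forall hM)
  have hdz : ∀ t, t ∉ Ioo a b → deriv φ t = 0 := by
    intro t ht
    exact image_eq_zero_of_notMem_tsupport (fun h => ht (hsup (tsupport_deriv_subset h)))
  have hdc : Continuous (deriv φ) := hφ.continuous_deriv le_rfl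
  have hdi : Integrable (deriv φ) := hdc.integrable_of_hasCompactSupport hc.deriv
  have hfi : ∀ f : ℝ → ℝ, Monotone f → Integrable (fun s => f s * deriv φ s) := by
    intro f hf
    have h1 : IntegrableOn (fun s => f s * deriv φ s) (Icc a b) := by
      have h2 : IntegrableOn (fun s => deriv φ s) (Icc a b) := hdi.integrableOn
      refine Integrable.bdd_mul (c := max |f a| |f b|) h2 hf.measurable.aestronglyMeasurable ?_
      rw [ae_restrict_iff' measurableSet_Icc]
      refine Eventually.of_forall fun t ht => ?_
      exact abs_le_max_abs_abs (hf ht.1) (hf ht.2)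
    refine h1.integrable_of_forall_notMem_eq_zero fun t ht => ?_
    rw [hdz t (fun h => ht (Ioo_subset_Icc_self h)), mul_zero]
  have e1 : ∫ t, ϑ t * deriv φ t = (- ∫ t, φ t ∂μ1) + ∫ t, φ t ∂μ2 := by
    have : (fun t => ϑ t * deriv φ t) = fun t => p t * deriv φ t - q t * deriv φ t := by
      ext t
      by_cases ht : t ∈ Ioo a b
      · rw [hpq t ht]; ring
      · rw [hdz t ht]; ring
    rw [this, integral_sub (hfi p hp) (hfi q hq), st_ibp hp hφ hc hsup, st_ibp hq hφ hc hsup]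
    ring
  have e2 : ∫ t, φ t ∂μ1 + ∫ t, φ t ∂(μ2 - μ1) = ∫ t, φ t ∂μ2 + ∫ t, φ t ∂(μ1 - μ2) := by
    rw [← integral_add_measure (hφi _ inferInstance) (hφi _ inferInstance),
      ← integral_add_measure (hφi _ inferInstance) (hφi _ inferInstance), hsum]
  have hgb : ∀ t, ‖g t‖ ≤ 1 := by intro t; simp only [hg]; split_ifs <;> simp
  have hgm : Measurable g := Measurable.ite hs measurable_const measurable_const
  have hφg : ∀ μ : Measure ℝ, IsFiniteMeasure μ → Integrable (fun t => φ t * g t) μ := fun μ hμ =>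
    (hφi μ hμ).mul_bdd hgm.aestronglyMeasurable (Eventually.of_forall hgb)
  have e3 : ∫ t, φ t * g t ∂((μ1 - μ2) + (μ2 - μ1)) = ∫ t, φ t ∂(μ1 - μ2) - ∫ t, φ t ∂(μ2 - μ1) := by
    rw [integral_add_measure (hφg _ inferInstance) (hφg _ inferInstance), sub_eq_add_neg, ← integral_neg]
    congr 1
    · apply integral_congr_ae
      filter_upwards [measure_eq_zero_iff_ae_notMem.1 hs1] with t ht
      simp [hg, ht]
    · apply integral_congr_ae
      filter_upwards [measure_eq_zero_iff_ae_notMem.1 hs2] with t ht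
      have : t ∈ s := by simpa using ht
      simp [hg, this]
  rw [e1, e3]
  linarith


abbrev eqv2 : V2 ≃ᵐ ℝ × ℝ := MeasurableEquiv.finTwoArrow

lemma eqv2_apply (x : V2) : eqv2 x = (x 0, x 1) := rfl
lemma eqv2_symm (p : ℝ × ℝ) : eqv2.symm p = ![p.1, p.2] := rfl

lemma vp : MeasurePreserving eqv2 (volume : Measure V2) (volume : Measure (ℝ × ℝ)) :=
  volume_preserving_finTwoArrow ℝ

lemma integral_V2 {F : V2 → ℝ} (hF : Integrable F) :
    ∫ x, F x = ∫ s, ∫ t, F ![s, t] := by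
  have h1 : ∫ p, F (eqv2.symm p) = ∫ x, F x :=
    vp.symm.integral_comp' (g := F)
  have h2 : Integrable (fun p => F (eqv2.symm p)) :=
    vp.symm.integrable_comp_of_integrable hF
  rw [← h1, Measure.volume_eq_prod, integral_prod _ h2]
  rfl

lemma integral_V2' {F : V2 → ℝ} (hF : Integrable F) :
    ∫ x, F x = ∫ t, ∫ s, F ![s, t] := by
  have h1 : ∫ p, F (eqv2.symm p) = ∫ x, F x :=
    vp.symm.integral_comp' (g := F)
  have h2 : Integrable (fun p => F (eqv2.symm p)) :=
    vp.symm.integrable_comp_of_integrable hF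
  rw [← h1, Measure.volume_eq_prod, integral_prod_symm _ h2]
  rfl

lemma slice1_deriv {φ : V2 → ℝ} (hφ : ContDiff ℝ (⊤ : ℕ∞) φ) (s t : ℝ) :
    HasDerivAt (fun r => φ ![s, r]) (pd 1 φ ![s, t]) t := by
  have h1 : HasDerivAt (fun r : ℝ => (![s, r] : V2)) (Pi.single 1 1) t := by
    rw [hasDerivAt_pi]
    intro i; fin_cases i
    · simpa using hasDerivAt_const t s
    · simpa using hasDerivAt_id' t
  exact (hφ.differentiable (by simp) _).hasFDerivAt.comp_hasDerivAt t h1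

lemma slice0_deriv {φ : V2 → ℝ} (hφ : ContDiff ℝ (⊤ : ℕ∞) φ) (s t : ℝ) :
    HasDerivAt (fun r => φ ![r, t]) (pd 0 φ ![s, t]) s := by
  have h1 : HasDerivAt (fun r : ℝ => (![r, t] : V2)) (Pi.single 0 1) s := by
    rw [hasDerivAt_pi]
    intro i; fin_cases i
    · simpa using hasDerivAt_id' s
    · simpa using hasDerivAt_const s t
  exact (hφ.differentiable (by simp) _).hasFDerivAt.comp_hasDerivAt s h1

lemma pd_compact {φ : V2 → ℝ} (hc : HasCompactSupport φ) (j : Fin 2) : HasCompactSupport (pd j φ) := by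
  refine hc.mono' fun x hx => ?_
  by_contra h
  exact hx (pd_eq_zero j h)

lemma slice1_tsupp {φ : V2 → ℝ} (s : ℝ) : tsupport (fun r => φ ![s, r]) ⊆ {r | ![s, r] ∈ tsupport φ} :=
  tsupport_comp_subset_preimage φ (f := fun r : ℝ => (![s, r] : V2)) (by fun_prop)

lemma slice0_tsupp {φ : V2 → ℝ} (t : ℝ) : tsupport (fun r => φ ![r, t]) ⊆ {r | ![r, t] ∈ tsupport φ} :=
  tsupport_comp_subset_preimage φ (f := fun r : ℝ => (![r, t] : V2)) (by fun_prop)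

lemma slice1_compact {φ : V2 → ℝ} (hc : HasCompactSupport φ) (s : ℝ) :
    HasCompactSupport (fun r => φ ![s, r]) := by
  have h := hc.isCompact.image (continuous_apply (1 : Fin 2))
  refine h.of_isClosed_subset (isClosed_tsupport _) fun r hr => ⟨_, slice1_tsupp s hr, by simp⟩

lemma slice0_compact {φ : V2 → ℝ} (hc : HasCompactSupport φ) (t : ℝ) :
    HasCompactSupport (fun r => φ ![r, t]) := by
  have h := hc.isCompact.image (continuous_apply (0 : Fin 2))
  refine h.of_isClosed_subset (isClosed_tsupport _) fun r hr => ⟨_, slice0_tsupp t hr, by simp⟩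

lemma slice1_C1 {φ : V2 → ℝ} (hφ : ContDiff ℝ (⊤ : ℕ∞) φ) (s : ℝ) :
    ContDiff ℝ 1 (fun r => φ ![s, r]) := by
  refine (hφ.of_le (by exact_mod_cast le_top)).comp (contDiff_pi.2 fun i => ?_)
  fin_cases i
  · exact contDiff_const
  · exact contDiff_id

lemma slice0_C1 {φ : V2 → ℝ} (hφ : ContDiff ℝ (⊤ : ℕ∞) φ) (t : ℝ) :
    ContDiff ℝ 1 (fun r => φ ![r, t]) := by
  refine (hφ.of_le (by exact_mod_cast le_top)).comp (contDiff_pi.2 fun i => ?_)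
  fin_cases i
  · exact contDiff_id
  · exact contDiff_const

lemma int_deriv_zero {φ : ℝ → ℝ} (hφ : ContDiff ℝ 1 φ) (hc : HasCompactSupport φ) :
    ∫ s, deriv φ s = 0 := by
  have hdc : Continuous (deriv φ) := hφ.continuous_deriv le_rfl
  have hdi : Integrable (deriv φ) := hdc.integrable_of_hasCompactSupport hc.deriv
  have h1 := hc.integral_Iic_deriv_eq hφ 0
  have h2 := hc.integral_Ioi_deriv_eq hφ 0
  rw [← intervalIntegral.integral_Iic_add_Ioi hdi.integrableOn hdi.integrableOn, h1, h2]
  ring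

/-- The derivative of a function of the second coordinate only. -/
lemma theta_ibp {ϑ : ℝ → ℝ} {a b : ℝ} (hm : Measurable ϑ) {M : ℝ} (hM : ∀ t, |ϑ t| ≤ M)
    {ν : Measure ℝ} [IsFiniteMeasure ν] {g : ℝ → ℝ} (hgm : Measurable g) (hg : ∀ t, g t = 1 ∨ g t = -1)
    (hibp : ∀ φ : ℝ → ℝ, ContDiff ℝ 1 φ → HasCompactSupport φ → tsupport φ ⊆ Ioo a b →
        ∫ t, ϑ t * deriv φ t = - ∫ t, φ t * g t ∂ν)
    {Ω : Set V2} (hab : ∀ x ∈ Ω, x 1 ∈ Ioo a b) {φ : V2 → ℝ} (hφ : ContDiff ℝ (⊤ : ℕ∞) φ)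
    (hc : HasCompactSupport φ) (hΩ : tsupport φ ⊆ Ω) :
    (∫ x, ϑ (x 1) * pd 0 φ x = 0) ∧
    ∫ x, ϑ (x 1) * pd 1 φ x = (- ∫ x, φ x * (g (x 1) * (ν.rnDeriv volume (x 1)).toReal)) -
      ∫ x, φ x * g (x 1) ∂((volume.prod (ν.singularPart volume)).map eqv2.symm) := by
  have hpi : ∀ j, Integrable (pd j φ) := fun j =>
    (pd_cont hφ j).integrable_of_hasCompactSupport (pd_compact hc j)
  have hintg : ∀ j, Integrable (fun x : V2 => ϑ (x 1) * pd j φ x) := fun j =>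
    (hpi j).bdd_mul (c := M) (hm.comp (measurable_pi_apply 1)).aestronglyMeasurable
      (Eventually.of_forall fun x => hM _)
  constructor
  · rw [integral_V2' (hintg 0)]
    have : ∀ t, ∫ s, ϑ ((![s, t] : V2) 1) * pd 0 φ ![s, t] = 0 := by
      intro t
      simp only [Matrix.cons_val_one, Matrix.cons_val_fin_one]
      rw [integral_const_mul]
      have e : (fun s => pd 0 φ ![s, t]) = deriv (fun r => φ ![r, t]) := by
        ext s; exact (slice0_deriv hφ s t).deriv.symm
      rw [e, int_deriv_zero (slice0_C1 hφ t) (slice0_compact hc t), mul_zero]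
    rw [show (fun t => ∫ s, ϑ ((![s, t] : V2) 1) * pd 0 φ ![s, t]) = fun _ => 0 from funext this]
    simp
  · set νs := ν.singularPart volume with hνs
    set f := ν.rnDeriv volume with hf
    have hfm : Measurable f := Measure.measurable_rnDeriv _ _
    have hfi : Integrable (fun t => (f t).toReal) := Measure.integrable_toReal_rnDeriv
    have hgb : ∀ t, ‖g t‖ ≤ 1 := by intro t; rcases hg t with h | h <;> simp [h]
    obtain ⟨K, hK⟩ := hc.exists_bound_of_continuous hφ.continuous
    have hdec : ν = νs + volume.withDensity f := ν.haveLebesgueDecomposition_add volume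
    -- slices
    have hsl : ∀ s, ∫ t, ϑ t * pd 1 φ ![s, t] =
        (- ∫ t, φ ![s, t] * (g t * (f t).toReal)) - ∫ t, φ ![s, t] * g t ∂νs := by
      intro s
      have e : (fun t => ϑ t * pd 1 φ ![s, t]) = fun t => ϑ t * deriv (fun r => φ ![s, r]) t := by
        ext t; rw [(slice1_deriv hφ s t).deriv]
      rw [e, hibp _ (slice1_C1 hφ s) (slice1_compact hc s) (fun t ht => by
        simpa using hab _ (hΩ (slice1_tsupp s ht)))]
      have hI : ∀ μ : Measure ℝ, IsFiniteMeasure μ → Integrable (fun t => φ ![s, t] * g t) μ := by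
        intro μ hμ
        refine Integrable.of_bound ((slice1_C1 hφ s).continuous.measurable.mul hgm).aestronglyMeasurable K
          (Eventually.of_forall fun t => ?_)
        rw [norm_mul]
        nlinarith [hK ![s, t], hgb t, norm_nonneg (φ ![s, t]), norm_nonneg (g t)]
      have : IsFiniteMeasure (volume.withDensity f) := by
        rw [hf]; infer_instance
      conv_lhs => rw [hdec]
      rw [integral_add_measure (hI _ inferInstance) (hI _ inferInstance),
        integral_withDensity_eq_integral_toReal_smul hfm (Measure.rnDeriv_lt_top _ _)]
      have e2 : (fun t => (f t).toReal • (φ ![s, t] * g t)) = fun t => φ ![s, t] * (g t * (f t).toReal) := by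
        ext t; simp only [smul_eq_mul]; ring
      rw [e2]; ring
    rw [integral_V2 (hintg 1)]
    simp only [Matrix.cons_val_one, Matrix.cons_val_fin_one]
    simp_rw [hsl]
    -- integrability
    obtain ⟨L, hL⟩ := (hc.isCompact.image (continuous_apply (0 : Fin 2))).isBounded.subset_closedBall 0
    have hz : ∀ s t, s ∉ Icc (-L) L → φ ![s, t] = 0 := by
      intro s t hs
      apply image_eq_zero_of_notMem_tsupport
      intro h
      apply hs
      rw [← Real.closedBall_zero_eq_Icc]
      exact hL ⟨_, h, by simp⟩
    have h1i : Integrable ((Icc (-L) L).indicator (fun _ : ℝ => K)) :=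
      (integrable_indicator_iff measurableSet_Icc).2 (integrableOn_const (by simp))
    have hφp : Measurable fun p : ℝ × ℝ => φ ![p.1, p.2] := by
      have := hφ.continuous.measurable.comp eqv2.symm.measurable
      exact this
    have hbd : ∀ s t, ‖φ ![s, t]‖ ≤ (Icc (-L) L).indicator (fun _ : ℝ => K) s := by
      intro s t
      by_cases hs : s ∈ Icc (-L) L
      · rw [indicator_of_mem hs]; exact hK _
      · rw [indicator_of_notMem hs, hz s t hs, norm_zero]
    have I1 : Integrable (fun p : ℝ × ℝ => φ ![p.1, p.2] * (g p.2 * (f p.2).toReal)) (volume.prod volume) := by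
      have := h1i.mul_prod hfi
      refine this.mono ((hφp.mul ((hgm.comp measurable_snd).mul
        (hfm.comp measurable_snd).ennreal_toReal)).aestronglyMeasurable) (Eventually.of_forall fun p => ?_)
      rw [norm_mul, norm_mul, norm_mul]
      have h1 := hbd p.1 p.2
      have h2 := hgb p.2
      have h3 : ‖g p.2‖ * ‖(f p.2).toReal‖ ≤ ‖(f p.2).toReal‖ := mul_le_of_le_one_left (norm_nonneg _) h2
      exact mul_le_mul (h1.trans (le_abs_self _)) h3 (by positivity) (norm_nonneg _)
    have I2 : Integrable (fun p : ℝ × ℝ => φ ![p.1, p.2] * g p.2) (volume.prod νs) := by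
      have := h1i.mul_prod (integrable_const (μ := νs) (1 : ℝ))
      refine this.mono ((hφp.mul (hgm.comp measurable_snd)).aestronglyMeasurable) (Eventually.of_forall fun p => ?_)
      rw [norm_mul, norm_mul]
      have h1 := hbd p.1 p.2
      have h2 := hgb p.2
      exact mul_le_mul (h1.trans (le_abs_self _)) (by simpa using h2) (by positivity) (norm_nonneg _)
    have J1 : Integrable (fun s => ∫ t, φ ![s, t] * (g t * (f t).toReal)) := I1.integral_prod_left
    have J2 : Integrable (fun s => ∫ t, φ ![s, t] * g t ∂νs) := I2.integral_prod_left
    have J1' : Integrable (fun s => - ∫ t, φ ![s, t] * (g t * (f t).toReal)) := J1.neg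
    rw [integral_sub J1' J2, integral_neg]
    congr 1
    · congr 1
      rw [integral_V2]
      · simp only [Matrix.cons_val_one, Matrix.cons_val_fin_one]
      · have := vp.integrable_comp_of_integrable (g := fun p : ℝ × ℝ => φ ![p.1, p.2] * (g p.2 * (f p.2).toReal)) I1
        refine this.congr (Eventually.of_forall fun x => ?_)
        simp only [Function.comp, eqv2_apply]
        congr 2
        ext i; fin_cases i <;> rfl
    · rw [integral_map_equiv, integral_prod]
      · rfl
      · exact I2


lemma mnorm_outer_e2 {w : V2} (hw : vnorm w = 1) {c : ℝ} (hc : c = 1 ∨ c = -1) :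
    mnorm (c • outer w e2) = 1 := by
  have : vnorm w ^ 2 = 1 := by rw [hw]; norm_num
  rw [vnorm, Real.sq_sqrt (by positivity)] at this
  rw [mnorm, Real.sqrt_eq_one]
  rcases hc with h | h <;> simp [h, outer, e2, Fin.sum_univ_two, this]

lemma apar_bv {Ω : Set V2} (hΩ : IsOpen Ω) (hb : Bornology.IsBounded Ω) {a b : ℝ}
    (hab : ∀ x ∈ Ω, x 1 ∈ Ioo a b) {ϑ : ℝ → ℝ} (hϑ : BoundedVariationOn ϑ (Ioo a b))
    {w : V2} (hw : vnorm w = 1) {lin : V2 → V2} {C : NNReal} (hl : LipschitzWith C lin) {u : V2 → V2}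
    (hu : ∀ᵐ x ∂(volume.restrict Ω), u x = lin x + ϑ (x 1) • w) :
    ∃ gu σ gs, HasBVDerivOn Ω u gu σ gs := by
  obtain ⟨p, q, hp, hq, hpq⟩ := bv_split hϑ
  obtain ⟨ν, g, hν, hgm, hg, hibp⟩ := bv1d hϑ
  set ϑ' : ℝ → ℝ := (Ioo a b).indicator ϑ with hϑ'
  have hm : Measurable ϑ' := by
    have : ϑ' = (Ioo a b).indicator (fun t => p t - q t) := indicator_congr hpq
    rw [this]; exact (hp.measurable.sub hq.measurable).indicator measurableSet_Ioo
  obtain ⟨M, hM⟩ : ∃ M, ∀ t, |ϑ' t| ≤ M := by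
    by_cases hne : (Ioo a b).Nonempty
    · obtain ⟨t0, ht0⟩ := hne
      refine ⟨|ϑ t0| + (eVariationOn ϑ (Ioo a b)).toReal, fun t => ?_⟩
      by_cases ht : t ∈ Ioo a b
      · rw [hϑ', indicator_of_mem ht]
        have := hϑ.dist_le ht ht0
        rw [Real.dist_eq] at this
        have := abs_sub_abs_le_abs_sub (ϑ t) (ϑ t0)
        linarith
      · rw [hϑ', indicator_of_notMem ht, abs_zero]; positivity
    · refine ⟨0, fun t => ?_⟩
      rw [hϑ', indicator_of_notMem (fun h => hne ⟨_, h⟩), abs_zero]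
  have hibp' : ∀ φ : ℝ → ℝ, ContDiff ℝ 1 φ → HasCompactSupport φ → tsupport φ ⊆ Ioo a b →
        ∫ t, ϑ' t * deriv φ t = - ∫ t, φ t * g t ∂ν := by
    intro φ h1 h2 h3
    rw [← hibp φ h1 h2 h3]
    congr 1; ext t
    by_cases ht : t ∈ Ioo a b
    · rw [hϑ', indicator_of_mem ht]
    · have : deriv φ t = 0 := by
        have := (support_deriv_subset (f := φ)).trans h3
        by_contra h; exact ht (this h)
      rw [this, mul_zero, mul_zero]
  have hu' : ∀ᵐ x ∂(volume.restrict Ω), u x = lin x + ϑ' (x 1) • w := by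
    filter_upwards [hu, ae_restrict_mem hΩ.measurableSet] with x h1 h2
    rw [h1, hϑ', indicator_of_mem (hab x h2)]
  have hsl := sob_of_lip hl hb
  have hvol : volume Ω ≠ ⊤ := hb.measure_lt_top.ne
  have : IsFiniteMeasure (volume.restrict Ω) := ⟨by simpa using hvol.lt_top⟩
  set f := ν.rnDeriv volume with hf
  set νs := ν.singularPart volume with hνs
  have hfm : Measurable f := Measure.measurable_rnDeriv _ _
  have hfi : Integrable (fun t => (f t).toReal) := Measure.integrable_toReal_rnDeriv
  have hgb : ∀ t, ‖g t‖ ≤ 1 := by intro t; rcases hg t with h | h <;> simp [h]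
  obtain ⟨L, hL⟩ := (hb.image_eval 0).subset_closedBall 0
  have hL' : ∀ x ∈ Ω, x 0 ∈ Icc (-L) L := by
    intro x hx
    rw [← Real.closedBall_zero_eq_Icc]
    exact hL ⟨x, hx, rfl⟩
  have hgf : IntegrableOn (fun x : V2 => g (x 1) * (f (x 1)).toReal) Ω := by
    have h1i : Integrable ((Icc (-L) L).indicator (fun _ : ℝ => (1:ℝ))) :=
      (integrable_indicator_iff measurableSet_Icc).2 (integrableOn_const (by simp))
    have hp := h1i.mul_prod hfi
    have := vp.integrable_comp_of_integrable hp
    refine Integrable.mono (this.integrableOn (s := Ω)) ?_ ?_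
    · exact ((hgm.comp (measurable_pi_apply 1)).mul
        (hfm.comp (measurable_pi_apply 1)).ennreal_toReal).aestronglyMeasurable
    · filter_upwards [ae_restrict_mem hΩ.measurableSet] with x hx
      simp only [Function.comp, eqv2_apply, indicator_of_mem (hL' x hx), one_mul]
      rw [norm_mul]
      exact mul_le_of_le_one_left (norm_nonneg _) (hgb _)
  set σ0 : Measure V2 := (volume.prod νs).map eqv2.symm with hσ0
  refine ⟨fun x => gJ lin x + (g (x 1) * (f (x 1)).toReal) • outer w e2, σ0.restrict Ω,
    fun x => g (x 1) • outer w e2, ?_⟩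
  refine ⟨?_, ?_, ?_, ?_, ?_, ?_, ?_, ?_⟩
  · have : IntegrableOn (fun x => lin x + ϑ' (x 1) • w) Ω := by
      refine hsl.int_u.add ?_
      refine Integrable.of_bound (((hm.comp (measurable_pi_apply 1)).smul_const w).aestronglyMeasurable) (M * ‖w‖)
        (Eventually.of_forall fun x => ?_)
      rw [norm_smul]
      exact mul_le_mul_of_nonneg_right (hM _) (norm_nonneg _)
    exact Integrable.congr this (by filter_upwards [hu'] with x hx using hx.symm)
  · intro i j
    refine (hsl.int_gu i j).add ?_
    have := hgf.mul_const (outer w e2 i j)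
    simpa [IntegrableOn] using this
  · rw [Measure.restrict_apply_univ, hσ0, MeasurableEquiv.map_apply]
    have hsub : eqv2.symm ⁻¹' Ω ⊆ Icc (-L) L ×ˢ univ := by
      intro z hz
      exact ⟨hL' _ hz, trivial⟩
    refine ne_top_of_le_ne_top ?_ (measure_mono hsub)
    rw [Measure.prod_prod]
    exact ENNReal.mul_ne_top (by simp) (measure_ne_top _ _)
  · rw [Measure.restrict_apply hΩ.measurableSet.compl]; simp
  · have hs : νs ⟂ₘ volume := Measure.mutuallySingular_singularPart _ _
    obtain ⟨N, hN, h1, h2⟩ := hs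
    refine ⟨{x | x 1 ∈ N}, measurable_pi_apply 1 hN, ?_, ?_⟩
    · refine le_antisymm ((Measure.restrict_apply_le _ _).trans ?_) bot_le
      rw [hσ0, MeasurableEquiv.map_apply]
      have : eqv2.symm ⁻¹' {x : V2 | x 1 ∈ N} = univ ×ˢ N := by
        ext z; simp
      rw [this, Measure.prod_prod, h1, mul_zero]
    · have := ae_snd_notMem h2
      rw [ae_iff] at this
      simpa [compl_def] using this
  · intro i j
    refine Measurable.aemeasurable ?_
    simpa using (hgm.comp (measurable_pi_apply 1)).mul_const (outer w e2 i j)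
  · exact Eventually.of_forall fun x => mnorm_outer_e2 hw (hg _)
  · intro φ h1 h2 h3 i j
    have key := theta_ibp hm hM hgm hg hibp' hab h1 h2 h3
    have hl1 := hsl.ibp φ h1 h2 h3 i j
    have hpi : Integrable (pd j φ) := (pd_cont h1 j).integrable_of_hasCompactSupport (pd_compact h2 j)
    obtain ⟨K, hK⟩ := pd_bdd h1 h2 j
    obtain ⟨K', hK'⟩ := h2.exists_bound_of_continuous h1.continuous
    have e1 : ∫ x in Ω, u x i * pd j φ x = (∫ x in Ω, lin x i * pd j φ x) +
        w i * ∫ x, ϑ' (x 1) * pd j φ x := by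
      rw [← setInt_pd h3 j (f := fun x => ϑ' (x 1)), ← integral_const_mul, ← integral_add]
      · refine integral_congr_ae ?_
        filter_upwards [hu'] with x hx
        rw [hx]; simp; ring
      · exact (comp_int hsl.int_u i).mul_bdd (c := K) (pd_cont h1 j).aestronglyMeasurable (Eventually.of_forall fun x => hK x)
      · exact (((hpi.bdd_mul (c := M) (hm.comp (measurable_pi_apply 1)).aestronglyMeasurable
          (Eventually.of_forall fun x => hM _)).integrableOn (s := Ω))).const_mul _
    have e2' : ∫ x in Ω, φ x * (gJ lin x + (g (x 1) * (f (x 1)).toReal) • outer w e2) i j =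
        (∫ x in Ω, φ x * gJ lin x i j) + outer w e2 i j * ∫ x, φ x * (g (x 1) * (f (x 1)).toReal) := by
      rw [← setInt_of_tsupport h3 (g := fun x => φ x * (g (x 1) * (f (x 1)).toReal))
        (by intro x hx; simp [hx]), ← integral_const_mul, ← integral_add]
      · refine integral_congr_ae (Eventually.of_forall fun x => ?_)
        simp; ring
      · exact (hsl.int_gu i j).bdd_mul (c := K') h1.continuous.aestronglyMeasurable (Eventually.of_forall fun x => hK' x)
      · exact (hgf.bdd_mul (c := K') h1.continuous.aestronglyMeasurable (Eventually.of_forall fun x => hK' x)).const_mul _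
    have e3 : ∫ x in Ω, φ x * (g (x 1) • outer w e2) i j ∂σ0 =
        outer w e2 i j * ∫ x, φ x * g (x 1) ∂σ0 := by
      rw [← setInt_of_tsupport h3 (g := fun x => φ x * g (x 1)) (by intro x hx; simp [hx]), ← integral_const_mul]
      refine integral_congr_ae (Eventually.of_forall fun x => ?_)
      simp; ring
    rw [e1, e2', e3, hl1]
    fin_cases j
    · have : outer w e2 i 0 = 0 := by simp [outer, e2]
      simp only [Fin.zero_eta]
      rw [this, key.1]; ring
    · have : outer w e2 i 1 = w i := by simp [outer, e2]
      simp only [Fin.mk_one]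
      rw [this, key.2]; ring


/-- `k` is a weak derivative of `f` on `(p, q)`. -/
def WD (p q : ℝ) (f k : ℝ → ℝ) : Prop :=
  ∀ ζ : ℝ → ℝ, ContDiff ℝ (⊤ : ℕ∞) ζ → HasCompactSupport ζ → tsupport ζ ⊆ Ioo p q →
    ∫ t, f t * deriv ζ t = - ∫ t, ζ t * k t

lemma cpt_Icc {p q : ℝ} (hpq : p < q) {K : Set ℝ} (hK : IsCompact K) (h : K ⊆ Ioo p q) :
    ∃ c d, p < c ∧ c ≤ d ∧ d < q ∧ K ⊆ Icc c d := by
  rcases K.eq_empty_or_nonempty with rfl | hne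
  · exact ⟨(p + q) / 2, (p + q) / 2, by linarith, le_rfl, by linarith, by simp⟩
  · obtain ⟨c, hc⟩ := hK.exists_isLeast hne
    obtain ⟨d, hd⟩ := hK.exists_isGreatest hne
    exact ⟨c, d, (h hc.1).1, hc.2 hd.1, (h hd.1).2, fun x hx => ⟨hc.2 hx, hd.2 hx⟩⟩

lemma antideriv {p q : ℝ} (hpq : p < q) {h : ℝ → ℝ} (h1 : ContDiff ℝ (⊤ : ℕ∞) h) (h2 : HasCompactSupport h)
    (h3 : tsupport h ⊆ Ioo p q) (h0 : ∫ t, h t = 0) :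
    ∃ ζ : ℝ → ℝ, ContDiff ℝ (⊤ : ℕ∞) ζ ∧ HasCompactSupport ζ ∧ tsupport ζ ⊆ Ioo p q ∧ deriv ζ = h := by
  obtain ⟨c, d, hc, hcd, hd, hs⟩ := cpt_Icc hpq h2 h3
  have hz : ∀ t, t ∉ Icc c d → h t = 0 := fun t ht => image_eq_zero_of_notMem_tsupport fun h => ht (hs h)
  set ζ : ℝ → ℝ := fun t => ∫ r in p..t, h r with hζ
  have hder : ∀ t, HasDerivAt ζ (h t) t := fun t =>
    intervalIntegral.integral_hasDerivAt_right (h1.continuous.intervalIntegrable _ _)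
      h1.continuous.stronglyMeasurable.stronglyMeasurableAtFilter h1.continuous.continuousAt
  have hd' : deriv ζ = h := funext fun t => (hder t).deriv
  have hzero : ∀ t, t ∉ Icc c d → ζ t = 0 := by
    intro t ht
    by_cases htc : t < c
    · rw [hζ]
      apply intervalIntegral.integral_zero_ae
      refine Eventually.of_forall fun r hr => hz r fun hr' => ?_
      have : r ≤ max p t := hr.2
      have := max_lt hc htc
      linarith [hr'.1]
    · have htd : d < t := by
        by_contra h; exact ht ⟨not_lt.1 htc, not_lt.1 h⟩
      rw [hζ]
      show ∫ r in p..t, h r = 0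
      rw [intervalIntegral.integral_eq_integral_of_support_subset, h0]
      intro r hr
      have := hs (subset_tsupport _ hr)
      exact ⟨by linarith [this.1], by linarith [this.2]⟩
  have hts : tsupport ζ ⊆ Icc c d := by
    refine closure_minimal (fun t ht => ?_) isClosed_Icc
    by_contra h; exact ht (hzero t h)
  refine ⟨ζ, ?_, ?_, ?_, hd'⟩
  · rw [contDiff_infty_iff_deriv, hd']
    exact ⟨fun t => (hder t).differentiableAt, h1⟩
  · exact isCompact_Icc.of_isClosed_subset (isClosed_tsupport _) hts
  · exact hts.trans fun t ht => ⟨by linarith [ht.1], by linarith [ht.2]⟩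

lemma bump_exists {p q : ℝ} (hpq : p < q) :
    ∃ η : ℝ → ℝ, ContDiff ℝ (⊤ : ℕ∞) η ∧ HasCompactSupport η ∧ tsupport η ⊆ Ioo p q ∧ ∫ t, η t = 1 := by
  let B : ContDiffBump ((p + q) / 2) := ⟨(q - p) / 8, (q - p) / 4, by linarith, by linarith⟩
  refine ⟨B.normed volume, B.contDiff_normed, B.hasCompactSupport_normed, ?_, B.integral_normed⟩
  rw [B.tsupport_normed_eq, Real.closedBall_eq_Icc]
  intro t ht
  have h1 : (p + q) / 2 - (q - p) / 4 ≤ t := ht.1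
  have h2 : t ≤ (p + q) / 2 + (q - p) / 4 := ht.2
  constructor <;> linarith

lemma li_mul {f g : ℝ → ℝ} (hf : LocallyIntegrable f) (hg : Continuous g) (hc : HasCompactSupport g) :
    Integrable (fun t => f t * g t) := by
  have := hf.integrable_smul_left_of_hasCompactSupport hg hc
  simpa [mul_comm] using this

lemma dbr0 {p q : ℝ} (hpq : p < q) {f : ℝ → ℝ} (hf : LocallyIntegrable f) (h : WD p q f 0) :
    ∃ C, ∀ᵐ t, t ∈ Ioo p q → f t = C := by
  obtain ⟨η, e1, e2, e3, e4⟩ := bump_exists hpq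
  set C := ∫ t, f t * η t with hC
  refine ⟨C, ?_⟩
  have := isOpen_Ioo.ae_eq_zero_of_integral_contDiff_smul_eq_zero (μ := volume) (U := Ioo p q)
    (f := fun t => f t - C) ((hf.sub (locallyIntegrable_const C)).locallyIntegrableOn _) ?_
  · filter_upwards [this] with t ht hm
    linarith [ht hm]
  · intro g g1 g2 g3
    set m := ∫ t, g t with hm
    have gi : Integrable g := g1.continuous.integrable_of_hasCompactSupport g2
    have ei : Integrable η := e1.continuous.integrable_of_hasCompactSupport e2
    have hs : tsupport (fun t => g t - m * η t) ⊆ tsupport g ∪ tsupport η := by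
      refine closure_minimal (fun t ht => ?_) ((isClosed_tsupport _).union (isClosed_tsupport _))
      by_contra hn
      rw [mem_union, not_or] at hn
      apply ht
      simp [image_eq_zero_of_notMem_tsupport hn.1, image_eq_zero_of_notMem_tsupport hn.2]
    obtain ⟨ζ, z1, z2, z3, z4⟩ := antideriv hpq (h := fun t => g t - m * η t)
      (g1.sub (contDiff_const.mul e1)) ((g2.union e2).of_isClosed_subset (isClosed_tsupport _) hs)
      (hs.trans (union_subset g3 e3)) (by rw [integral_sub gi (ei.const_mul m), integral_const_mul, e4]; simp [hm])
    have hw := h ζ z1 z2 z3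
    rw [z4] at hw
    simp only [Pi.zero_apply, mul_zero, integral_zero, neg_zero] at hw
    have i1 := li_mul hf g1.continuous g2
    have i2 := li_mul hf e1.continuous e2
    have h3 : ∫ t, f t * (g t - m * η t) = (∫ t, f t * g t) - m * C := by
      rw [hC, ← integral_const_mul, ← integral_sub i1 (i2.const_mul m)]
      congr 1; ext t; ring
    have h4 : ∫ t, g t • (f t - C) = (∫ t, f t * g t) - C * m := by
      rw [hm, ← integral_const_mul, ← integral_sub i1 (gi.const_mul C)]
      congr 1; ext t; simp only [smul_eq_mul]; ring
    rw [h4]; rw [h3] at hw; linarith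

lemma prim_ibp {p q : ℝ} {k : ℝ → ℝ} (hk : Integrable k) :
    WD p q (fun t => ∫ r in p..t, k r) k := by
  intro ζ z1 z2 z3
  have hki : ∀ a b, IntervalIntegrable k volume a b := fun a b => hk.intervalIntegrable
  have hK := (hki p q).absolutelyContinuousOnInterval_intervalIntegral (c := p) left_mem_uIcc
  have hZ : AbsolutelyContinuousOnInterval ζ p q :=
    ((z1.of_le (by exact_mod_cast le_top)).contDiffOn (s := uIcc p q)).absolutelyContinuousOnInterval
  have key := hK.integral_mul_deriv_eq_deriv_mul hZ
  have hz : ∀ t, t ∉ Ioo p q → ζ t = 0 := fun t ht => image_eq_zero_of_notMem_tsupport fun h => ht (z3 h)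
  have hdz : ∀ t, t ∉ Ioo p q → deriv ζ t = 0 := by
    intro t ht
    have := (support_deriv_subset (f := ζ)).trans z3
    by_contra h; exact ht (this h)
  rw [hz q (by simp), hz p (by simp), mul_zero, mul_zero, sub_zero, zero_sub] at key
  have a1 : ∫ t in p..q, (∫ r in p..t, k r) * deriv ζ t = ∫ t, (∫ r in p..t, k r) * deriv ζ t := by
    apply intervalIntegral.integral_eq_integral_of_support_subset
    intro t ht
    by_contra hn
    exact ht (by simp [hdz t (fun h => hn (Ioo_subset_Ioc_self h))])
  have a2 : ∫ t in p..q, deriv (fun t => ∫ r in p..t, k r) t * ζ t = ∫ t in p..q, ζ t * k t := by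
    apply intervalIntegral.integral_congr_ae
    filter_upwards [(hki p q).ae_hasDerivAt_integral] with t ht ht'
    rw [(ht (uIoc_subset_uIcc ht') p left_mem_uIcc).deriv, mul_comm]
  have a3 : ∫ t in p..q, ζ t * k t = ∫ t, ζ t * k t := by
    apply intervalIntegral.integral_eq_integral_of_support_subset
    intro t ht
    by_contra hn
    exact ht (by simp [hz t (fun h => hn (Ioo_subset_Ioc_self h))])
  rw [a1, a2, a3] at key
  exact key

lemma WD.sub {p q : ℝ} {f k f' k' : ℝ → ℝ} (h : WD p q f k) (h' : WD p q f' k')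
    (hf : LocallyIntegrable f) (hf' : LocallyIntegrable f') (hk : LocallyIntegrable k)
    (hk' : LocallyIntegrable k') : WD p q (fun t => f t - f' t) (fun t => k t - k' t) := by
  intro ζ z1 z2 z3
  have hd : Continuous (deriv ζ) := z1.continuous_deriv (by exact_mod_cast le_top)
  have i1 := li_mul hf hd z2.deriv
  have i2 := li_mul hf' hd z2.deriv
  have i3 := li_mul hk z1.continuous z2
  have i4 := li_mul hk' z1.continuous z2
  have e1 : ∫ t, (f t - f' t) * deriv ζ t = (∫ t, f t * deriv ζ t) - ∫ t, f' t * deriv ζ t := by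
    rw [← integral_sub i1 i2]; congr 1; ext t; ring
  have e2 : ∫ t, ζ t * (k t - k' t) = (∫ t, ζ t * k t) - ∫ t, ζ t * k' t := by
    rw [← integral_sub (by simpa [mul_comm] using i3) (by simpa [mul_comm] using i4)]; congr 1; ext t; ring
  rw [e1, e2, h ζ z1 z2 z3, h' ζ z1 z2 z3]; ring

lemma WD.const_mul {p q : ℝ} {f k : ℝ → ℝ} (h : WD p q f k) (c : ℝ) :
    WD p q (fun t => c * f t) (fun t => c * k t) := by
  intro ζ z1 z2 z3
  have := h ζ z1 z2 z3
  have e1 : ∫ t, (c * f t) * deriv ζ t = c * ∫ t, f t * deriv ζ t := by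
    rw [← integral_const_mul]; congr 1; ext t; ring
  have e2 : ∫ t, ζ t * (c * k t) = c * ∫ t, ζ t * k t := by
    rw [← integral_const_mul]; congr 1; ext t; ring
  rw [e1, e2, this]; ring

lemma WD.congr {p q : ℝ} {f k k' : ℝ → ℝ} (h : WD p q f k) (hk : ∀ᵐ t, t ∈ Ioo p q → k t = k' t) :
    WD p q f k' := by
  intro ζ z1 z2 z3
  rw [h ζ z1 z2 z3]
  congr 1
  apply integral_congr_ae
  filter_upwards [hk] with t ht
  by_cases hm : t ∈ Ioo p q
  · simp only [ht hm]
  · rw [show ζ t = 0 from image_eq_zero_of_notMem_tsupport fun h => hm (z3 h)]; simp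

lemma prim_cont {k : ℝ → ℝ} (hk : Integrable k) (p : ℝ) : Continuous fun t => ∫ r in p..t, k r :=
  intervalIntegral.continuous_primitive (fun _ _ => hk.intervalIntegrable) p

lemma dbr {p q : ℝ} (hpq : p < q) {f k : ℝ → ℝ} (hf : LocallyIntegrable f) (hk : Integrable k)
    (h : WD p q f k) : ∃ C, ∀ᵐ t, t ∈ Ioo p q → f t = C + ∫ r in p..t, k r := by
  have hK := (prim_cont hk p).locallyIntegrable (μ := volume)
  have := h.sub (prim_ibp hk) hf hK hk.locallyIntegrable hk.locallyIntegrable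
  obtain ⟨C, hC⟩ := dbr0 hpq (hf.sub hK) (by simp only [sub_self] at this; exact this)
  refine ⟨C, ?_⟩
  filter_upwards [hC] with t ht hm
  have := ht hm
  simp only [Pi.sub_apply] at this
  linarith

lemma ae_eq_on_Ioo {p q : ℝ} {f g : ℝ → ℝ} (hf : Continuous f) (hg : Continuous g)
    (h : ∀ᵐ t, t ∈ Ioo p q → f t = g t) : ∀ t ∈ Ioo p q, f t = g t := by
  have h1 : f =ᵐ[volume.restrict (Ioo p q)] g := by
    rw [EventuallyEq, ae_restrict_iff' measurableSet_Ioo]; exact h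
  have := Measure.eqOn_open_of_ae_eq h1 isOpen_Ioo hf.continuousOn hg.continuousOn
  exact this

/-- The rigidity statement in one variable. -/
lemma rigid_1d {p q : ℝ} (hpq : p < q) {c s k0 k1 : ℝ → ℝ} (hc : LocallyIntegrable c)
    (hs : LocallyIntegrable s) (hk0 : Integrable k0) (hk1 : Integrable k1)
    (h0 : WD p q c k0) (h1 : WD p q s k1) (hu : ∀ᵐ t, t ∈ Ioo p q → c t ^ 2 + s t ^ 2 = 1)
    (hd : ∀ᵐ t, t ∈ Ioo p q → c t * k1 t - s t * k0 t = 0) :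
    ∃ c0 s0, ∀ᵐ t, t ∈ Ioo p q → c t = c0 ∧ s t = s0 := by
  obtain ⟨C, hC⟩ := dbr hpq hc hk0 h0
  obtain ⟨S, hS⟩ := dbr hpq hs hk1 h1
  have c1 := (prim_cont hk0 p).const_add C
  have c2 := (prim_cont hk1 p).const_add S
  have hone : ∀ t ∈ Ioo p q, (C + ∫ r in p..t, k0 r) ^ 2 + (S + ∫ r in p..t, k1 r) ^ 2 = 1 := by
    apply ae_eq_on_Ioo ((c1.pow 2).add (c2.pow 2)) continuous_const
    filter_upwards [hC, hS, hu] with t a1 a2 a3 hm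
    show (C + ∫ r in p..t, k0 r) ^ 2 + (S + ∫ r in p..t, k1 r) ^ 2 = 1
    rw [← a1 hm, ← a2 hm, a3 hm]
  have hk : ∀ᵐ t, t ∈ Ioo p q → k0 t = 0 ∧ k1 t = 0 := by
    filter_upwards [LocallyIntegrable.ae_hasDerivAt_integral hk0.locallyIntegrable, LocallyIntegrable.ae_hasDerivAt_integral hk1.locallyIntegrable,
      hC, hS, hu, hd] with t a1 a2 a3 a4 a5 a6 hm
    have d := (((a1 p).const_add C).pow 2).add (((a2 p).const_add S).pow 2)
    have d' : HasDerivAt (fun _ : ℝ => (1 : ℝ)) _ t := d.congr_of_eventuallyEq (by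
      filter_upwards [isOpen_Ioo.mem_nhds hm] with r hr
      exact (hone r hr).symm)
    have e := d'.unique (hasDerivAt_const t (1 : ℝ))
    rw [← a3 hm, ← a4 hm] at e
    have e5 := a5 hm
    have e6 := a6 hm
    have e' : c t * k0 t + s t * k1 t = 0 := by
      have : 2 * (c t * k0 t + s t * k1 t) = 0 := by rw [← e]; norm_num; ring
      linarith
    constructor
    · linear_combination (-k0 t) * e5 + c t * e' - s t * e6
    · linear_combination (-k1 t) * e5 + s t * e' + c t * e6
  have z0 : WD p q c 0 := h0.congr (by filter_upwards [hk] with t ht hm using (ht hm).1)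
  have z1 : WD p q s 0 := h1.congr (by filter_upwards [hk] with t ht hm using (ht hm).2)
  obtain ⟨c0, hc0⟩ := dbr0 hpq hc z0
  obtain ⟨s0, hs0⟩ := dbr0 hpq hs z1
  refine ⟨c0, s0, ?_⟩
  filter_upwards [hc0, hs0] with t a1 a2 hm using ⟨a1 hm, a2 hm⟩


def box (l r p q : ℝ) : Set V2 := {x | x 0 ∈ Ioo l r ∧ x 1 ∈ Ioo p q}

lemma box_open (l r p q : ℝ) : IsOpen (box l r p q) :=
  (isOpen_Ioo.preimage (continuous_apply (0 : Fin 2))).inter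
    (isOpen_Ioo.preimage (continuous_apply (1 : Fin 2)))

lemma int_V2p {F : V2 → ℝ} (hF : Integrable F) :
    Integrable (fun z : ℝ × ℝ => F ![z.1, z.2]) (volume.prod volume) :=
  vp.symm.integrable_comp_of_integrable hF

lemma ae_V2' {P : V2 → Prop} (h : ∀ᵐ x, P x) : ∀ᵐ t : ℝ, ∀ᵐ s : ℝ, P ![s, t] := by
  have h1 : ∀ᵐ z : ℝ × ℝ ∂(volume.prod volume), P ![z.1, z.2] :=
    vp.symm.quasiMeasurePreserving.ae h
  have h2 : ∀ᵐ z : ℝ × ℝ ∂(volume.prod volume), P ![z.2, z.1] :=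
    (Measure.measurePreserving_swap (μ := (volume : Measure ℝ)) (ν := (volume : Measure ℝ))).quasiMeasurePreserving.ae h1
  exact Measure.ae_ae_of_ae_prod h2

/-- Product test functions. -/
def tens (α ζ : ℝ → ℝ) (x : V2) : ℝ := α (x 0) * ζ (x 1)

lemma tens_smooth {α ζ : ℝ → ℝ} (hα : ContDiff ℝ (⊤ : ℕ∞) α) (hζ : ContDiff ℝ (⊤ : ℕ∞) ζ) :
    ContDiff ℝ (⊤ : ℕ∞) (tens α ζ) :=
  (hα.comp (contDiff_apply ℝ ℝ (0 : Fin 2))).mul (hζ.comp (contDiff_apply ℝ ℝ (1 : Fin 2)))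

lemma tens_tsupp (α ζ : ℝ → ℝ) : tsupport (tens α ζ) ⊆ {x | x 0 ∈ tsupport α ∧ x 1 ∈ tsupport ζ} := by
  refine closure_minimal (fun x hx => ?_) (((isClosed_tsupport _).preimage (continuous_apply (0 : Fin 2))).inter
    ((isClosed_tsupport _).preimage (continuous_apply (1 : Fin 2))))
  have h : α (x 0) * ζ (x 1) ≠ 0 := hx
  exact ⟨subset_tsupport _ (left_ne_zero_of_mul h), subset_tsupport _ (right_ne_zero_of_mul h)⟩

lemma tens_compact {α ζ : ℝ → ℝ} (hα : HasCompactSupport α) (hζ : HasCompactSupport ζ) :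
    HasCompactSupport (tens α ζ) := by
  have hK : IsCompact (Set.pi univ fun i : Fin 2 => if i = 0 then tsupport α else tsupport ζ) := by
    apply isCompact_univ_pi
    intro i; split_ifs
    · exact hα
    · exact hζ
  refine hK.of_isClosed_subset (isClosed_tsupport _) fun x hx i _ => ?_
  have := tens_tsupp α ζ hx
  fin_cases i
  · simpa using this.1
  · simpa using this.2

lemma tens_pd1 {α ζ : ℝ → ℝ} (hα : ContDiff ℝ (⊤ : ℕ∞) α) (hζ : ContDiff ℝ (⊤ : ℕ∞) ζ) (s t : ℝ) :
    pd 1 (tens α ζ) ![s, t] = α s * deriv ζ t := by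
  have h := slice1_deriv (tens_smooth hα hζ) s t
  have h2 : HasDerivAt (fun r => tens α ζ ![s, r]) (α s * deriv ζ t) t := by
    have := ((hζ.differentiable (by simp) t).hasDerivAt).const_mul (α s)
    simpa [tens] using this
  exact h.unique h2

section BoxSec
variable {l r p q : ℝ}

/-- Averages in the first variable have weak derivatives. -/
lemma wd_of_ibp {U G : V2 → ℝ} (hU : Integrable U) (hG : Integrable G)
    (hibp : ∀ φ : V2 → ℝ, ContDiff ℝ (⊤ : ℕ∞) φ → HasCompactSupport φ → tsupport φ ⊆ box l r p q →
      ∫ x, U x * pd 1 φ x = - ∫ x, φ x * G x)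
    {F H : ℝ → ℝ} (hUF : ∀ᵐ x, x ∈ box l r p q → U x = F (x 1) + x 0 * H (x 1))
    {α : ℝ → ℝ} (a1 : ContDiff ℝ (⊤ : ℕ∞) α) (a2 : HasCompactSupport α) (a3 : tsupport α ⊆ Ioo l r) :
    WD p q (fun t => (∫ s, α s) * F t + (∫ s, s * α s) * H t) (fun t => ∫ s, α s * G ![s, t]) := by
  intro ζ z1 z2 z3
  have t1 := tens_smooth a1 z1
  have t2 := tens_compact a2 z2
  have t3 : tsupport (tens α ζ) ⊆ box l r p q := fun x hx =>
    ⟨a3 (tens_tsupp _ _ hx).1, z3 (tens_tsupp _ _ hx).2⟩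
  have key := hibp _ t1 t2 t3
  obtain ⟨K, hK⟩ := pd_bdd t1 t2 1
  obtain ⟨K', hK'⟩ := t2.exists_bound_of_continuous t1.continuous
  have i1 : Integrable (fun x => U x * pd 1 (tens α ζ) x) :=
    hU.mul_bdd (c := K) (pd_cont t1 1).aestronglyMeasurable (Eventually.of_forall fun x => hK x)
  have i2 : Integrable (fun x => tens α ζ x * G x) :=
    hG.bdd_mul (c := K') t1.continuous.aestronglyMeasurable (Eventually.of_forall fun x => hK' x)
  have hαi : Integrable α := a1.continuous.integrable_of_hasCompactSupport a2
  have hαi' : Integrable (fun s => s * α s) :=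
    (continuous_id.mul a1.continuous).integrable_of_hasCompactSupport a2.mul_left
  have hdz : ∀ t, t ∉ Ioo p q → deriv ζ t = 0 := by
    intro t ht
    have := (support_deriv_subset (f := ζ)).trans z3
    by_contra h; exact ht (this h)
  rw [integral_V2' i1, integral_V2' i2] at key
  have e1 : ∫ t, ((∫ s, α s) * F t + (∫ s, s * α s) * H t) * deriv ζ t =
      ∫ t, ∫ s, U ![s, t] * pd 1 (tens α ζ) ![s, t] := by
    apply integral_congr_ae
    filter_upwards [ae_V2' hUF] with t ht
    have : ∫ s, U ![s, t] * pd 1 (tens α ζ) ![s, t] =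
        ∫ s, (α s * (F t * deriv ζ t) + (s * α s) * (H t * deriv ζ t)) := by
      apply integral_congr_ae
      filter_upwards [ht] with s hs
      rw [tens_pd1 a1 z1]
      by_cases hm : t ∈ Ioo p q
      · by_cases hm' : s ∈ Ioo l r
        · rw [hs ⟨by simpa using hm', by simpa using hm⟩]; simp; ring
        · have : α s = 0 := image_eq_zero_of_notMem_tsupport fun h => hm' (a3 h)
          simp [this]
      · simp [hdz t hm]
    simp only [this]
    rw [integral_add (hαi.mul_const _) (hαi'.mul_const _), integral_mul_const, integral_mul_const]
    ring
  have e2 : ∫ t, ζ t * ∫ s, α s * G ![s, t] = ∫ t, ∫ s, tens α ζ ![s, t] * G ![s, t] := by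
    congr 1; ext t
    rw [← integral_const_mul]
    congr 1; ext s
    simp [tens]; ring
  rw [e1, e2, key]

lemma int_slice {G : V2 → ℝ} (hG : Integrable G) {α : ℝ → ℝ} (a1 : Continuous α) (a2 : HasCompactSupport α) :
    Integrable (fun t => ∫ s, α s * G ![s, t]) ∧ ∀ᵐ t, Integrable (fun s => α s * G ![s, t]) := by
  obtain ⟨K, hK⟩ := a2.exists_bound_of_continuous a1
  have : Integrable (fun x : V2 => α (x 0) * G x) :=
    hG.bdd_mul (c := K) (a1.comp (continuous_apply (0 : Fin 2))).aestronglyMeasurable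
      (Eventually.of_forall fun x => hK _)
  have h := int_V2p this
  exact ⟨h.integral_prod_right, h.prod_left_ae⟩

/-- The first column of the gradient. -/
lemma col0 {U G : V2 → ℝ} (hU : Integrable U) (hG : Integrable G)
    (hibp : ∀ φ : V2 → ℝ, ContDiff ℝ (⊤ : ℕ∞) φ → HasCompactSupport φ → tsupport φ ⊆ box l r p q →
      ∫ x, U x * pd 0 φ x = - ∫ x, φ x * G x)
    {F H : ℝ → ℝ} (hH : Measurable H) {M : ℝ} (hM : ∀ t, |H t| ≤ M)
    (hUF : ∀ᵐ x, x ∈ box l r p q → U x = F (x 1) + x 0 * H (x 1)) :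
    ∀ᵐ x, x ∈ box l r p q → G x = H (x 1) := by
  have hHl : LocallyIntegrable (fun x : V2 => H (x 1)) := by
    refine (locallyIntegrable_const (μ := (volume : Measure V2)) M).mono
      (hH.comp (measurable_pi_apply 1)).aestronglyMeasurable (Eventually.of_forall fun x => ?_)
    exact (hM _).trans (le_abs_self _)
  have := (box_open l r p q).ae_eq_zero_of_integral_contDiff_smul_eq_zero (μ := volume)
    (f := fun x => G x - H (x 1)) ((hG.locallyIntegrable.sub hHl).locallyIntegrableOn _) ?_
  · filter_upwards [this] with x h1 h2
    linarith [h1 h2]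
  · intro φ h1 h2 h3
    have key := hibp φ h1 h2 h3
    obtain ⟨K, hK⟩ := pd_bdd h1 h2 0
    obtain ⟨K', hK'⟩ := h2.exists_bound_of_continuous h1.continuous
    have i1 : Integrable (fun x => U x * pd 0 φ x) :=
      hU.mul_bdd (c := K) (pd_cont h1 0).aestronglyMeasurable (Eventually.of_forall fun x => hK x)
    have i2 : Integrable (fun x => φ x * G x) :=
      hG.bdd_mul (c := K') h1.continuous.aestronglyMeasurable (Eventually.of_forall fun x => hK' x)
    have i3 : Integrable (fun x => φ x * H (x 1)) :=
      (h1.continuous.integrable_of_hasCompactSupport h2).mul_bdd (c := M)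
        (hH.comp (measurable_pi_apply 1)).aestronglyMeasurable (Eventually.of_forall fun x => hM _)
    have e : ∫ x, U x * pd 0 φ x = - ∫ x, φ x * H (x 1) := by
      rw [integral_V2' i1, integral_V2' i3, ← integral_neg]
      apply integral_congr_ae
      filter_upwards [ae_V2' hUF] with t ht
      have hd : ∀ s, HasDerivAt (fun s => (F t + s * H t) * φ ![s, t])
          (1 * H t * φ ![s, t] + (F t + s * H t) * pd 0 φ ![s, t]) s := fun s =>
        (((hasDerivAt_id' s).mul_const (H t)).const_add (F t)).mul (slice0_deriv h1 s t)
      have hC : ContDiff ℝ 1 (fun s => (F t + s * H t) * φ ![s, t]) :=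
        (contDiff_const.add (contDiff_id.mul contDiff_const)).mul (slice0_C1 h1 t)
      have hz := int_deriv_zero hC (slice0_compact h2 t).mul_left
      have hcs : HasCompactSupport (fun s => pd 0 φ ![s, t]) := slice0_compact (pd_compact h2 0) t
      have hcc : Continuous (fun s : ℝ => pd 0 φ ![s, t]) :=
        (pd_cont h1 0).comp (by fun_prop)
      have j1 : Integrable (fun s => H t * φ ![s, t]) :=
        ((slice0_C1 h1 t).continuous.integrable_of_hasCompactSupport (slice0_compact h2 t)).const_mul _
      have j2 : Integrable (fun s => (F t + s * H t) * pd 0 φ ![s, t]) :=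
        ((by fun_prop : Continuous fun s : ℝ => F t + s * H t).mul hcc).integrable_of_hasCompactSupport hcs.mul_left
      rw [show deriv (fun s => (F t + s * H t) * φ ![s, t]) =
        fun s => H t * φ ![s, t] + (F t + s * H t) * pd 0 φ ![s, t] from
          funext fun s => by rw [(hd s).deriv]; ring, integral_add j1 j2] at hz
      have e3 : ∫ s, U ![s, t] * pd 0 φ ![s, t] = ∫ s, (F t + s * H t) * pd 0 φ ![s, t] := by
        apply integral_congr_ae
        filter_upwards [ht] with s hs
        by_cases hm : ![s, t] ∈ box l r p q
        · rw [hs hm]; simp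
        · rw [pd_eq_zero 0 (fun h => hm (h3 h))]; simp
      rw [e3]
      have e4 : ∫ s, φ ![s, t] * H ((![s, t] : V2) 1) = ∫ s, H t * φ ![s, t] := by
        congr 1; ext s; simp; ring
      rw [e4]; linarith
    have e5 : ∫ x, φ x • (G x - H (x 1)) = (∫ x, φ x * G x) - ∫ x, φ x * H (x 1) := by
      rw [← integral_sub i2 i3]; congr 1; ext x; simp only [smul_eq_mul]; ring
    rw [e5]; linarith

lemma li_of_bdd {f : ℝ → ℝ} (hf : Measurable f) {M : ℝ} (hM : ∀ t, |f t| ≤ M) : LocallyIntegrable f :=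
  (locallyIntegrable_const (μ := volume) M).mono hf.aestronglyMeasurable
    (Eventually.of_forall fun t => (hM t).trans (le_abs_self _))

lemma li_id_mul {f : ℝ → ℝ} (hf : Measurable f) {M : ℝ} (hM : ∀ t, |f t| ≤ M) :
    LocallyIntegrable (fun t => t * f t) :=
  ((continuous_abs.mul continuous_const).locallyIntegrable (μ := volume) (f := fun t : ℝ => |t| * M)).mono
    (measurable_id.mul hf).aestronglyMeasurable
    (Eventually.of_forall fun t => by
      rw [Real.norm_eq_abs, Real.norm_eq_abs, abs_mul]
      exact (mul_le_mul_of_nonneg_left (hM t) (abs_nonneg t)).trans (le_abs_self _))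

/-- Rigidity on a box. -/
lemma rigid_box (hlr : l < r) (hpq : p < q) {u : V2 → V2} {gu : V2 → Mat2}
    (hs : IsSobolev11On (box l r p q) u gu) {c s f0 f1 : ℝ → ℝ} (hc : Measurable c) (hsm : Measurable s)
    (hf0 : Measurable f0) (hf1 : Measurable f1) {M : ℝ} (bc : ∀ t, |c t| ≤ M) (bs : ∀ t, |s t| ≤ M)
    (b0 : ∀ t, |f0 t| ≤ M) (b1 : ∀ t, |f1 t| ≤ M)
    (hu0 : ∀ᵐ x, x ∈ box l r p q → u x 0 = f0 (x 1) - x 1 * s (x 1) + x 0 * c (x 1))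
    (hu1 : ∀ᵐ x, x ∈ box l r p q → u x 1 = f1 (x 1) + x 1 * c (x 1) + x 0 * s (x 1))
    (hcs : ∀ᵐ t, t ∈ Ioo p q → c t ^ 2 + s t ^ 2 = 1)
    (hdet : ∀ᵐ x, x ∈ box l r p q → (gu x).det = 1) :
    ∃ c0 s0 d, ∀ᵐ t, t ∈ Ioo p q → c t = c0 ∧ s t = s0 ∧ c0 * f1 t - s0 * f0 t = d := by
  have hBm : MeasurableSet (box l r p q) := (box_open l r p q).measurableSet
  set U : Fin 2 → V2 → ℝ := fun i => (box l r p q).indicator (fun x => u x i) with hU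
  set G : Fin 2 → Fin 2 → V2 → ℝ := fun i j => (box l r p q).indicator (fun x => gu x i j) with hG
  have Ui : ∀ i, Integrable (U i) := fun i => (integrable_indicator_iff hBm).2 (comp_int hs.int_u i)
  have Gi : ∀ i j, Integrable (G i j) := fun i j => (integrable_indicator_iff hBm).2 (hs.int_gu i j)
  have hibp : ∀ i j, ∀ φ : V2 → ℝ, ContDiff ℝ (⊤ : ℕ∞) φ → HasCompactSupport φ → tsupport φ ⊆ box l r p q →
      ∫ x, U i x * pd j φ x = - ∫ x, φ x * G i j x := by
    intro i j φ h1 h2 h3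
    have := hs.ibp φ h1 h2 h3 i j
    rw [← integral_indicator hBm, ← integral_indicator hBm] at this
    have q1 : (fun x => U i x * pd j φ x) = (box l r p q).indicator (fun x => u x i * pd j φ x) := by
      ext x; rw [hU, indicator_mul_left]
    have q2 : (fun x => φ x * G i j x) = (box l r p q).indicator (fun x => φ x * gu x i j) := by
      ext x; rw [hG, indicator_mul_right]
    rw [q1, q2]; exact this
  have hU0 : ∀ᵐ x, x ∈ box l r p q → U 0 x = (f0 (x 1) - x 1 * s (x 1)) + x 0 * c (x 1) := by
    filter_upwards [hu0] with x hx hm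
    rw [← hx hm, hU]; exact indicator_of_mem hm _
  have hU1 : ∀ᵐ x, x ∈ box l r p q → U 1 x = (f1 (x 1) + x 1 * c (x 1)) + x 0 * s (x 1) := by
    filter_upwards [hu1] with x hx hm
    rw [← hx hm, hU]; exact indicator_of_mem hm _
  have C0 := col0 (Ui 0) (Gi 0 0) (hibp 0 0) (F := fun t => f0 t - t * s t) (H := c) hc bc hU0
  have C1 := col0 (Ui 1) (Gi 1 0) (hibp 1 0) (F := fun t => f1 t + t * c t) (H := s) hsm bs hU1
  have hD : ∀ᵐ x, x ∈ box l r p q → c (x 1) * G 1 1 x - s (x 1) * G 0 1 x = 1 := by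
    filter_upwards [C0, C1, hdet] with x h0 h1 h2 hm
    have := h2 hm
    rw [Matrix.det_fin_two] at this
    rw [← h0 hm, ← h1 hm]
    simp only [hG, indicator_of_mem hm]
    linarith
  have avg : ∀ α : ℝ → ℝ, ContDiff ℝ (⊤ : ℕ∞) α → HasCompactSupport α → tsupport α ⊆ Ioo l r →
      ∀ᵐ t, t ∈ Ioo p q → c t * (∫ x, α x * G 1 1 ![x, t]) - s t * (∫ x, α x * G 0 1 ![x, t]) = ∫ x, α x := by
    intro α a1 a2 a3
    filter_upwards [ae_V2' hD, (int_slice (Gi 1 1) a1.continuous a2).2, (int_slice (Gi 0 1) a1.continuous a2).2]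
      with t h1 h2 h3 hm
    rw [← integral_const_mul, ← integral_const_mul, ← integral_sub (h2.const_mul _) (h3.const_mul _)]
    apply integral_congr_ae
    filter_upwards [h1] with x hx
    by_cases hm' : x ∈ Ioo l r
    · have := hx ⟨by simpa using hm', by simpa using hm⟩
      simp only [Matrix.cons_val_one, Matrix.cons_val_fin_one] at this
      linear_combination (α x) * this
    · have : α x = 0 := image_eq_zero_of_notMem_tsupport fun h => hm' (a3 h)
      simp [this]
  obtain ⟨η, e1, e2, e3, e4⟩ := bump_exists hlr
  have hη' : ContDiff ℝ (⊤ : ℕ∞) (deriv η) := (contDiff_infty_iff_deriv.1 e1).2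
  set α : ℝ → ℝ := fun x => - deriv η x with hα
  have a1 : ContDiff ℝ (⊤ : ℕ∞) α := hη'.neg
  have a2 : HasCompactSupport α := e2.deriv.neg
  have a3 : tsupport α ⊆ Ioo l r := by
    refine (closure_minimal (fun x hx => ?_) (isClosed_tsupport η)).trans e3
    have : deriv η x ≠ 0 := fun h => hx (by simp [hα, h])
    exact support_deriv_subset this
  have a4 : ∫ x, α x = 0 := by
    rw [hα, integral_neg, int_deriv_zero (e1.of_le (by exact_mod_cast le_top)) e2, neg_zero]
  have a5 : ∫ x, x * α x = 1 := by
    have hC : ContDiff ℝ 1 (fun x => x * η x) := contDiff_id.mul (e1.of_le (by exact_mod_cast le_top))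
    have hz := int_deriv_zero hC e2.mul_left
    have hd : deriv (fun x => x * η x) = fun x => η x + x * deriv η x := by
      ext x
      have := ((hasDerivAt_id' x).mul (e1.differentiable (by simp) x).hasDerivAt).deriv
      rw [one_mul] at this; exact this
    have j1 : Integrable (fun x => x * deriv η x) :=
      (continuous_id.mul hη'.continuous).integrable_of_hasCompactSupport e2.deriv.mul_left
    rw [hd, integral_add (e1.continuous.integrable_of_hasCompactSupport e2) j1, e4] at hz
    rw [show (fun x => x * α x) = fun x => -(x * deriv η x) from funext fun x => by simp [hα], integral_neg]
    linarith
  have w0 := wd_of_ibp (Ui 0) (Gi 0 1) (hibp 0 1) (F := fun t => f0 t - t * s t) (H := c) hU0 a1 a2 a3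
  have w1 := wd_of_ibp (Ui 1) (Gi 1 1) (hibp 1 1) (F := fun t => f1 t + t * c t) (H := s) hU1 a1 a2 a3
  simp only [a4, a5, zero_mul, one_mul, zero_add] at w0 w1
  have d1 := avg α a1 a2 a3
  rw [a4] at d1
  obtain ⟨c0, s0, h⟩ := rigid_1d hpq (li_of_bdd hc bc) (li_of_bdd hsm bs)
    (int_slice (Gi 0 1) a1.continuous a2).1 (int_slice (Gi 1 1) a1.continuous a2).1 w0 w1 hcs d1
  have v0 := wd_of_ibp (Ui 0) (Gi 0 1) (hibp 0 1) (F := fun t => f0 t - t * s t) (H := c) hU0 e1 e2 e3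
  have v1 := wd_of_ibp (Ui 1) (Gi 1 1) (hibp 1 1) (F := fun t => f1 t + t * c t) (H := s) hU1 e1 e2 e3
  have d2 := avg η e1 e2 e3
  simp only [e4, one_mul] at v0 v1 d2
  set m := ∫ x, x * η x with hm
  have l0 : LocallyIntegrable (fun t => f0 t - t * s t + m * c t) :=
    ((li_of_bdd hf0 b0).sub (li_id_mul hsm bs)).add ((li_of_bdd hc bc).smul m)
  have l1 : LocallyIntegrable (fun t => f1 t + t * c t + m * s t) :=
    ((li_of_bdd hf1 b1).add (li_id_mul hc bc)).add ((li_of_bdd hsm bs).smul m)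
  have g0 := (int_slice (Gi 0 1) e1.continuous e2).1.locallyIntegrable
  have g1 := (int_slice (Gi 1 1) e1.continuous e2).1.locallyIntegrable
  have hw := (v1.const_mul c0).sub (v0.const_mul s0) (l1.smul c0) (l0.smul s0) (g1.smul c0) (g0.smul s0)
  have hw' := hw.congr (k' := fun _ => 1) (by
    filter_upwards [h, d2] with t h1 h2 ht
    rw [← h2 ht, (h1 ht).1, (h1 ht).2])
  obtain ⟨d, hd⟩ := dbr hpq (((l1.smul c0).sub (l0.smul s0))) (k := (Ioo p q).indicator fun _ => 1)
    ((integrable_indicator_iff measurableSet_Ioo).2 (integrableOn_const (by simp)))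
    (hw'.congr (Eventually.of_forall fun t ht => by rw [indicator_of_mem ht]))
  refine ⟨c0, s0, d - p, ?_⟩
  filter_upwards [h, hd, hcs] with t h1 h2 h3 ht
  refine ⟨(h1 ht).1, (h1 ht).2, ?_⟩
  have h4 := h2 ht
  have h5 := h3 ht
  have h6 : ∫ x in p..t, (Ioo p q).indicator (fun _ => (1:ℝ)) x = t - p := by
    rw [intervalIntegral.integral_congr_ae (g := fun _ => (1:ℝ))]
    · simp
    · refine Eventually.of_forall fun x hx => ?_
      rw [uIoc_of_le ht.1.le] at hx
      exact indicator_of_mem (show x ∈ Ioo p q from ⟨hx.1, hx.2.trans_lt ht.2⟩) _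
  rw [h6] at h4
  simp only [Pi.sub_apply, Pi.smul_apply, smul_eq_mul] at h4
  rw [(h1 ht).1, (h1 ht).2] at h4 h5
  linear_combination h4 - t * h5
end BoxSec


lemma sob_of_null {Ω B : Set V2} {u : V2 → V2} {gu : V2 → Mat2} {σ : Measure V2}
    {gs : V2 → Mat2} (h : HasBVDerivOn Ω u gu σ gs) (hB : B ⊆ Ω) (hσ : σ B = 0) :
    IsSobolev11On B u gu := by
  refine ⟨h.int_u.mono_set hB, fun i j => (h.int_gu i j).mono_set hB, ?_⟩
  intro φ hφ hc hs i j
  have e := h.ibp φ hφ hc (hs.trans hB) i j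
  rw [setInt_pd (hs.trans hB), setInt_of_tsupport (hs.trans hB) (fun x hx => by simp [hx])] at e
  rw [setInt_pd hs, setInt_of_tsupport hs (fun x hx => by simp [hx]), e]
  have : ∫ x, φ x * gs x i j ∂σ = 0 := by
    rw [← setInt_of_tsupport hs (fun x hx => by simp [hx])]
    exact setIntegral_measure_zero _ hσ
  rw [this, sub_zero]

lemma dec_unique {Ω B : Set V2} (hBo : IsOpen B) {u : V2 → V2} {gu gu' : V2 → Mat2}
    {σ : Measure V2} {gs : V2 → Mat2} (h : IsSobolev11On B u gu) (hB : B ⊆ Ω)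
    (h' : HasBVDerivOn Ω u gu' σ gs) : ∀ᵐ x, x ∈ B → gu' x = gu x := by
  have key : ∀ i j, ∀ᵐ x, x ∈ B → gu' x i j = gu x i j := by
    intro i j
    obtain ⟨S, hS, hS1, hS2⟩ := h'.perp
    classical
    set f : V2 → ℝ := S.piecewise (fun x => gu' x i j - gu x i j) (fun x => gs x i j) with hf
    have : IsFiniteMeasure σ := ⟨h'.fin.lt_top⟩
    have fv : ∀ᵐ x : V2, gu' x i j - gu x i j = f x := by
      filter_upwards [measure_eq_zero_iff_ae_notMem.1 hS2] with x hx
      have hx' : x ∈ S := by simpa using hx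
      simp [hf, hx']
    have fs : ∀ᵐ x ∂σ, gs x i j = f x := by
      filter_upwards [measure_eq_zero_iff_ae_notMem.1 hS1] with x hx
      simp [hf, hx]
    have i1 : IntegrableOn f B volume :=
      (((h'.int_gu i j).mono_set hB).sub (h.int_gu i j)).congr (ae_restrict_of_ae fv)
    have i2 : Integrable f σ := (h'.gs_int i j).congr fs
    have li : LocallyIntegrableOn f B (volume + σ) := by
      apply IntegrableOn.locallyIntegrableOn
      exact i1.add_measure i2.restrict
    have hz := hBo.ae_eq_zero_of_integral_contDiff_smul_eq_zero li (fun φ hφ hc hs => by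
      obtain ⟨K, hK⟩ := hc.exists_bound_of_continuous hφ.continuous
      have hm : ∀ μ : Measure V2, ∀ g : V2 → ℝ, Integrable g μ → Integrable (fun x => φ x * g x) μ :=
        fun μ g hg => hg.bdd_mul (c := K) hφ.continuous.aestronglyMeasurable
          (Eventually.of_forall hK)
      have supp : ∀ g : V2 → ℝ, IntegrableOn g B → Integrable (fun x => φ x * g x) := by
        intro g hg
        have := hm _ g hg
        refine (integrableOn_iff_integrable_of_support_subset ?_).1 this
        intro x hx
        apply hs
        apply subset_tsupport
        intro h0
        exact hx (by simp [h0])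
      simp only [smul_eq_mul]
      rw [integral_add_measure (supp _ i1) (hm _ _ i2)]
      have e1 : ∫ x, φ x * f x = (∫ x, φ x * gu' x i j) - ∫ x, φ x * gu x i j := by
        rw [← integral_sub (supp _ ((h'.int_gu i j).mono_set hB)) (supp _ (h.int_gu i j))]
        apply integral_congr_ae
        filter_upwards [fv] with x hx
        rw [← hx]; ring
      have e2 : ∫ x, φ x * f x ∂σ = ∫ x, φ x * gs x i j ∂σ := by
        apply integral_congr_ae
        filter_upwards [fs] with x hx
        rw [← hx]
      have e3 := h'.ibp φ hφ hc (hs.trans hB) i j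
      have e4 := h.ibp φ hφ hc hs i j
      rw [setInt_pd (hs.trans hB), setInt_of_tsupport (hs.trans hB) (fun x hx => by simp [hx])] at e3
      rw [setInt_pd hs, setInt_of_tsupport hs (fun x hx => by simp [hx])] at e4
      rw [e1, e2]
      linarith)
    have hz' : ∀ᵐ x : V2, x ∈ B → f x = 0 := by
      rw [ae_add_measure_iff] at hz
      exact hz.1
    filter_upwards [hz', fv] with x h1 h2 hx
    have := h1 hx
    rw [← h2] at this
    linarith
  filter_upwards [key 0 0, key 0 1, key 1 0, key 1 1] with x a b c d hx
  ext i j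
  fin_cases i <;> fin_cases j
  exacts [a hx, b hx, c hx, d hx]


lemma vnorm_eq_norm (v : V2) : vnorm v = ‖vToE v‖ := by
  rw [EuclideanSpace.norm_eq, Fin.sum_univ_two]
  simp [vnorm, vToE, EuclideanSpace.equiv]

lemma vToE_sub (v w : V2) : vToE (v - w) = vToE v - vToE w := by
  simp [vToE]

lemma vnorm_tri (v w z : V2) : vnorm (v - w) ≤ vnorm (z - v) + vnorm (z - w) := by
  simp only [vnorm_eq_norm, vToE_sub]
  have := norm_sub_le (vToE z - vToE w) (vToE z - vToE v)
  have e : vToE z - vToE w - (vToE z - vToE v) = vToE v - vToE w := by abel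
  rw [e] at this
  linarith

lemma vnorm_pos {v w : V2} (h : v ≠ w) : 0 < vnorm (v - w) := by
  rw [vnorm_eq_norm, vToE_sub, norm_pos_iff, sub_ne_zero]
  intro h0
  exact h ((EuclideanSpace.equiv (Fin 2) ℝ).symm.injective h0)

def HalfLim (u : V2 → V2) (x ν L : V2) : Prop :=
  ∀ ε > 0, ∃ r0 > 0, ∀ᵐ z, z ∈ Metric.ball x r0 → 0 < dot (z - x) ν → vnorm (u z - L) ≤ ε

lemma half_uniq {u : V2 → V2} {x ν L a : V2} (hν : vnorm ν = 1)
    (ht : Tendsto (fun r : ℝ =>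
        (∫⁻ z in {z | z ∈ Metric.ball x r ∧ 0 < dot (z - x) ν},
            ENNReal.ofReal (vnorm (u z - a))) / volume (Metric.ball x r))
      (𝓝[>] 0) (𝓝 0)) (hL : HalfLim u x ν L) : a = L := by
  by_contra hne
  have hd := vnorm_pos hne
  set d := vnorm (a - L) with hdd
  obtain ⟨r0, hr0, hae⟩ := hL (d / 2) (by positivity)
  have hsub : ∀ r > 0, Metric.ball (x + (r / 2) • ν) (r / 4) ⊆
      {z | z ∈ Metric.ball x r ∧ 0 < dot (z - x) ν} := by
    intro r hr z hz
    have h0 : |ν 0| ≤ 1 := hν ▸ abs_le_vnorm ν 0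
    have h1 : |ν 1| ≤ 1 := hν ▸ abs_le_vnorm ν 1
    have hsq : ν 0 ^ 2 + ν 1 ^ 2 = 1 := by
      have := hν
      unfold vnorm at this
      rwa [Real.sqrt_eq_one] at this
    rw [Metric.mem_ball, dist_pi_lt_iff (by positivity)] at hz
    have z0 := hz 0
    have z1 := hz 1
    simp only [Real.dist_eq, Pi.add_apply, Pi.smul_apply, smul_eq_mul] at z0 z1
    rw [abs_lt] at z0 z1
    rw [abs_le] at h0 h1
    refine ⟨?_, ?_⟩
    · rw [Metric.mem_ball, dist_pi_lt_iff hr]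
      intro i
      rw [Real.dist_eq, abs_lt]
      fin_cases i <;> constructor <;> simp <;> nlinarith
    · simp only [dot, Fin.sum_univ_two, Pi.sub_apply]
      obtain ⟨p, hp⟩ : ∃ p, p = z 0 - x 0 - r / 2 * ν 0 := ⟨_, rfl⟩
      obtain ⟨q, hq⟩ : ∃ q, q = z 1 - x 1 - r / 2 * ν 1 := ⟨_, rfl⟩
      have hp2 : p ^ 2 ≤ (r / 4) ^ 2 := sq_le_sq' (by linarith) (by linarith)
      have hq2 : q ^ 2 ≤ (r / 4) ^ 2 := sq_le_sq' (by linarith) (by linarith)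
      have e : (z 0 - x 0) * ν 0 + (z 1 - x 1) * ν 1 = r / 2 + (p * ν 0 + q * ν 1) := by
        rw [hp, hq]; linear_combination (r / 2) * hsq
      rw [e]
      have : (p * ν 0 + q * ν 1) ^ 2 < (r / 2) ^ 2 := by
        have : (p * ν 0 + q * ν 1) ^ 2 ≤ (p ^ 2 + q ^ 2) * (ν 0 ^ 2 + ν 1 ^ 2) := by
          nlinarith [sq_nonneg (p * ν 1 - q * ν 0)]
        rw [hsq] at this
        nlinarith
      have := abs_lt_of_sq_lt_sq this (by positivity)
      rw [abs_lt] at this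
      linarith
  have hev : ∀ᶠ r in 𝓝[>] (0:ℝ), ENNReal.ofReal (d / 2) / 16 ≤ (∫⁻ z in {z | z ∈ Metric.ball x r ∧ 0 < dot (z - x) ν},
            ENNReal.ofReal (vnorm (u z - a))) / volume (Metric.ball x r) := by
    filter_upwards [Ioo_mem_nhdsGT hr0] with r hr
    have hr1 := hr.1
    have hv : volume (Metric.ball x r) = 16 * volume (Metric.ball (x + (r / 2) • ν) (r / 4)) := by
      rw [Real.volume_pi_ball _ hr1, Real.volume_pi_ball _ (by positivity)]
      rw [show (16 : ℝ≥0∞) = ENNReal.ofReal 16 by simp, ← ENNReal.ofReal_mul (by norm_num)]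
      congr 1
      simp
      ring
    rw [ENNReal.le_div_iff_mul_le (Or.inl ?_) (Or.inl ?_), hv]
    · calc ENNReal.ofReal (d / 2) / 16 * (16 * volume (Metric.ball (x + (r / 2) • ν) (r / 4)))
          = ENNReal.ofReal (d / 2) * volume (Metric.ball (x + (r / 2) • ν) (r / 4)) := by
            rw [← mul_assoc, ENNReal.div_mul_cancel (by simp) (by simp)]
        _ = ∫⁻ z in Metric.ball (x + (r / 2) • ν) (r / 4), ENNReal.ofReal (d / 2) := by
            rw [lintegral_const, Measure.restrict_apply_univ]
        _ ≤ ∫⁻ z in Metric.ball (x + (r / 2) • ν) (r / 4), ENNReal.ofReal (vnorm (u z - a)) := by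
            apply setLIntegral_mono_ae' measurableSet_ball
            filter_upwards [hae] with z hz hzb
            have hz2 := hsub r hr1 hzb
            have := hz (Metric.ball_subset_ball hr.2.le hz2.1) hz2.2
            have := vnorm_tri a L (u z)
            apply ENNReal.ofReal_le_ofReal
            linarith
        _ ≤ _ := lintegral_mono_set (hsub r hr1)
    · exact (Metric.measure_ball_pos _ _ hr1).ne'
    · exact measure_ball_lt_top.ne
  have := ge_of_tendsto ht hev
  have h0 : 0 < ENNReal.ofReal (d / 2) / 16 := by
    apply ENNReal.div_pos
    · simpa using hd
    · exact ENNReal.ofNat_ne_top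
  exact absurd this (not_le.2 h0)

lemma dot_neg' (v ν : V2) : dot v (-ν) = - dot v ν := by
  simp [dot]

lemma not_jump {u : V2 → V2} {x L : V2}
    (hL : ∀ ε > 0, ∃ r0 > 0, ∀ᵐ z, z ∈ Metric.ball x r0 → vnorm (u z - L) ≤ ε) :
    ¬ JumpPt u x := by
  rintro ⟨a, b, ν, hab, hν, h1, h2⟩
  have H : ∀ ν, HalfLim u x ν L := by
    intro ν ε hε
    obtain ⟨r0, hr0, h⟩ := hL ε hε
    exact ⟨r0, hr0, h.mono fun z hz a _ => hz a⟩
  have ha := half_uniq hν h1 (H ν)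
  have hν' : vnorm (-ν) = 1 := by rw [← hν]; simp [vnorm]
  have hb := half_uniq (a := b) hν' (by simpa only [dot_neg', Left.neg_pos_iff] using h2) (H (-ν))
  exact hab (ha.trans hb.symm)

lemma half_tendsto {u : V2 → V2} {x ν L : V2} (hL : HalfLim u x ν L) :
    Tendsto (fun r : ℝ =>
        (∫⁻ z in {z | z ∈ Metric.ball x r ∧ 0 < dot (z - x) ν},
            ENNReal.ofReal (vnorm (u z - L))) / volume (Metric.ball x r))
      (𝓝[>] 0) (𝓝 0) := by
  rw [ENNReal.tendsto_nhds_zero]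
  intro ε hε
  obtain ⟨δ, hδ, hδε⟩ := ENNReal.lt_iff_exists_nnreal_btwn.1 hε
  have hδ0 : (0:ℝ) < δ := by exact_mod_cast hδ
  obtain ⟨r0, hr0, h⟩ := hL δ hδ0
  filter_upwards [Ioo_mem_nhdsGT hr0] with r hr
  apply ENNReal.div_le_of_le_mul
  have hm : MeasurableSet {z : V2 | z ∈ Metric.ball x r ∧ 0 < dot (z - x) ν} := by
    apply MeasurableSet.inter measurableSet_ball
    have : Continuous fun z : V2 => dot (z - x) ν := by
      unfold dot; fun_prop
    exact (isOpen_lt continuous_const this).measurableSet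
  calc _ ≤ ∫⁻ z in {z : V2 | z ∈ Metric.ball x r ∧ 0 < dot (z - x) ν}, (δ : ℝ≥0∞) := by
        apply setLIntegral_mono_ae' hm
        filter_upwards [h] with z hz hzm
        have := hz (Metric.ball_subset_ball hr.2.le hzm.1) hzm.2
        rw [← ENNReal.ofReal_coe_nnreal]
        exact ENNReal.ofReal_le_ofReal this
    _ = δ * volume {z : V2 | z ∈ Metric.ball x r ∧ 0 < dot (z - x) ν} := by
        rw [lintegral_const, Measure.restrict_apply_univ]
    _ ≤ ε * volume (Metric.ball x r) := by
        gcongr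
        exact fun z hz => hz.1

lemma is_jump {u : V2 → V2} {x L M : V2} (h1 : HalfLim u x e2 L) (h2 : HalfLim u x (-e2) M)
    (hne : L ≠ M) : JumpPt u x := by
  refine ⟨L, M, e2, hne, by simp [vnorm, e2], half_tendsto h1, ?_⟩
  simpa only [dot_neg', Left.neg_pos_iff] using half_tendsto h2


def Jv (v : V2) : V2 := ![-(v 1), v 0]

lemma Jv_cont : Continuous Jv := by unfold Jv; fun_prop

lemma vnorm_cont : Continuous vnorm := by unfold vnorm; fun_prop

lemma ess_lim {Ω : Set V2} (hΩ : IsOpen Ω) {u : V2 → V2} {E ψ : ℝ → V2}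
    (hu : ∀ᵐ x ∂(volume.restrict Ω), u x = ψ (x 1) + x 0 • E (x 1) + x 1 • Jv (E (x 1)))
    {x : V2} (hx : x ∈ Ω) {S : Set ℝ} {L M : V2}
    (hE : Tendsto E (𝓝[S] (x 1)) (𝓝 L)) (hψ : Tendsto ψ (𝓝[S] (x 1)) (𝓝 M)) {ε : ℝ} (hε : 0 < ε) :
    ∃ r0 > 0, ∀ᵐ z, z ∈ Metric.ball x r0 → z 1 ∈ S →
      vnorm (u z - (M + x 0 • L + x 1 • Jv L)) ≤ ε := by
  have h1 : Tendsto (fun z : V2 => z 1) (𝓝[{z : V2 | z 1 ∈ S}] x) (𝓝[S] (x 1)) := by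
    apply tendsto_nhdsWithin_of_tendsto_nhds_of_eventually_within
    · exact ((continuous_apply 1).tendsto x).mono_left nhdsWithin_le_nhds
    · exact self_mem_nhdsWithin
  have h0 : Tendsto (fun z : V2 => z 0) (𝓝[{z : V2 | z 1 ∈ S}] x) (𝓝 (x 0)) :=
    ((continuous_apply 0).tendsto x).mono_left nhdsWithin_le_nhds
  have h1' : Tendsto (fun z : V2 => z 1) (𝓝[{z : V2 | z 1 ∈ S}] x) (𝓝 (x 1)) :=
    ((continuous_apply 1).tendsto x).mono_left nhdsWithin_le_nhds
  have tE := hE.comp h1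
  have tψ := hψ.comp h1
  have tJ := (Jv_cont.tendsto L).comp tE
  have tt := ((tψ.add (h0.smul tE)).add (h1'.smul tJ)).sub_const (M + x 0 • L + x 1 • Jv L)
  have t2 := (vnorm_cont.tendsto _).comp tt
  have hz : vnorm (M + x 0 • L + x 1 • Jv L - (M + x 0 • L + x 1 • Jv L)) = 0 := by
    simp [vnorm]
  rw [hz] at t2
  have ev1 := t2.eventually (Iio_mem_nhds hε)
  obtain ⟨r, hr, hrs⟩ := Metric.mem_nhdsWithin_iff.1 ev1
  obtain ⟨s, hs, hss⟩ := Metric.isOpen_iff.1 hΩ x hx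
  refine ⟨min r s, lt_min hr hs, ?_⟩
  rw [ae_restrict_iff' hΩ.measurableSet] at hu
  filter_upwards [hu] with z hz hzb hzS
  rw [hz (hss (Metric.ball_subset_ball (min_le_right _ _) hzb))]
  have := hrs ⟨Metric.ball_subset_ball (min_le_left _ _) hzb, hzS⟩
  simp only [mem_ofPred_eq, Function.comp_apply] at this
  exact this.le

def Rem (E ψ : ℝ → V2) (t : ℝ) : Prop :=
  ∃ L M, Tendsto E (𝓝[≠] t) (𝓝 L) ∧ Tendsto ψ (𝓝[≠] t) (𝓝 M)

lemma rem_not_jump {Ω : Set V2} (hΩ : IsOpen Ω) {u : V2 → V2} {E ψ : ℝ → V2}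
    (hu : ∀ᵐ x ∂(volume.restrict Ω), u x = ψ (x 1) + x 0 • E (x 1) + x 1 • Jv (E (x 1)))
    {x : V2} (hx : x ∈ Ω) (h : Rem E ψ (x 1)) : ¬ JumpPt u x := by
  obtain ⟨L, M, hE, hψ⟩ := h
  apply not_jump (L := M + x 0 • L + x 1 • Jv L)
  intro ε hε
  obtain ⟨r0, hr0, h⟩ := ess_lim hΩ hu hx hE hψ hε
  refine ⟨r0, hr0, ?_⟩
  filter_upwards [h, ae_snd_notMem (N := {x 1}) (by simp)] with z hz h1 hzb
  exact hz hzb h1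

lemma bv_onesided {a b : ℝ} {f : ℝ → V2} (hf : BoundedVariationOn f (Ioo a b)) {t : ℝ}
    (ht : t ∈ Ioo a b) : ∃ l r, Tendsto f (𝓝[<] t) (𝓝 l) ∧ Tendsto f (𝓝[>] t) (𝓝 r) := by
  obtain ⟨l, hl⟩ := hf.exists_tendsto_left t
  obtain ⟨r, hr⟩ := hf.exists_tendsto_right t
  refine ⟨l, r, ?_, ?_⟩
  · rwa [inter_comm, nhdsWithin_inter_of_mem' (mem_nhdsWithin_of_mem_nhds (Ioo_mem_nhds ht.1 ht.2))] at hl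
  · rwa [inter_comm, nhdsWithin_inter_of_mem' (mem_nhdsWithin_of_mem_nhds (Ioo_mem_nhds ht.1 ht.2))] at hr

lemma nonrem_jump {Ω : Set V2} (hΩ : IsOpen Ω) {u : V2 → V2} {E ψ : ℝ → V2} {a b : ℝ}
    (hE : BoundedVariationOn E (Ioo a b)) (hψ : BoundedVariationOn ψ (Ioo a b))
    (hu : ∀ᵐ x ∂(volume.restrict Ω), u x = ψ (x 1) + x 0 • E (x 1) + x 1 • Jv (E (x 1)))
    {t : ℝ} (ht : t ∈ Ioo a b) (h : ¬ Rem E ψ t) :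
    ∃ y : ℝ, ∀ x ∈ Ω, x 1 = t → x 0 ≠ y → JumpPt u x := by
  obtain ⟨El, Er, hEl, hEr⟩ := bv_onesided hE ht
  obtain ⟨pl, pr, hpl, hpr⟩ := bv_onesided hψ ht
  have key : ∀ x ∈ Ω, x 1 = t → ¬ JumpPt u x →
      pr + x 0 • Er + x 1 • Jv Er = pl + x 0 • El + x 1 • Jv El := by
    intro x hx hxt hj
    subst hxt
    by_contra hne
    refine hj (is_jump (L := pr + x 0 • Er + x 1 • Jv Er) (M := pl + x 0 • El + x 1 • Jv El) ?_ ?_ hne)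
    · intro ε hε
      obtain ⟨r0, hr0, h⟩ := ess_lim hΩ hu hx hEr hpr hε
      refine ⟨r0, hr0, h.mono fun z hz h1 h2 => hz h1 ?_⟩
      simpa [dot, e2, Fin.sum_univ_two] using h2
    · intro ε hε
      obtain ⟨r0, hr0, h⟩ := ess_lim hΩ hu hx hEl hpl hε
      refine ⟨r0, hr0, h.mono fun z hz h1 h2 => hz h1 ?_⟩
      simpa [dot, e2, Fin.sum_univ_two] using h2
  by_contra hcon
  push Not at hcon
  obtain ⟨x, hx, hxt, -, hxj⟩ := hcon 0
  obtain ⟨y, hy, hyt, hxy, hyj⟩ := hcon (x 0)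
  have k1 := key x hx hxt hxj
  have k2 := key y hy hyt hyj
  rw [hxt] at k1
  rw [hyt] at k2
  have hE' : Er = El := by
    have : (x 0 - y 0) • (Er - El) = 0 := by
      have := congrArg₂ (· - ·) k1 k2
      rw [← sub_eq_zero] at this
      rw [← this]
      module
    rcases smul_eq_zero.1 this with h | h
    · exact absurd (by linarith) hxy
    · exact sub_eq_zero.1 h
  have hp' : pr = pl := by
    rw [hE'] at k1
    simpa using k1
  apply h
  refine ⟨El, pl, ?_, ?_⟩
  · rw [← Iio_union_Ioi, nhdsWithin_union]
    exact hEl.sup (hE' ▸ hEr)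
  · rw [← Iio_union_Ioi, nhdsWithin_union]
    exact hpl.sup (hp' ▸ hpr)

lemma fin_heights {Ω : Set V2} (hΩ : IsOpen Ω) {u : V2 → V2} {E ψ : ℝ → V2} {a b : ℝ}
    (hE : BoundedVariationOn E (Ioo a b)) (hψ : BoundedVariationOn ψ (Ioo a b))
    (hab : ∀ x ∈ Ω, x 1 ∈ Ioo a b)
    (hu : ∀ᵐ x ∂(volume.restrict Ω), u x = ψ (x 1) + x 0 • E (x 1) + x 1 • Jv (E (x 1)))
    (hJ : Measure.hausdorffMeasure (1 : ℝ) (jumpSet Ω u) ≠ ⊤)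
    {l r p q : ℝ} (hlr : l < r) (hB : box l r p q ⊆ Ω) :
    {t ∈ Ioo p q | ¬ Rem E ψ t}.Finite := by
  set μ : Measure V2 := (Measure.hausdorffMeasure (1 : ℝ)).restrict (jumpSet Ω u) with hμ
  have hm : ∀ t : ℝ, MeasurableSet {z : V2 | z 1 = t} := fun t =>
    (isClosed_eq (continuous_apply 1) continuous_const).measurableSet
  have hfin := Measure.finite_const_le_meas_of_disjoint_iUnion μ (ε := ENNReal.ofReal (r - l))
    (by simpa using hlr) (As := fun t : ℝ => {z : V2 | z 1 = t}) hm
    (by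
      intro s t hst
      refine Set.disjoint_left.2 fun z h1 h2 => hst ?_
      exact h1.symm.trans h2)
    (by
      refine ne_top_of_le_ne_top hJ ?_
      refine (measure_mono (subset_univ _)).trans ?_
      rw [hμ, Measure.restrict_apply_univ])
  refine hfin.subset ?_
  rintro t ⟨ht, hR⟩
  have hmem : (![(l + r) / 2, t] : V2) ∈ Ω :=
    hB ⟨⟨by simp; linarith, by simp; linarith⟩, by simpa using ht⟩
  have htab : t ∈ Ioo a b := by simpa using hab _ hmem
  obtain ⟨y, hy⟩ := nonrem_jump hΩ hE hψ hu htab hR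
  simp only [mem_ofPred_eq]
  rw [hμ, Measure.restrict_apply (hm t)]
  have hl : LipschitzWith 1 (fun z : V2 => z 0) := LipschitzWith.eval (α := fun _ : Fin 2 => ℝ) 0
  have h1 := hl.hausdorffMeasure_image_le (d := 1) zero_le_one ({z : V2 | z 1 = t} ∩ jumpSet Ω u)
  simp only [ENNReal.coe_one, ENNReal.one_rpow, one_mul, hausdorffMeasure_real] at h1
  refine le_trans ?_ h1
  calc ENNReal.ofReal (r - l) = volume (Ioo l r \ {y}) := by
        rw [measure_sdiff_null (by simp), Real.volume_Ioo]
    _ ≤ _ := by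
        apply measure_mono
        rintro s ⟨hs, hsy⟩
        have hsΩ : (![s, t] : V2) ∈ Ω := hB ⟨by simpa using hs, by simpa using ht⟩
        refine ⟨![s, t], ⟨by simp, hsΩ, hy _ hsΩ (by simp) (by simpa using hsy)⟩, by simp⟩


lemma bv_comp {f : ℝ → V2} {S : Set ℝ} (hf : BoundedVariationOn f S) (i : Fin 2) :
    BoundedVariationOn (fun t => f t i) S := by
  have : LipschitzWith 1 (fun z : V2 => z i) := LipschitzWith.eval (α := fun _ : Fin 2 => ℝ) i
  exact this.comp_boundedVariationOn hf

lemma bv_meas {f : ℝ → ℝ} {a b : ℝ} (hf : BoundedVariationOn f (Ioo a b)) :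
    ∃ g : ℝ → ℝ, Measurable g ∧ (∃ M, ∀ t, |g t| ≤ M) ∧ ∀ t ∈ Ioo a b, g t = f t := by
  obtain ⟨p, q, hp, hq, hpq⟩ := bv_split hf
  refine ⟨(Ioo a b).indicator (fun t => p t - q t),
    (hp.measurable.sub hq.measurable).indicator measurableSet_Ioo, ?_, ?_⟩
  · rcases (Ioo a b).eq_empty_or_nonempty with h | ⟨s, hs⟩
    · exact ⟨0, fun t => by simp [h]⟩
    · refine ⟨|f s| + (eVariationOn f (Ioo a b)).toReal, fun t => ?_⟩
      by_cases ht : t ∈ Ioo a b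
      · rw [indicator_of_mem ht, ← hpq t ht]
        have h1 := hf.dist_le ht hs
        rw [Real.dist_eq] at h1
        have := abs_sub_abs_le_abs_sub (f t) (f s)
        linarith
      · rw [indicator_of_notMem ht, abs_zero]
        positivity
  · intro t ht
    rw [indicator_of_mem ht, hpq t ht]

lemma ae_const_cont {X : Type*} [TopologicalSpace X] [T1Space X] {f : ℝ → X} {p q : ℝ} {k : X}
    (h : ∀ᵐ t, t ∈ Ioo p q → f t = k) {s : ℝ} (hs : s ∈ Ioo p q) (hc : ContinuousAt f s) :
    f s = k := by
  by_contra hne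
  have h1 : ∀ᶠ t in 𝓝 s, f t ≠ k := hc.eventually_ne hne
  have h2 : ∀ᶠ t in 𝓝 s, t ∈ Ioo p q := Ioo_mem_nhds hs.1 hs.2
  have hd : Dense {t | t ∈ Ioo p q → f t = k} := Measure.dense_of_ae h
  obtain ⟨t, ht1, ht2⟩ := mem_closure_iff_nhds.1 (hd s) _ (h1.and h2)
  exact ht1.1 (ht2 ht1.2)

lemma box_tang {Ω : Set V2} (hΩ : IsOpen Ω) {u : V2 → V2} {θ : ℝ → ℝ} {ψ : ℝ → V2} {a b : ℝ}
    (hE : BoundedVariationOn (fun t => ev (θ t)) (Ioo a b)) (hψ : BoundedVariationOn ψ (Ioo a b))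
    (hab : ∀ x ∈ Ω, x 1 ∈ Ioo a b)
    (hu : ∀ᵐ x ∂(volume.restrict Ω),
      u x = ψ (x 1) + x 0 • ev (θ (x 1)) + x 1 • Jv (ev (θ (x 1))))
    {gu gu' gs gs' : V2 → Mat2} {σ σ' : Measure V2} (h1 : HasBVDerivOn Ω u gu σ gs)
    (h2 : HasBVDerivOn Ω u gu' σ' gs') (hσ : σ {x | ¬ JumpPt u x} = 0)
    (hdet : ∀ᵐ x ∂(volume.restrict Ω), (gu' x).det = 1)
    {l r p q : ℝ} (hlr : l < r) (hB : box l r p q ⊆ Ω)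
    (hR : ∀ t ∈ Ioo p q, Rem (fun t => ev (θ t)) ψ t)
    {s t : ℝ} (hs : s ∈ Ioo p q) (ht : t ∈ Ioo p q)
    (cs : ContinuousAt (fun t => ev (θ t)) s ∧ ContinuousAt ψ s)
    (ct : ContinuousAt (fun t => ev (θ t)) t ∧ ContinuousAt ψ t) : Tang θ ψ s t := by
  have hpq : p < q := hs.1.trans hs.2
  have hσB : σ (box l r p q) = 0 :=
    measure_mono_null (fun x hx => rem_not_jump hΩ hu (hB hx) (hR _ hx.2)) hσ
  have sob := sob_of_null h1 hB hσB
  have du := dec_unique (box_open _ _ _ _) sob hB h2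
  have hIoo : ∀ τ ∈ Ioo p q, τ ∈ Ioo a b := by
    intro τ hτ
    have hmem : (![(l + r) / 2, τ] : V2) ∈ Ω :=
      hB ⟨⟨by simp; linarith, by simp; linarith⟩, by simpa using hτ⟩
    simpa using hab _ hmem
  obtain ⟨c, mc, ⟨M1, bc⟩, ec⟩ := bv_meas (bv_comp hE 0)
  obtain ⟨sn, ms, ⟨M2, bs⟩, es⟩ := bv_meas (bv_comp hE 1)
  obtain ⟨f0, m0, ⟨M3, b0⟩, e0⟩ := bv_meas (bv_comp hψ 0)
  obtain ⟨f1, m1, ⟨M4, b1⟩, e1⟩ := bv_meas (bv_comp hψ 1)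
  rw [ae_restrict_iff' hΩ.measurableSet] at hu hdet
  have nn : ∀ (M : ℝ) (f : ℝ → ℝ), (∀ t, |f t| ≤ M) → 0 ≤ M := fun M f h =>
    (abs_nonneg _).trans (h 0)
  have n1 := nn _ _ bc
  have n2 := nn _ _ bs
  have n3 := nn _ _ b0
  have n4 := nn _ _ b1
  obtain ⟨c0, s0, d, H⟩ := rigid_box hlr hpq sob mc ms m0 m1 (M := M1 + M2 + M3 + M4)
    (fun t => (bc t).trans (by linarith)) (fun t => (bs t).trans (by linarith))
    (fun t => (b0 t).trans (by linarith)) (fun t => (b1 t).trans (by linarith))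
    (by
      filter_upwards [hu] with x hx hxB
      have := hIoo _ hxB.2
      rw [hx (hB hxB), ec _ this, es _ this, e0 _ this]
      simp [Jv]; ring)
    (by
      filter_upwards [hu] with x hx hxB
      have := hIoo _ hxB.2
      rw [hx (hB hxB), ec _ this, es _ this, e1 _ this]
      simp [Jv]; ring)
    (Eventually.of_forall fun τ hτ => by
      have := hIoo _ hτ
      rw [ec _ this, es _ this]
      simp [ev])
    (by
      filter_upwards [hdet, du] with x hx hx2 hxB
      rw [← hx2 hxB, hx (hB hxB)])
  set F : ℝ → ℝ × ℝ × ℝ := fun τ =>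
    (ev (θ τ) 0, ev (θ τ) 1, ev (θ τ) 0 * ψ τ 1 - ev (θ τ) 1 * ψ τ 0) with hF
  have HF : ∀ᵐ τ, τ ∈ Ioo p q → F τ = (c0, s0, d) := by
    filter_upwards [H] with τ h hτ
    obtain ⟨ha, hb, hc⟩ := h hτ
    have := hIoo _ hτ
    rw [ec _ this] at ha
    rw [es _ this] at hb
    rw [e1 _ this, e0 _ this] at hc
    simp only [hF, ha, hb, hc]
  have FC : ∀ τ, ContinuousAt (fun t => ev (θ t)) τ ∧ ContinuousAt ψ τ → ContinuousAt F τ := by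
    intro τ h
    have a0 : ContinuousAt (fun t => ev (θ t) 0) τ := (continuous_apply 0).continuousAt.comp h.1
    have a1 : ContinuousAt (fun t => ev (θ t) 1) τ := (continuous_apply 1).continuousAt.comp h.1
    have a2 : ContinuousAt (fun t => ψ t 0) τ := (continuous_apply 0).continuousAt.comp h.2
    have a3 : ContinuousAt (fun t => ψ t 1) τ := (continuous_apply 1).continuousAt.comp h.2
    exact a0.prodMk (a1.prodMk ((a0.mul a3).sub (a1.mul a2)))
  have Fs := ae_const_cont HF hs (FC s cs)
  have Ft := ae_const_cont HF ht (FC t ct)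
  simp only [hF, Prod.mk.injEq] at Fs Ft
  obtain ⟨s1, s2, s3⟩ := Fs
  obtain ⟨t1, t2, t3⟩ := Ft
  have hsq : c0 ^ 2 + s0 ^ 2 = 1 := by
    rw [← s1, ← s2]; simp [ev]
  rw [s1, s2] at s3
  rw [t1, t2] at t3
  refine ⟨?_, (ψ t 0 - ψ s 0) * c0 + (ψ t 1 - ψ s 1) * s0, ?_⟩
  · ext i
    fin_cases i
    · exact s1.trans t1.symm
    · exact s2.trans t2.symm
  · ext i
    fin_cases i
    · simp only [Fin.zero_eta, Pi.add_apply, Pi.smul_apply, smul_eq_mul, s1]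
      linear_combination (ψ s 0 - ψ t 0) * hsq - s0 * t3 + s0 * s3
    · simp only [Fin.mk_one, Pi.add_apply, Pi.smul_apply, smul_eq_mul, s2]
      linear_combination (ψ s 1 - ψ t 1) * hsq + c0 * t3 - c0 * s3

lemma local_tang {Ω : Set V2} (hΩ : IsOpen Ω) {u : V2 → V2} {θ : ℝ → ℝ} {ψ : ℝ → V2} {a b : ℝ}
    (hE : BoundedVariationOn (fun t => ev (θ t)) (Ioo a b)) (hψ : BoundedVariationOn ψ (Ioo a b))
    (hab : ∀ x ∈ Ω, x 1 ∈ Ioo a b)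
    (hu : ∀ᵐ x ∂(volume.restrict Ω),
      u x = ψ (x 1) + x 0 • ev (θ (x 1)) + x 1 • Jv (ev (θ (x 1))))
    {gu gu' gs gs' : V2 → Mat2} {σ σ' : Measure V2} (h1 : HasBVDerivOn Ω u gu σ gs)
    (h2 : HasBVDerivOn Ω u gu' σ' gs') (hσ : σ {x | ¬ JumpPt u x} = 0)
    (hdet : ∀ᵐ x ∂(volume.restrict Ω), (gu' x).det = 1)
    (hJ : Measure.hausdorffMeasure (1 : ℝ) (jumpSet Ω u) ≠ ⊤) {x : V2} (hx : x ∈ Ω) :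
    ∃ δ > 0, ∀ s t, (s ∈ Ioo a b → ContinuousAt (fun t => ev (θ t)) s ∧ ContinuousAt ψ s) →
      (t ∈ Ioo a b → ContinuousAt (fun t => ev (θ t)) t ∧ ContinuousAt ψ t) →
      s ∈ Ioo (x 1 - δ) (x 1 + δ) → t ∈ Ioo (x 1 - δ) (x 1 + δ) → s < t → x 1 ∉ Icc s t →
      Tang θ ψ s t := by
  obtain ⟨r, hr, hball⟩ := Metric.isOpen_iff.1 hΩ x hx
  have hB : box (x 0 - r) (x 0 + r) (x 1 - r) (x 1 + r) ⊆ Ω := by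
    intro z hz
    apply hball
    rw [Metric.mem_ball, dist_pi_lt_iff hr]
    intro i
    obtain ⟨⟨a1, a2⟩, b1, b2⟩ := hz
    rw [Real.dist_eq, abs_lt]
    fin_cases i <;> constructor <;> simp <;> linarith
  have hfin := fin_heights hΩ hE hψ hab hu hJ (by linarith) hB
  have hfin2 := (hfin.subset (sdiff_subset (s := _) (t := {x 1}))).isClosed.isOpen_compl
  obtain ⟨δ', hδ', hδs⟩ := Metric.isOpen_iff.1 hfin2 (x 1) (by simp)
  have hIoo : ∀ τ ∈ Ioo (x 1 - r) (x 1 + r), τ ∈ Ioo a b := by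
    intro τ hτ
    have hmem : (![x 0, τ] : V2) ∈ Ω :=
      hB ⟨⟨by simp; linarith, by simp; linarith⟩, by simpa using hτ⟩
    simpa using hab _ hmem
  have hδδ : min r δ' ≤ r := min_le_left _ _
  refine ⟨min r δ', lt_min hr hδ', ?_⟩
  have hRem : ∀ τ ∈ Ioo (x 1 - min r δ') (x 1 + min r δ'), τ ≠ x 1 →
      Rem (fun t => ev (θ t)) ψ τ := by
    intro τ hτ hne
    by_contra hR
    have hm : τ ∈ Metric.ball (x 1) δ' := by
      rw [Metric.mem_ball, Real.dist_eq, abs_lt]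
      have := min_le_right r δ'
      exact ⟨by linarith [hτ.1], by linarith [hτ.2]⟩
    exact hδs hm ⟨⟨⟨by linarith [hτ.1], by linarith [hτ.2]⟩, hR⟩, hne⟩
  intro s t hs ht hsI htI hst hnot
  have cs := hs (hIoo s ⟨by linarith [hsI.1], by linarith [hsI.2]⟩)
  have ct := ht (hIoo t ⟨by linarith [htI.1], by linarith [htI.2]⟩)
  have hcase : t < x 1 ∨ x 1 < s := by
    by_contra hc
    push Not at hc
    exact hnot ⟨hc.2, hc.1⟩
  rcases hcase with hc | hc
  · refine box_tang hΩ hE hψ hab hu h1 h2 hσ hdet (l := x 0 - r) (r := x 0 + r)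
      (p := x 1 - min r δ') (q := x 1) (by linarith) ?_ ?_ ⟨hsI.1, hst.trans hc⟩ ⟨htI.1, hc⟩ cs ct
    · intro z hz
      exact hB ⟨hz.1, by linarith [hz.2.1], by linarith [hz.2.2]⟩
    · intro τ hτ
      have := lt_min hr hδ'
      exact hRem τ ⟨hτ.1, by linarith [hτ.2]⟩ hτ.2.ne
  · refine box_tang hΩ hE hψ hab hu h1 h2 hσ hdet (l := x 0 - r) (r := x 0 + r)
      (p := x 1) (q := x 1 + min r δ') (by linarith) ?_ ?_ ⟨hc, hsI.2⟩ ⟨hc.trans hst, htI.2⟩ cs ct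
    · intro z hz
      exact hB ⟨hz.1, by linarith [hz.2.1], by linarith [hz.2.2]⟩
    · intro τ hτ
      have := lt_min hr hδ'
      exact hRem τ ⟨by linarith [hτ.1], hτ.2⟩ hτ.1.ne'


lemma Jv_ev (θ : ℝ) : Jv (ev θ) = nv θ := by
  simp [Jv, ev, nv]

lemma so2_angle {R : Mat2} (hR : R ∈ SO2) : ∃ θ : ℝ, R 0 0 = Real.cos θ ∧ R 1 0 = Real.sin θ ∧
    R 0 1 = -Real.sin θ ∧ R 1 1 = Real.cos θ := by
  obtain ⟨h1, h2⟩ := hR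
  have h00 := congrFun (congrFun h1 0) 0
  have h11 := congrFun (congrFun h1 1) 1
  simp only [Matrix.mul_apply, Fin.sum_univ_two, Matrix.transpose_apply, Matrix.one_apply_eq] at h00 h11
  rw [Matrix.det_fin_two] at h2
  have e : (R 1 1 - R 0 0) ^ 2 + (R 0 1 + R 1 0) ^ 2 = 0 := by nlinarith
  have e1 : R 1 1 = R 0 0 := by nlinarith [sq_nonneg (R 1 1 - R 0 0), sq_nonneg (R 0 1 + R 1 0)]
  have e2 : R 0 1 = - R 1 0 := by
    have : (R 0 1 + R 1 0) ^ 2 = 0 := by nlinarith [sq_nonneg (R 1 1 - R 0 0)]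
    have := pow_eq_zero_iff (two_ne_zero) |>.1 this
    linarith
  have hn : R 0 0 ^ 2 + R 1 0 ^ 2 = 1 := by rw [e2] at h00; nlinarith
  set z : ℂ := ⟨R 0 0, R 1 0⟩ with hz
  have hz1 : ‖z‖ = 1 := by
    rw [Complex.norm_def, Complex.normSq_apply, Real.sqrt_eq_one]
    simp only [hz]; nlinarith
  have hz0 : z ≠ 0 := by
    intro h; rw [h] at hz1; simp at hz1
  have c := Complex.cos_arg hz0
  have s := Complex.sin_arg z
  rw [hz1, div_one] at c s
  refine ⟨z.arg, c.symm, s.symm, ?_, ?_⟩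
  · rw [s, e2]
  · rw [c, e1]

lemma mulVec_rig {R : Mat2} {θ : ℝ} (h : R 0 0 = Real.cos θ ∧ R 1 0 = Real.sin θ ∧
    R 0 1 = -Real.sin θ ∧ R 1 1 = Real.cos θ) (x p : V2) : R.mulVec x + p = rig θ p x := by
  obtain ⟨h1, h2, h3, h4⟩ := h
  ext i
  fin_cases i
  · simp [rig, ev, nv, h1, h3, Matrix.vecHead]; ring
  · simp [rig, ev, nv, h2, h4, Matrix.vecHead, Matrix.vecTail]; ring

lemma bvm_ev {R : ℝ → Mat2} {θ : ℝ → ℝ} {a b : ℝ} (h : BVm R (Ioo a b))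
    (hθ : ∀ t ∈ Ioo a b, R t 0 0 = Real.cos (θ t) ∧ R t 1 0 = Real.sin (θ t)) :
    BoundedVariationOn (fun t => ev (θ t)) (Ioo a b) := by
  let L : EuclideanSpace ℝ (Fin 2 × Fin 2) →L[ℝ] V2 :=
    ContinuousLinearMap.pi fun i => EuclideanSpace.proj (i, 0)
  have h1 := L.lipschitz.comp_boundedVariationOn h
  unfold BoundedVariationOn at h1 ⊢
  rw [eVariationOn.eq_of_eqOn (f' := L ∘ fun t => mToE (R t))]
  · exact h1
  · intro t ht
    ext i
    obtain ⟨a1, a2⟩ := hθ t ht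
    fin_cases i
    · simp [L, mToE, ev, a1, EuclideanSpace.equiv]
    · simp [L, mToE, ev, a2, EuclideanSpace.equiv]

lemma bvv_v {ψ : ℝ → V2} {a b : ℝ} (h : BVv ψ (Ioo a b)) : BoundedVariationOn ψ (Ioo a b) := by
  have h1 := (EuclideanSpace.equiv (Fin 2) ℝ).lipschitz.comp_boundedVariationOn h
  have e : (EuclideanSpace.equiv (Fin 2) ℝ) ∘ (fun t => vToE (ψ t)) = ψ := by
    ext t; simp [vToE]
  rwa [e] at h1

lemma hab_om {Ω : Set V2} (hΩ : IsOpen Ω) (hb : Bornology.IsBounded Ω) :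
    ∀ x ∈ Ω, x 1 ∈ Ioo (aOm Ω) (bOm Ω) := by
  intro x hx
  obtain ⟨r, hr, hs⟩ := Metric.isOpen_iff.1 hΩ x hx
  obtain ⟨M, hM⟩ := hb.exists_norm_le
  have hM' : ∀ y ∈ Ω, |y 1| ≤ M := fun y hy => (norm_le_pi_norm y 1).trans (hM y hy)
  have hmem : ∀ τ : ℝ, |τ| < r → (x + ![0, τ]) ∈ Ω := by
    intro τ hτ
    apply hs
    rw [Metric.mem_ball, dist_pi_lt_iff hr]
    intro i
    fin_cases i
    · simpa using hr
    · simpa [Real.dist_eq] using hτ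
  have h1 := hmem (-(r / 2)) (by rw [abs_neg, abs_of_pos] <;> linarith)
  have h2 := hmem (r / 2) (by rw [abs_of_pos] <;> linarith)
  constructor
  · have : aOm Ω ≤ x 1 - r / 2 := by
      apply csInf_le
      · refine ⟨-M, ?_⟩
        rintro _ ⟨y, hy, rfl⟩
        exact (abs_le.1 (hM' y hy)).1
      · exact ⟨_, h1, by simp; ring⟩
    linarith
  · have : x 1 + r / 2 ≤ bOm Ω := by
      apply le_csSup
      · refine ⟨M, ?_⟩
        rintro _ ⟨y, hy, rfl⟩
        exact (abs_le.1 (hM' y hy)).2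
      · exact ⟨_, h2, by simp⟩
    linarith

theorem wrap {Ω : Set V2} (hΩ : IsOpen Ω) (hb : Bornology.IsBounded Ω) {a b : ℝ}
    (hab : ∀ x ∈ Ω, x 1 ∈ Ioo a b) {Θ : ℝ → ℝ} {Ψ : ℝ → V2} (hψ : BoundedVariationOn Ψ (Ioo a b))
    (hθ : BoundedVariationOn (fun t => ev (Θ t)) (Ioo a b)) {T : Set ℝ} (hT : Dense T)
    {u : V2 → V2} (hu : ∀ᵐ x ∂(volume.restrict Ω), u x = rig (Θ (x 1)) (Ψ (x 1)) x)
    (H : ∀ x ∈ Ω, ∃ δ > 0, ∀ s ∈ T, ∀ t ∈ T, s ∈ Ioo (x 1 - δ) (x 1 + δ) →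
      t ∈ Ioo (x 1 - δ) (x 1 + δ) → s < t → x 1 ∉ Icc s t → Tang Θ Ψ s t)
    {gu : V2 → Mat2} {σ : Measure V2} {gs : V2 → Mat2} (hBV : HasBVDerivOn Ω u gu σ gs)
    {lam : ℝ} (hlam : lam ∈ Ioo (0:ℝ) 1)
    (ε : ℕ → ℝ) (hεpos : ∀ n, 0 < ε n) (hε0 : Tendsto ε atTop (𝓝 0)) :
    ∃ un : ℕ → V2 → V2, ∃ Rn : ℕ → V2 → Mat2, ∃ γn : ℕ → V2 → ℝ,
      (∀ n, MemAeps Ω lam (ε n) (un n) (Rn n) (γn n)) ∧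
      WeakStarToBV Ω un u := by
  set θ : ℝ → ℝ := (Ioo a b).indicator Θ with hθd
  set ψ : ℝ → V2 := (Ioo a b).indicator Ψ with hψd
  have eθ : ∀ t ∈ Ioo a b, θ t = Θ t := fun t ht => indicator_of_mem ht _
  have eψ : ∀ t ∈ Ioo a b, ψ t = Ψ t := fun t ht => indicator_of_mem ht _
  have hψ' : BoundedVariationOn ψ (Ioo a b) := by
    unfold BoundedVariationOn
    rw [eVariationOn.eq_of_eqOn (f' := Ψ) (fun t ht => eψ t ht)]
    exact hψ
  have hθ' : BoundedVariationOn (fun t => ev (θ t)) (Ioo a b) := by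
    unfold BoundedVariationOn
    rw [eVariationOn.eq_of_eqOn (f' := fun t => ev (Θ t))
      (fun t ht => by simp only [eθ t ht])]
    exact hθ
  obtain ⟨B, hB⟩ : ∃ B, ∀ t, ‖ψ t‖ ≤ B := by
    rcases (Ioo a b).eq_empty_or_nonempty with h | ⟨s, hs⟩
    · exact ⟨0, fun t => by simp [hψd, h]⟩
    · refine ⟨‖Ψ s‖ + (eVariationOn Ψ (Ioo a b)).toReal, fun t => ?_⟩
      by_cases ht : t ∈ Ioo a b
      · rw [eψ t ht]
        have h1 := hψ.dist_le ht hs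
        rw [dist_eq_norm] at h1
        have := norm_sub_norm_le (Ψ t) (Ψ s)
        linarith
      · rw [hψd, indicator_of_notMem ht, norm_zero]
        positivity
  refine approx_core hΩ hb hab hψ' hθ' (A := max |a| |b|) (B := B) (by positivity) hB ?_ hT
    (u := u) ?_ ?_ hBV hlam ε hεpos hε0
  · intro t ht
    have : t ∉ Ioo a b := by
      intro h
      have : |t| < max |a| |b| := by
        rw [abs_lt]
        constructor
        · have := neg_abs_le a
          have := le_max_left |a| |b|
          linarith [h.1]
        · exact h.2.trans_le ((le_abs_self b).trans (le_max_right _ _))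
      linarith
    exact ⟨indicator_of_notMem this _, indicator_of_notMem this _⟩
  · rw [ae_restrict_iff' hΩ.measurableSet] at hu ⊢
    filter_upwards [hu] with x hx hxΩ
    rw [hx hxΩ, eθ _ (hab x hxΩ), eψ _ (hab x hxΩ)]
  · intro x hx
    obtain ⟨δ, hδ, h⟩ := H x hx
    obtain ⟨h1, h2⟩ := hab x hx
    set η := min δ (min (x 1 - a) (b - x 1)) with hη
    have k1 : η ≤ δ := min_le_left _ _
    have k2 : η ≤ x 1 - a := (min_le_right _ _).trans (min_le_left _ _)
    have k3 : η ≤ b - x 1 := (min_le_right _ _).trans (min_le_right _ _)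
    refine ⟨η, lt_min hδ (lt_min (by linarith) (by linarith)), ?_⟩
    intro s hs t ht hsI htI hst hn
    have := h s hs t ht ⟨by linarith [hsI.1], by linarith [hsI.2]⟩
      ⟨by linarith [htI.1], by linarith [htI.2]⟩ hst hn
    have is : s ∈ Ioo a b := ⟨by linarith [hsI.1], by linarith [hsI.2]⟩
    have it : t ∈ Ioo a b := ⟨by linarith [htI.1], by linarith [htI.2]⟩
    unfold Tang at this ⊢
    rw [eθ s is, eθ t it, eψ s is, eψ t it]
    exact this

/-- Theorem 1.3: approximation of maps in `(A ∩ SBV_∞) ∪ A∥`.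
For every `u ∈ (A ∩ SBV_∞(Ω;ℝ²)) ∪ A∥`, there is a sequence `u_ε ∈ A_ε` with
`u_ε ⇀* u` in `BV(Ω;ℝ²)`. -/
theorem approx_SBVinf_Apar
    (Ω : Set V2) (hΩlip : IsLipschitzDomain Ω) (hΩx1 : X1Connected Ω)
    (lam : ℝ) (hlam : lam ∈ Ioo (0:ℝ) 1)
    (ε : ℕ → ℝ) (hεpos : ∀ n, 0 < ε n) (hε0 : Tendsto ε atTop (𝓝 0))
    (u : V2 → V2)
    (hu : (memA Ω u ∧ memSBVinf Ω u) ∨ memApar Ω u) :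
    ∃ un : ℕ → V2 → V2, ∃ Rn : ℕ → V2 → Mat2, ∃ γn : ℕ → V2 → ℝ,
      (∀ n, MemAeps Ω lam (ε n) (un n) (Rn n) (γn n)) ∧
      WeakStarToBV Ω un u := by
  obtain ⟨hΩ, -, hb, -⟩ := hΩlip
  have hab := hab_om hΩ hb
  rcases hu with ⟨⟨gu', σ', gs', h2, ⟨R, ψ, hR, hRbv, hψbv, hu⟩, hdet⟩,
    ⟨gu, σ, gs, h1, hσ, -, hJ⟩⟩ | ⟨R, hR, ϑ, c, hϑ, hu⟩
  · have hang : ∀ t, ∃ θ : ℝ, t ∈ Ioo (aOm Ω) (bOm Ω) → R t 0 0 = Real.cos θ ∧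
        R t 1 0 = Real.sin θ ∧ R t 0 1 = -Real.sin θ ∧ R t 1 1 = Real.cos θ := by
      intro t
      by_cases ht : t ∈ Ioo (aOm Ω) (bOm Ω)
      · obtain ⟨θ, h⟩ := so2_angle (hR t ht)
        exact ⟨θ, fun _ => h⟩
      · exact ⟨0, fun h => absurd h ht⟩
    choose θ hθ using hang
    have hE := bvm_ev hRbv (fun t ht => ⟨(hθ t ht).1, (hθ t ht).2.1⟩)
    have hψ := bvv_v hψbv
    have hu' : ∀ᵐ x ∂(volume.restrict Ω), u x = rig (θ (x 1)) (ψ (x 1)) x := by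
      rw [ae_restrict_iff' hΩ.measurableSet] at hu ⊢
      filter_upwards [hu] with x hx hxΩ
      rw [hx hxΩ]
      exact mulVec_rig (hθ _ (hab x hxΩ)) x _
    have hT : Dense {t | t ∈ Ioo (aOm Ω) (bOm Ω) →
        ContinuousAt (fun t => ev (θ t)) t ∧ ContinuousAt ψ t} := by
      apply Measure.dense_of_ae (μ := (volume : Measure ℝ))
      filter_upwards [bv_ae_cont hE, bv_ae_cont hψ] with t a1 a2 ht
      exact ⟨a1 ht, a2 ht⟩
    refine wrap hΩ hb hab hψ hE hT hu' ?_ h1 hlam ε hεpos hε0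
    intro x hx
    obtain ⟨δ, hδ, h⟩ := local_tang hΩ hE hψ hab
      (hu'.mono fun x hx => by rw [hx, Jv_ev, rig]) h1 h2 hσ hdet hJ hx
    exact ⟨δ, hδ, fun s hs t ht => h s t hs ht⟩
  · obtain ⟨θ, hθ⟩ := so2_angle hR
    have he : R.mulVec e1 = ev θ := by
      have := mulVec_rig hθ e1 0
      rw [add_zero] at this
      rw [this]
      simp [rig, e1]
    have hw : vnorm (ev θ) = 1 := by simp [vnorm, ev]
    have hl := (Matrix.mulVecLin R).toContinuousLinearMap.lipschitz.add (LipschitzWith.const c)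
    obtain ⟨gu, σ, gs, hBV⟩ := apar_bv hΩ hb hab hϑ hw hl (u := u) (by
      filter_upwards [hu] with x hx
      rw [hx, he]
      simp only [LinearMap.coe_toContinuousLinearMap', Matrix.mulVecLin_apply]
      abel)
    refine wrap hΩ hb hab (Θ := fun _ => θ) (Ψ := fun t => c + ϑ t • ev θ) ?_ ?_ dense_univ ?_ ?_
      hBV hlam ε hεpos hε0
    · have hL := (LipschitzWith.const (α := ℝ) c).add
        ((ContinuousLinearMap.id ℝ ℝ).smulRight (ev θ)).lipschitz
      exact hL.comp_boundedVariationOn hϑ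
    · have hL := LipschitzWith.const (α := ℝ) (ev θ)
      exact hL.comp_boundedVariationOn hϑ
    · filter_upwards [hu] with x hx
      rw [hx, he, add_assoc, mulVec_rig hθ, add_comm c]
    · intro x hx
      refine ⟨1, one_pos, fun s _ t _ _ _ _ _ => ⟨rfl, ϑ t - ϑ s, ?_⟩⟩
      module
end
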